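/- The edge-inducibility constant λ_{7,10} equals 28/81. Moreover, the problem of maximising λ_{7,10} is perfectly stable with respect to the family of complete bipartite graphs (with possibly empty parts). -/

import Mathlib

open Finset
open scoped Classical

/-- Number of edges of `G` inside the vertex subset `S`. -/
noncomputable def edgeCount {n : ℕ} (G : SimpleGraph (Fin n)) (S : Finset (Fin n)) : ℕ :=
  (Finset.univ.filter (fun p : Fin n × Fin n =>
    p.1 ∈ S ∧ p.2 ∈ S ∧ p.1 < p.2 ∧ G.Adj p.1 p.2)).card

/-- `Λ_{κ,ℓ}(G)`: number of `κ`-subsets of vertices inducing exactly `ℓ` edges. -/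
noncomputable def numKL (κ ℓ : ℕ) {n : ℕ} (G : SimpleGraph (Fin n)) : ℕ :=
  ((Finset.powersetCard κ Finset.univ).filter (fun S => edgeCount G S = ℓ)).card

/-- `λ_{κ,ℓ}(G) = Λ_{κ,ℓ}(G) / C(n,κ)`. -/
noncomputable def lamKL (κ ℓ : ℕ) {n : ℕ} (G : SimpleGraph (Fin n)) : ℝ :=
  (numKL κ ℓ G : ℝ) / (n.choose κ : ℝ)

/-- `λ_{κ,ℓ}(n)`: the maximum of `λ_{κ,ℓ}(G)` over all graphs on `n` vertices. -/
noncomputable def lamKLmax (κ ℓ n : ℕ) : ℝ :=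
  ⨆ G : SimpleGraph (Fin n), lamKL κ ℓ G

/-- Edit distance between two graphs on `Fin n`: the minimum over bijections of the number
of vertex pairs whose adjacency must be changed in `G` to obtain a graph isomorphic to `H`. -/
noncomputable def editDist {n : ℕ} (G H : SimpleGraph (Fin n)) : ℕ :=
  ⨅ σ : Equiv.Perm (Fin n),
    (Finset.univ.filter (fun p : Fin n × Fin n =>
      p.1 < p.2 ∧ ¬ (G.Adj p.1 p.2 ↔ H.Adj (σ p.1) (σ p.2)))).card

/-- Edit distance of `G` to the family of `n`-vertex graphs satisfying `P`. -/
noncomputable def distToFam {n : ℕ} (G : SimpleGraph (Fin n))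
    (P : SimpleGraph (Fin n) → Prop) : ℕ :=
  ⨅ H : {H : SimpleGraph (Fin n) // P H}, editDist G H.1

/-- A complete bipartite graph (with possibly empty parts). -/
def isCompleteBipartite {n : ℕ} (G : SimpleGraph (Fin n)) : Prop :=
  ∃ c : Fin n → Fin 2, ∀ u v, G.Adj u v ↔ c u ≠ c v

inductive TTree | em | lf (k : Nat) (l : List Nat) | nd (x y : TTree)

noncomputable def tSel (t : TTree) : Nat → TTree :=
  TTree.rec (fun _ => .em) (fun k l _ => .lf k l)
    (fun _ _ ix iy h => Nat.rec (ix (Nat.div h 2)) (fun _ _ => iy (Nat.div h 2)) (Nat.mod h 2)) t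

def gT (x y : Nat) : Nat := Nat.add (Nat.mul x y) (Nat.mul 4096 (Nat.sub 16384 (Nat.add x y)))

noncomputable def wL (k : Nat) (l : List Nat) (x y : Nat) : Nat :=
  List.rec (Nat.mul 50331648 k) (fun p _ ih => Nat.add (gT (Nat.mod (Nat.shiftRight p x) 8192) (Nat.mod (Nat.shiftRight p y) 8192)) ih) l

noncomputable def wT (t : TTree) (x y : Nat) : Nat :=
  TTree.rec 301989888 (fun k l => wL k l (Nat.mul 13 x) (Nat.mul 13 y)) (fun _ _ _ _ => 301989888) t

def tab5 : TTree := (.nd (.nd (.nd (.nd (.nd .em (.nd (.lf 1 [2276182972485205243990972085939563529212933228348524513767406089922828666999241877009066757063086434493993374896161634250525436082991648007529713913153646624, 1716406234710740212688503287561228345056305541708112669006645986483568238860179438603189037267428153549035984274333793029982314088420410168591567669345791890, 1716371498202966223560786440134439758514548180471090552712223969970304930943233240090558173605641797926877552428224486169021678233050562718314002231615483739, 1716398401382024869976781008928730862595299314406017941737991965068847828447331626637957716703969501049508020054232149510358270786558543648252960707515723513, 1716394667670862738439960221516409132048931809696645584803574182266049032869488722272504310865429623208028066092168793058502847311596653542603551809656803718])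 (.lf 2 [1716433387086498636629756275308287585134793452562937532782549238206817402476466069920742522642555396661230523521757417992066064802094586460794571738432459174, 1716443356989869792403340280893597387761672917267649396282518057055747500735377686553782888060450496720349484916641336062882278682726800649725164262253908247, 1716430009111070807804285601781367060396017817327343715558393734824123061522084726881446247641557250752413433283183903310555909406918496361179428201777320005, 1716407760608944612940176100210825961709762491546477675420422147512168761435956473000053917265116643194369549944319292769863804236923950786688653233300443345]))) (.nd (.nd (.lf 3 [1716408937608044035705956527891714175267023535697843297957880956027634625444657709125146076563909705345513207973418279019013439913583504590003081789887745597, 1716408937608044035683425159607240621205782515390178401276748849951648600219112294462294065451163794559850217735717569534739899597651061248040649913830215429, 1716408937608044035683425148516561844722523072942641780204158968107380673794049214472894274000380932031539498075135521000620110563135988464887088557401838027]) .em) .em)) (.nd (.nd (.nd (.lf 4 [1716408937608044035683424836591221256130755313890884062198709851749530771114068446071721575757601827056848125726036696381688631791855046143665759161948188478, 1716408937608044035683424836591221256130884302275142507588793253408296971896324716438755325770860932812778914787469685186101786978863905515953188945447095988]) .em) (.nd (.lf 5 [1716408934436347508553813660722434097009998733911368743178553658438010977259993106138127114466651322738774231189264624090464497629576551851320636633977458867])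 .em)) (.nd (.nd (.lf 2 [1716408937608044035683424535678882723465709724973121290105354969207452426333155489997766571829279050051076883645289278927435337945469199429631241616317664951, 1716408937608044035683425841638631647019476581900554872506254868842578578880638565895441277089672554769400765197341726390406036706927520837955229669133782767, 1716408937608044035683424466525616867303291553039179534585839706033994352054781360981532379808493433399986659837800535498775629447664898714799509812622618676, 1716408937608044035683425277445702621340414033570161404795541657699591509000629518001485514270045269553524261119917573516043816385893314949668482127008567027]) .em) (.nd (.lf 3 [1716408937608044035683924071019331026510800181757439101044042852995381556453939240921079479682168775945142884738660986151296475977108315759284978376528367291, 1716408937608044035682879179354422820947708618058488043355580346140474311996485210950579066893576220884487816566734399756995250965805121504911155761688613507, 1716408937608044035683765378655722868732719641010816763728840929091382518099851330700858099627386550757431628381986589519338695910321144218478323209663942656]) .em)))) (.nd (.nd (.nd (.nd (.lf 5 [1716408937608044035683424836591221256130851360602306126070385176859516046282616420740001439345285638305584682605106826352066824369779503340692595454153543435]) .em) .em) (.nd (.nd (.lf 1 [1716408937608044035701345206606283138091530251978136545656045391093512938234545549408233168728035809397052010105614363460354707417264172969250115819081174939, 1716408937608044035684015652242127986158129455804808080447322168770305048594230041428559691100009983862052858901791340907104036787107919027780119694733332492,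 1716408937608044035692635175310008316797964755110728023960231392588500258692621575758365541407607657329357966337865390914801721082776140798364671774066667359, 1716408937608044035683424681390933589521433404836481754956759185798857666127499594077125992768994291076356934225234198811541650080827267323729257600487370696, 1716408937608044035683424544057983954239873924504882289588962388077750853872298116411617935642464027586711324269256595987131794918379991699924442642001441099]) .em) (.nd (.lf 1 [1716402442860133080072537530660124914253091333389388280358012162478446665372254760264595193771714708307587871776418516417554178004657904265844563138245037637, 1716400811684080568951089093398641246876983182234245772559577064498378787910242009725920650620652868939019856205253735758543073834563717191630386451372315153, 1716416405030368298751148882690248219248039273131348170433949460112356600024680206548372450827395694280728627870286811079315873437064842352028184868353477942, 1716405715364164387922507947674695545634666025417669317457751256856305342084875238384940812302715119749954120191726768423129908936727349486144786550302445281, 1716386944514897233481337300414456224892536229987331464727781502438652883041502848112513852072581796653217900674810900464448038070056109148139284193796427922]) .em))) (.nd (.nd (.nd (.lf 2 [1716408937608044035683424836591221256130704850212472695081472870090853001532452536319518809370330137475644160030381886163691394889638111718333694252943323082, 1716408937608044035683424836591221256130866748291508973148882683791253335549968842631219424819439701265681868865581524325789085160008241780480911166713941943, 1716408937608044035683424836591221256130887379203661960503787738996467581467654065094936877344934026402354588140469273228619690602425117009774587760287928763,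 1716408937608044035683424836591221256130824577410004619287490581524039663123286804836411329547292220186583293518856838118044344591082962777146883572467798016]) .em) (.nd (.lf 1 [1716446224503218170666432194898926874508619480351814709000043305830788912839926425733847801691757418580986013983732552066816835506886175080687391562717466594, 1716432563213351728536163638073363499037473974391721151294659886150599094483514708831055292664709001275514624750524714150460212487127826171671970627287257316, 1716408373401941542881095896297708268993292762980709437006805023006681432213233672501156425980865410786848091567577453129068119850790536785374778900797722439, 1716403668027812634179667126896435963067639109359167099629816880662925527785891798727669165672976538273398926665521015146084364314571098654687579413831225372, 1716453331282419409937003297274256689557963530145924906526625311718540975337977209476460857578827512810207258209591513614064126025270680339076037293715230678]) .em)) (.nd (.nd (.lf 2 [1716447093067317325087097154131055931382386794175852791336470472433056051664382492734524253445614519176709979400784715080807164029405267596442965412558147305, 1716399731196959327784415985961319678957333290719447396950376871620914848131415713595033560983695010911980923212210226537775697017530109043863458791206948753, 1716427248136756954727009239977958195109737786110554513490296967654970109377778836864003895634494432749743300733760945496114121087635358197757734474511028668, 1716437477482406630170354197126720944425294878394689046035417016540361848543236051366202534524915336591875428306141344021504369807477608006130222509770936199]) .em) (.nd (.lf 5 [1747833487693586881660830836191293986375584428704207399437880209888018060240886654804924692029548860486008193352696582660216493499141942150541019625319042876])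 .em))))) (.nd (.nd (.nd (.nd (.nd .em (.lf 1 [1716383928724736212307098210052001657737145884321185691821609422496367936130722457730598996596481801148028086161990917695791208435703072053954812815490421086, 1716394001808140453143719455994866964175630944820332931959513222786450874320494047478963979017320584742049263694811316862639398106965366000493787228615478637, 1716368175107877909288449148834118836070679740305882687185142274589495493022083362567054075439278294913613937648607891271002140450779851175144955102413983884, 1716383008776655919699942296465687318210484167758502342905949031048646302611988227736542138095565584755349493093457101063076638123714015588141114386683006570, 1716412771346273216446256444745804565499051583315771614055051352000676688739342547228629090135742690031726563066009403074099235861024338453703153022197042958])) .em) (.nd (.nd .em (.lf 2 [1696716217176081023336839296317089391966568720318248069665933294999988968110088063766103112387942651595171397346410578267039258749620134626492707499933700559, 1591967722293644361159030568262691402548359302173371010480794245604728605304161259448691932591806779746053962672362325261330190474346602032688246979507000426, 1668224629920166870565385089746052850698893677238271204612436386208756506633956932422036493170051474852534367716727756313178054220460622483771587536724430848, 1718922902550163329036289104813116670916964144199542849737409012315105642095448837073590404483630473683197695056002175236019491699388647587698487286120321024])) (.nd (.lf 2 [1716414154574325370159529475755864760313015982029448751867378382824402419844616609085102603303779907111044326489880411188231994071748870459677943094438793194,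 1716439932525362552276757573436642317189041930438880797075429108370305720271722393925287340118465887829452746907233584302153228877941067097166082097822044281, 1716420496768628168934403954222363285196553039287172292312807018607917214048135318081605362423482464489462833852383763070094585989363392473915729612145430351, 1716420650208812914066053384651170464336770089897751955093538725335537192504462733314537371833389036766784171744740450158608989998831878128880139694044614405]) .em))) (.nd (.nd (.nd (.lf 2 [1748200462109767548050781221219963356532828886221216598550496342441488437420655873950823253304605022111306258339843089427106584201091894221823004978685415497, 1396725624986114280098423881907551355455362275310626951093548164272470293653987550999891032990168591470714750846431128664074373560199451310103240811369993610, 1515270646610600998495109685714066812139937152752612965746041072915586604355436956778879367579314391784606606980838664331230929401150379676992976699854426112, 1809845774220907813368140717021606197750692821679664013819867170387404440043093357968998411432480597323894997320213018957705540241005026963310580014247841792]) (.lf 3 [1716455938429451697640607366766831643734612515149618861568186489558932464187347856010451298991206265022163800587604631728747047096935079388996485113599496451, 1716394411512663693717216040691941086331116997970912127548986221099637704374672191138904674972526559285899420501999067361825076089565007885972765756702592477, 1716396353920803174227365387956469428811458899579843492099586556714459643938066059903578423067128136190767816947052639339445549176449703170925683787415162496])) .em) (.nd (.nd (.lf 3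 [1716385205251422916224936192676326014390020682151811043180464382902838315446605274741620301037972002604406435839038273241057601076619349825428606294389953730, 1716382187675621724285406225838392416034597678579773652650754742402507795574389209546012170376439368582238338439620703121778321404367257457184073591382085632, 1716389859422632102637316324419313729886772688112923631745564782244062836339327735740584492938953093136075147084116680654952691673864611358427934657045598208]) (.lf 5 [1716408937608044035683424837948956177757517475006457554255129888507034129100144609938625452105805284303778864046116128424407499578973426727648888992116510448])) (.nd (.lf 0 [1923417800463007848184993180225056765921734139085882221649873058336883114525401782769467636853445915571036035160464944576821660235538860589975040192798986324, 1936789700305432516766229854816388202501143760593954519055648718315634850456344922447480718690315331980154427416371765328100823422712452362253708521086791933, 2193226252956633155445030242973497700611003714771883544897047927072804495952254871653548308399857232335082744082889327967489444264639987122321815490499342464, 1716401779388670184308182749514887126092388902592350312292259389991805476021624214181498656402151899774337773599100597264023078675555319699468469040707956629, 1716399937282311625444958653279538896856215855983293593728107530924164531605298268319626679187908524771951426378617812069694606552229693972106981004016275335, 1716405765805377463924573739754492068379431116657819219829968553651282218871543735392002603864661760033744058637396822788726744710605412148416851289414677013]) .em)))) (.nd (.nd (.nd (.nd .em (.lf 1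 [1716421568777080347446125216998068730065151371351820240666667193301583735412862665612577058111859049294912468267115830753878980024040260992360344285331067076, 1716401418389667825766034330770424574202403560924571018527524539702806178184617894705974034087770544585793300920898309390335230500799081061833749555304206519, 1716456296469036430483681487445660081753988485965748990409426380880627617436455181989148367265949530376457293727958666613139760033682750864926736696408543363, 1716408934436347508561093689060393132190979752038440456114804016613174612623000131801256958685612909557878959577476715004088914535152289427377918406668849001, 1716408936072143748932226309411731863453469783629675938204498357911399603986642683827627902448670631197203403473238087842056365166757213995493806488120463254])) .em) (.nd (.nd (.lf 3 [1722693847575204628073850160809130246503107306077592829328564420856853801184032040220704267370944880748564846142602214834575610587158334535220459292237762640, 1808587617126399390742996258453886448257272004825568121994164916483574308919774322247771851539048585381655346498216480229834665316971670868743006357777551464, 1643084987991170457795129387382283035121198577944956296201324113879845718342051437620957857710817757066253348578268532232797408061840481018444941163063414529]) .em) .em)) (.nd (.nd (.nd (.lf 1 [1435691961922976147804881676356116520106376096725648613858864256738846925170617180427076519264607529167551651650004670991309837668945638993141870274895942813, 1759168983023227263208668439980169840543926244682731809524570985096253758806361075351351826142257720631496473432654384320530832652482016865897977524986580992, 1733557821017331312840532205604973664893175837617117687042768087082287084560391090174437777959438051506345520039899247445695510831109341568086890067301240832,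 1807726256149849971344933646554089120347985777963265266018327230016725403358884531413064222531268461057256543752169534716931832721995761891117924461873991680, 1720583071773657032967927228759541694831198318231773860115232182565280841558575668138542768584320754836863319213511488356993832205798665572018012184167583744]) (.lf 2 [1716411135581250336368499076671725197822556577298280806139936223554549438254318755260451405383960931194316599359878055920414681185958893695918024248573039189, 1716408937377034642960041411468983061126157053976909863464580352121542991206899243231348229833708299987287773093966378244064206687563948904062655509808812291, 1716405511439062087076895019586156002454140140623866980956618501980611052875597842923076643863788204553102940386489826181954623600418195870009577391299497853, 1716406737555753200487899770410573559396897384277765082930122133858372708423412344728152181228193568593504160717644637728662778644198719245367190497592872721])) (.nd (.lf 4 [1716408937608044035697188710018286210435674919370407494095148978320165791509164092749229698317959097702217654913700591183123609960186997494523463108782427905, 1716408937608044035683425033413200405890418982294077949420379896892469626571392950865361517779607439989546678163326256830252190895308358237998205727068991864]) .em)) (.nd (.nd .em (.lf 5 [1548392344485950865779387539206550692353714865987548553281383094177330380119550437924637521239407136265505509523225078671245156197406158402539742032109243822])) (.nd (.lf 5 [1690054358356589713715781456781172126043987641639293717196639585248175100765854194001489429444371284848705695260357497545358921793910214460733546204645888595])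 .em))))))

def tab1 : List Nat := [18510827609656212512818247380509009265742511197850122300254595089821725692065478498635038539323955734598734028, 18419087665018311767023075129556440085828815041655908776875352017123551278127919602742686660382729146351464448, 18015431908604751708026368490356346870277791548712206931768735940507000901873981664461271304565599219220140032, 18978701327319572155280468595823467896299936786432249673549649603611775057017561345872915782755535654550065152]

noncomputable def pairT (base a c dx dy gx gy wx wy : Nat) : Nat :=
  wT (tSel tab5 (Nat.mod (Nat.sub (Nat.add (Nat.add base (Nat.add dx dy)) (Nat.add (Nat.mul 2 c) (Nat.mul a (Nat.sub (Nat.add (Nat.mul 2 (Nat.add dx dy)) (Nat.mul 60 c)) 2)))) (Nat.add gx gy)) 49))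
    (Nat.mod (Nat.sub wx (Nat.add (Nat.mul 5 c) (Nat.mul a (Nat.sub (Nat.add (Nat.mul 5 dy) (Nat.mul 10 c)) 4)))) 40)
    (Nat.mod (Nat.sub wy (Nat.add (Nat.mul 5 c) (Nat.mul a (Nat.sub (Nat.add (Nat.mul 5 dx) (Nat.mul 10 c)) 4)))) 40)

def rootT2 (W : Nat → Nat → Nat) (r0 r1 r2 r3 r4 r5 w01 w02 w03 w04 w05 w12 w13 w14 w15 w23 w24 w25 w34 w35 w45 : Nat) : Nat :=
  (Nat.add (Nat.add (Nat.add (Nat.add (Nat.add (Nat.add (Nat.add (Nat.add (Nat.add (W (Nat.mul 13 (Nat.add (Nat.add (Nat.add r0 r1) r2) (Nat.add (Nat.add w01 w02) w12))) (Nat.mul 13 (Nat.add (Nat.add (Nat.add r3 r4) r5) (Nat.add (Nat.add w34 w35) w45)))) (W (Nat.mul 13 (Nat.add (Nat.add (Nat.add r0 r1) r3) (Nat.add (Nat.add w01 w03) w13))) (Nat.mul 13 (Nat.add (Nat.add (Nat.add r2 r4) r5) (Nat.add (Nat.add w24 w25) w45))))) (W (Nat.mul 13 (Nat.add (Nat.add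 (Nat.add r0 r1) r4) (Nat.add (Nat.add w01 w04) w14))) (Nat.mul 13 (Nat.add (Nat.add (Nat.add r2 r3) r5) (Nat.add (Nat.add w23 w25) w35))))) (W (Nat.mul 13 (Nat.add (Nat.add (Nat.add r0 r1) r5) (Nat.add (Nat.add w01 w05) w15))) (Nat.mul 13 (Nat.add (Nat.add (Nat.add r2 r3) r4) (Nat.add (Nat.add w23 w24) w34))))) (W (Nat.mul 13 (Nat.add (Nat.add (Nat.add r0 r2) r3) (Nat.add (Nat.add w02 w03) w23))) (Nat.mul 13 (Nat.add (Nat.add (Nat.add r1 r4) r5) (Nat.add (Nat.add w14 w15) w45))))) (W (Nat.mul 13 (Nat.add (Nat.add (Nat.add r0 r2) r4) (Nat.add (Nat.add w02 w04) w24))) (Nat.mul 13 (Nat.add (Nat.add (Nat.add r1 r3) r5) (Nat.add (Nat.add w13 w15) w35))))) (W (Nat.mul 13 (Nat.add (Nat.add (Nat.add r0 r2) r5) (Nat.add (Nat.add w02 w05) w25))) (Nat.mul 13 (Nat.add (Nat.add (Nat.add r1 r3) r4) (Nat.add (Nat.add w13 w14) w34))))) (W (Nat.mul 13 (Nat.add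 (Nat.add (Nat.add r0 r3) r4) (Nat.add (Nat.add w03 w04) w34))) (Nat.mul 13 (Nat.add (Nat.add (Nat.add r1 r2) r5) (Nat.add (Nat.add w12 w15) w25))))) (W (Nat.mul 13 (Nat.add (Nat.add (Nat.add r0 r3) r5) (Nat.add (Nat.add w03 w05) w35))) (Nat.mul 13 (Nat.add (Nat.add (Nat.add r1 r2) r4) (Nat.add (Nat.add w12 w14) w24))))) (W (Nat.mul 13 (Nat.add (Nat.add (Nat.add r0 r4) r5) (Nat.add (Nat.add w04 w05) w45))) (Nat.mul 13 (Nat.add (Nat.add (Nat.add r1 r2) r3) (Nat.add (Nat.add w12 w13) w23)))))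

def rootT (W : Nat → Nat → Nat) (r0 r1 r2 r3 r4 r5 b01 b02 b03 b04 b05 b12 b13 b14 b15 b23 b24 b25 b34 b35 b45 : Nat) : Nat :=
  rootT2 W r0 r1 r2 r3 r4 r5 (Nat.mul b01 (Nat.add 6 (Nat.mul 1 (Nat.add r0 r1)))) (Nat.mul b02 (Nat.add 6 (Nat.mul 1 (Nat.add r0 r2)))) (Nat.mul b03 (Nat.add 6 (Nat.mul 1 (Nat.add r0 r3)))) (Nat.mul b04 (Nat.add 6 (Nat.mul 1 (Nat.add r0 r4)))) (Nat.mul b05 (Nat.add 6 (Nat.mul 1 (Nat.add r0 r5)))) (Nat.mul b12 (Nat.add 6 (Nat.mul 1 (Nat.add r1 r2)))) (Nat.mul b13 (Nat.add 6 (Nat.mul 1 (Nat.add r1 r3)))) (Nat.mul b14 (Nat.add 6 (Nat.mul 1 (Nat.add r1 r4)))) (Nat.mul b15 (Nat.add 6 (Nat.mul 1 (Nat.add r1 r5)))) (Nat.mul b23 (Nat.add 6 (Nat.mul 1 (Nat.add r2 r3)))) (Nat.mul b24 (Nat.add 6 (Nat.mul 1 (Nat.add r2 r4)))) (Nat.mul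 b25 (Nat.add 6 (Nat.mul 1 (Nat.add r2 r5)))) (Nat.mul b34 (Nat.add 6 (Nat.mul 1 (Nat.add r3 r4)))) (Nat.mul b35 (Nat.add 6 (Nat.mul 1 (Nat.add r3 r5)))) (Nat.mul b45 (Nat.add 6 (Nat.mul 1 (Nat.add r4 r5))))

def x5C (F : Nat → Nat → Nat → Nat → Nat → Nat → Nat → Nat → Nat → Nat) (base a01 a02 a12 a03 a13 a23 a04 a14 a24 a34 a05 a15 a25 a35 a45 a06 a16 a26 a36 a46 a56 c01 c02 c12 c03 c13 c23 c04 c14 c24 c34 c05 c15 c25 c35 c45 c06 c16 c26 c36 c46 c56 d0 d1 d2 d3 d4 d5 d6 g0 g1 g2 g3 g4 g5 g6 w0 w1 w2 w3 w4 w5 w6 : Nat) : Nat :=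
  (Nat.add (Nat.add (Nat.add (Nat.add (Nat.add (Nat.add (Nat.add (Nat.add (Nat.add (Nat.add (Nat.add (Nat.add (Nat.add (Nat.add (Nat.add (Nat.add (Nat.add (Nat.add (Nat.add (Nat.add (F base a01 c01 d0 d1 g0 g1 w0 w1) (F base a02 c02 d0 d2 g0 g2 w0 w2)) (F base a12 c12 d1 d2 g1 g2 w1 w2)) (F base a03 c03 d0 d3 g0 g3 w0 w3)) (F base a13 c13 d1 d3 g1 g3 w1 w3)) (F base a23 c23 d2 d3 g2 g3 w2 w3)) (F base a04 c04 d0 d4 g0 g4 w0 w4)) (F base a14 c14 d1 d4 g1 g4 w1 w4)) (F base a24 c24 d2 d4 g2 g4 w2 w4)) (F base a34 c34 d3 d4 g3 g4 w3 w4)) (F base a05 c05 d0 d5 g0 g5 w0 w5)) (F base a15 c15 d1 d5 g1 g5 w1 w5)) (F base a25 c25 d2 d5 g2 g5 w2 w5)) (F base a35 c35 d3 d5 g3 g5 w3 w5)) (F base a45 c45 d4 d5 g4 g5 w4 w5)) (F base a06 c06 d0 d6 g0 g6 w0 w6)) (F base a16 c16 d1 d6 g1 g6 w1 w6)) (F base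 a26 c26 d2 d6 g2 g6 w2 w6)) (F base a36 c36 d3 d6 g3 g6 w3 w6)) (F base a46 c46 d4 d6 g4 g6 w4 w6)) (F base a56 c56 d5 d6 g5 g6 w5 w6))

def x1C (W : Nat → Nat → Nat) (a01 a02 a12 a03 a13 a23 a04 a14 a24 a34 a05 a15 a25 a35 a45 a06 a16 a26 a36 a46 a56 : Nat) : Nat :=
  (Nat.add (Nat.add (Nat.add (Nat.add (Nat.add (Nat.add (rootT W a01 a02 a03 a04 a05 a06 a12 a13 a14 a15 a16 a23 a24 a25 a26 a34 a35 a36 a45 a46 a56) (rootT W a01 a12 a13 a14 a15 a16 a02 a03 a04 a05 a06 a23 a24 a25 a26 a34 a35 a36 a45 a46 a56)) (rootT W a02 a12 a23 a24 a25 a26 a01 a03 a04 a05 a06 a13 a14 a15 a16 a34 a35 a36 a45 a46 a56)) (rootT W a03 a13 a23 a34 a35 a36 a01 a02 a04 a05 a06 a12 a14 a15 a16 a24 a25 a26 a45 a46 a56)) (rootT W a04 a14 a24 a34 a45 a46 a01 a02 a03 a05 a06 a12 a13 a15 a16 a23 a25 a26 a35 a36 a56)) (rootT W a05 a15 a25 a35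 a45 a56 a01 a02 a03 a04 a06 a12 a13 a14 a16 a23 a24 a26 a34 a36 a46)) (rootT W a06 a16 a26 a36 a46 a56 a01 a02 a03 a04 a05 a12 a13 a14 a15 a23 a24 a25 a34 a35 a45))

noncomputable def chkF (D Q T x5 x1 : Nat) : Bool :=
  Nat.ble (Nat.add (Nat.add (bif Nat.beq D 20 then 8427240 else 0) (Nat.add x5 x1)) (Nat.mul 100 (Nat.add (Nat.mul 21 D) (Nat.mul 4 T)))) (Nat.add 27483992928 (Nat.mul 600 Q))

noncomputable def chkC (a01 a02 a12 a03 a13 a23 a04 a14 a24 a34 a05 a15 a25 a35 a45 a06 a16 a26 a36 a46 a56 c01 c02 c12 c03 c13 c23 c04 c14 c24 c34 c05 c15 c25 c35 c45 c06 c16 c26 c36 c46 c56 d0 d1 d2 d3 d4 d5 d6 s0 s1 s2 s3 s4 s5 s6 t0 t1 t2 t3 t4 t5 t6 : Nat) : Bool :=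
  (fun D Q T => chkF D Q T (x5C pairT (Nat.add Q (Nat.mul 10 T)) a01 a02 a12 a03 a13 a23 a04 a14 a24 a34 a05 a15 a25 a35 a45 a06 a16 a26 a36 a46 a56 c01 c02 c12 c03 c13 c23 c04 c14 c24 c34 c05 c15 c25 c35 c45 c06 c16 c26 c36 c46 c56 d0 d1 d2 d3 d4 d5 d6 (Nat.add (Nat.mul d0 d0) (Nat.add (Nat.mul 2 s0) (Nat.mul 30 t0))) (Nat.add (Nat.mul d1 d1) (Nat.add (Nat.mul 2 s1) (Nat.mul 30 t1))) (Nat.add (Nat.mul d2 d2) (Nat.add (Nat.mul 2 s2) (Nat.mul 30 t2))) (Nat.add (Nat.mul d3 d3) (Nat.add (Nat.mul 2 s3) (Nat.mul 30 t3))) (Nat.add (Nat.mul d4 d4) (Nat.add (Nat.mul 2 s4) (Nat.mul 30 t4))) (Nat.add (Nat.mul d5 d5) (Nat.add (Nat.mul 2 s5) (Nat.mul 30 t5))) (Nat.add (Nat.mul d6 d6) (Nat.add (Nat.mul 2 s6) (Nat.mul 30 t6))) (Nat.sub (Nat.add (Nat.mul 5 s0) (Nat.mul 5 t0)) (Nat.mul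 4 d0)) (Nat.sub (Nat.add (Nat.mul 5 s1) (Nat.mul 5 t1)) (Nat.mul 4 d1)) (Nat.sub (Nat.add (Nat.mul 5 s2) (Nat.mul 5 t2)) (Nat.mul 4 d2)) (Nat.sub (Nat.add (Nat.mul 5 s3) (Nat.mul 5 t3)) (Nat.mul 4 d3)) (Nat.sub (Nat.add (Nat.mul 5 s4) (Nat.mul 5 t4)) (Nat.mul 4 d4)) (Nat.sub (Nat.add (Nat.mul 5 s5) (Nat.mul 5 t5)) (Nat.mul 4 d5)) (Nat.sub (Nat.add (Nat.mul 5 s6) (Nat.mul 5 t6)) (Nat.mul 4 d6))) (x1C (wL 2 tab1) a01 a02 a12 a03 a13 a23 a04 a14 a24 a34 a05 a15 a25 a35 a45 a06 a16 a26 a36 a46 a56)) (Nat.add (Nat.add (Nat.add (Nat.add (Nat.add (Nat.add d0 d1) d2) d3) d4) d5) d6) (Nat.add (Nat.add (Nat.add (Nat.add (Nat.add (Nat.add (Nat.mul d0 d0) (Nat.mul d1 d1)) (Nat.mul d2 d2)) (Nat.mul d3 d3)) (Nat.mul d4 d4)) (Nat.mul d5 d5)) (Nat.mul d6 d6)) (Nat.add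 (Nat.add (Nat.add (Nat.add (Nat.add (Nat.add t0 t1) t2) t3) t4) t5) t6)

def maxD (d0 d1 d2 d3 d4 d5 d6 : Nat) : Bool :=
  bif Nat.ble d0 d6 then bif Nat.ble d1 d6 then bif Nat.ble d2 d6 then bif Nat.ble d3 d6 then bif Nat.ble d4 d6 then Nat.ble d5 d6 else false else false else false else false else false

noncomputable def chkB (a01 a02 a12 a03 a13 a23 a04 a14 a24 a34 a05 a15 a25 a35 a45 a06 a16 a26 a36 a46 a56 c01 c02 c12 c03 c13 c23 c04 c14 c24 c34 c05 c15 c25 c35 c45 c06 c16 c26 c36 c46 c56 d0 d1 d2 d3 d4 d5 d6 : Nat) : Bool :=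
  bif maxD d0 d1 d2 d3 d4 d5 d6 then chkC a01 a02 a12 a03 a13 a23 a04 a14 a24 a34 a05 a15 a25 a35 a45 a06 a16 a26 a36 a46 a56 c01 c02 c12 c03 c13 c23 c04 c14 c24 c34 c05 c15 c25 c35 c45 c06 c16 c26 c36 c46 c56 d0 d1 d2 d3 d4 d5 d6 (Nat.add (Nat.add (Nat.add (Nat.add (Nat.add (Nat.mul a01 d1) (Nat.mul a02 d2)) (Nat.mul a03 d3)) (Nat.mul a04 d4)) (Nat.mul a05 d5)) (Nat.mul a06 d6)) (Nat.add (Nat.add (Nat.add (Nat.add (Nat.add (Nat.mul a01 d0) (Nat.mul a12 d2)) (Nat.mul a13 d3)) (Nat.mul a14 d4)) (Nat.mul a15 d5)) (Nat.mul a16 d6)) (Nat.add (Nat.add (Nat.add (Nat.add (Nat.add (Nat.mul a02 d0) (Nat.mul a12 d1)) (Nat.mul a23 d3)) (Nat.mul a24 d4)) (Nat.mul a25 d5)) (Nat.mul a26 d6)) (Nat.add (Nat.add (Nat.add (Nat.add (Nat.add (Nat.mul a03 d0) (Nat.mul a13 d1)) (Nat.mul a23 d2)) (Nat.mul a34 d4))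 (Nat.mul a35 d5)) (Nat.mul a36 d6)) (Nat.add (Nat.add (Nat.add (Nat.add (Nat.add (Nat.mul a04 d0) (Nat.mul a14 d1)) (Nat.mul a24 d2)) (Nat.mul a34 d3)) (Nat.mul a45 d5)) (Nat.mul a46 d6)) (Nat.add (Nat.add (Nat.add (Nat.add (Nat.add (Nat.mul a05 d0) (Nat.mul a15 d1)) (Nat.mul a25 d2)) (Nat.mul a35 d3)) (Nat.mul a45 d4)) (Nat.mul a56 d6)) (Nat.add (Nat.add (Nat.add (Nat.add (Nat.add (Nat.mul a06 d0) (Nat.mul a16 d1)) (Nat.mul a26 d2)) (Nat.mul a36 d3)) (Nat.mul a46 d4)) (Nat.mul a56 d5)) (Nat.add (Nat.add (Nat.add (Nat.add (Nat.add (Nat.mul a01 c01) (Nat.mul a02 c02)) (Nat.mul a03 c03)) (Nat.mul a04 c04)) (Nat.mul a05 c05)) (Nat.mul a06 c06)) (Nat.add (Nat.add (Nat.add (Nat.add (Nat.add (Nat.mul a01 c01) (Nat.mul a12 c12)) (Nat.mul a13 c13)) (Nat.mul a14 c14)) (Nat.mul a15 c15)) (Nat.mul a16 c16)) (Nat.add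 (Nat.add (Nat.add (Nat.add (Nat.add (Nat.mul a02 c02) (Nat.mul a12 c12)) (Nat.mul a23 c23)) (Nat.mul a24 c24)) (Nat.mul a25 c25)) (Nat.mul a26 c26)) (Nat.add (Nat.add (Nat.add (Nat.add (Nat.add (Nat.mul a03 c03) (Nat.mul a13 c13)) (Nat.mul a23 c23)) (Nat.mul a34 c34)) (Nat.mul a35 c35)) (Nat.mul a36 c36)) (Nat.add (Nat.add (Nat.add (Nat.add (Nat.add (Nat.mul a04 c04) (Nat.mul a14 c14)) (Nat.mul a24 c24)) (Nat.mul a34 c34)) (Nat.mul a45 c45)) (Nat.mul a46 c46)) (Nat.add (Nat.add (Nat.add (Nat.add (Nat.add (Nat.mul a05 c05) (Nat.mul a15 c15)) (Nat.mul a25 c25)) (Nat.mul a35 c35)) (Nat.mul a45 c45)) (Nat.mul a56 c56)) (Nat.add (Nat.add (Nat.add (Nat.add (Nat.add (Nat.mul a06 c06) (Nat.mul a16 c16)) (Nat.mul a26 c26)) (Nat.mul a36 c36)) (Nat.mul a46 c46)) (Nat.mul a56 c56)) else true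

noncomputable def chkA (a01 a02 a12 a03 a13 a23 a04 a14 a24 a34 a05 a15 a25 a35 a45 a06 a16 a26 a36 a46 a56 : Nat) : Bool :=
  chkB a01 a02 a12 a03 a13 a23 a04 a14 a24 a34 a05 a15 a25 a35 a45 a06 a16 a26 a36 a46 a56 (Nat.add (Nat.add (Nat.add (Nat.add (Nat.mul a02 a12) (Nat.mul a03 a13)) (Nat.mul a04 a14)) (Nat.mul a05 a15)) (Nat.mul a06 a16)) (Nat.add (Nat.add (Nat.add (Nat.add (Nat.mul a01 a12) (Nat.mul a03 a23)) (Nat.mul a04 a24)) (Nat.mul a05 a25)) (Nat.mul a06 a26)) (Nat.add (Nat.add (Nat.add (Nat.add (Nat.mul a01 a02) (Nat.mul a13 a23)) (Nat.mul a14 a24)) (Nat.mul a15 a25)) (Nat.mul a16 a26)) (Nat.add (Nat.add (Nat.add (Nat.add (Nat.mul a01 a13) (Nat.mul a02 a23)) (Nat.mul a04 a34)) (Nat.mul a05 a35)) (Nat.mul a06 a36)) (Nat.add (Nat.add (Nat.add (Nat.add (Nat.mul a01 a03) (Nat.mul a12 a23)) (Nat.mul a14 a34)) (Nat.mul a15 a35))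 (Nat.mul a16 a36)) (Nat.add (Nat.add (Nat.add (Nat.add (Nat.mul a02 a03) (Nat.mul a12 a13)) (Nat.mul a24 a34)) (Nat.mul a25 a35)) (Nat.mul a26 a36)) (Nat.add (Nat.add (Nat.add (Nat.add (Nat.mul a01 a14) (Nat.mul a02 a24)) (Nat.mul a03 a34)) (Nat.mul a05 a45)) (Nat.mul a06 a46)) (Nat.add (Nat.add (Nat.add (Nat.add (Nat.mul a01 a04) (Nat.mul a12 a24)) (Nat.mul a13 a34)) (Nat.mul a15 a45)) (Nat.mul a16 a46)) (Nat.add (Nat.add (Nat.add (Nat.add (Nat.mul a02 a04) (Nat.mul a12 a14)) (Nat.mul a23 a34)) (Nat.mul a25 a45)) (Nat.mul a26 a46)) (Nat.add (Nat.add (Nat.add (Nat.add (Nat.mul a03 a04) (Nat.mul a13 a14)) (Nat.mul a23 a24)) (Nat.mul a35 a45)) (Nat.mul a36 a46)) (Nat.add (Nat.add (Nat.add (Nat.add (Nat.mul a01 a15) (Nat.mul a02 a25)) (Nat.mul a03 a35)) (Nat.mul a04 a45)) (Nat.mul a06 a56)) (Nat.add (Nat.add (Nat.add (Nat.add (Nat.mul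 a01 a05) (Nat.mul a12 a25)) (Nat.mul a13 a35)) (Nat.mul a14 a45)) (Nat.mul a16 a56)) (Nat.add (Nat.add (Nat.add (Nat.add (Nat.mul a02 a05) (Nat.mul a12 a15)) (Nat.mul a23 a35)) (Nat.mul a24 a45)) (Nat.mul a26 a56)) (Nat.add (Nat.add (Nat.add (Nat.add (Nat.mul a03 a05) (Nat.mul a13 a15)) (Nat.mul a23 a25)) (Nat.mul a34 a45)) (Nat.mul a36 a56)) (Nat.add (Nat.add (Nat.add (Nat.add (Nat.mul a04 a05) (Nat.mul a14 a15)) (Nat.mul a24 a25)) (Nat.mul a34 a35)) (Nat.mul a46 a56)) (Nat.add (Nat.add (Nat.add (Nat.add (Nat.mul a01 a16) (Nat.mul a02 a26)) (Nat.mul a03 a36)) (Nat.mul a04 a46)) (Nat.mul a05 a56)) (Nat.add (Nat.add (Nat.add (Nat.add (Nat.mul a01 a06) (Nat.mul a12 a26)) (Nat.mul a13 a36)) (Nat.mul a14 a46)) (Nat.mul a15 a56)) (Nat.add (Nat.add (Nat.add (Nat.add (Nat.mul a02 a06) (Nat.mul a12 a16)) (Nat.mul a23 a36)) (Nat.mul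 a24 a46)) (Nat.mul a25 a56)) (Nat.add (Nat.add (Nat.add (Nat.add (Nat.mul a03 a06) (Nat.mul a13 a16)) (Nat.mul a23 a26)) (Nat.mul a34 a46)) (Nat.mul a35 a56)) (Nat.add (Nat.add (Nat.add (Nat.add (Nat.mul a04 a06) (Nat.mul a14 a16)) (Nat.mul a24 a26)) (Nat.mul a34 a36)) (Nat.mul a45 a56)) (Nat.add (Nat.add (Nat.add (Nat.add (Nat.mul a05 a06) (Nat.mul a15 a16)) (Nat.mul a25 a26)) (Nat.mul a35 a36)) (Nat.mul a45 a46)) (Nat.add (Nat.add (Nat.add (Nat.add (Nat.add a01 a02) a03) a04) a05) a06) (Nat.add (Nat.add (Nat.add (Nat.add (Nat.add a01 a12) a13) a14) a15) a16) (Nat.add (Nat.add (Nat.add (Nat.add (Nat.add a02 a12) a23) a24) a25) a26) (Nat.add (Nat.add (Nat.add (Nat.add (Nat.add a03 a13) a23) a34) a35) a36) (Nat.add (Nat.add (Nat.add (Nat.add (Nat.add a04 a14) a24) a34) a45) a46) (Nat.add (Nat.add (Nat.add (Nat.add (Nat.add a05 a15) a25) a35) a45) a56) (Nat.add (Nat.add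 (Nat.add (Nat.add (Nat.add a06 a16) a26) a36) a46) a56)

def bt (c k : Nat) : Nat := Nat.mod (Nat.shiftRight c k) 2

noncomputable def chk (c m : Nat) : Bool := chkA (bt c 0) (bt c 1) (bt c 2) (bt c 3) (bt c 4) (bt c 5) (bt c 6) (bt c 7) (bt c 8) (bt c 9) (bt c 10) (bt c 11) (bt c 12) (bt c 13) (bt c 14) (bt m 0) (bt m 1) (bt m 2) (bt m 3) (bt m 4) (bt m 5)

def reps2 : List Nat := [0, 1]

def reps3 : List Nat := [0, 1, 3, 7]

def reps4 : List Nat := [0, 1, 3, 11, 7, 12, 13, 15, 30, 31, 63]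

def reps5 : List Nat := [0, 1, 3, 11, 75, 7, 12, 13, 15, 76, 77, 79, 30, 31, 86, 87, 94, 95, 222, 223, 63, 116, 117, 119, 127, 235, 236, 237, 239, 254, 255, 507, 511, 1023]

def reps6 : List Nat := [0, 1, 3, 11, 75, 1099, 7, 12, 13, 15, 76, 77, 79, 1100, 1101, 1103, 30, 31, 86, 87, 94, 95, 1108, 1109, 1110, 1111, 1118, 1119, 222, 223, 1182, 1183, 1246, 1247, 3294, 3295, 63, 116, 117, 119, 127, 1140, 1141, 1143, 1151, 235, 1184, 1185, 1187, 1194, 1195, 1259, 236, 237, 239, 1191, 1196, 1197, 1198, 1199, 1260, 1261, 1263, 254, 255, 1214, 1215, 1268, 1269, 1270, 1271, 1278, 1279, 1456, 1460, 1457, 1461, 3306, 3307, 1459, 1463, 3308, 3309, 3310, 3311, 3326, 3327, 507, 1465, 1467, 1531, 511, 1468, 1469, 1471, 1532, 1533, 1535, 3440, 3441, 3443, 3448, 3449, 3451, 3447, 3452, 3453, 3455, 3576, 3577, 3578, 3579, 3582, 3583, 7672, 7673, 7675, 7679, 1023, 1972, 1973, 1975, 1983, 2047, 3873, 3875, 3879,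 3947, 3885, 3887, 3948, 3949, 3950, 3951, 3903, 3958, 3959, 3966, 3967, 4094, 4095, 7902, 7903, 7915, 7916, 7917, 7919, 7934, 7935, 8185, 8187, 8191, 16350, 16351, 16383, 32767]

def wit1 : List (Nat × List Nat) := [(0, [57499975680, 57499975681])]

def wit2 : List (Nat × List Nat) := [(0, [57499975680, 57498140673, 57496076289, 57497681923]), (1, [57499975681, 57499975683, 57499746307, 57499975687])]

def wit3 : List (Nat × List Nat) := [(0, [57499975680, 57481625601, 57479561217, 57480937475, 57462816769, 57466257411, 57449742339, 57480937483]), (1, [57499975681, 57485295619, 57485066243, 57485295623, 57468780556, 57466945549, 57450201101, 57480937487]), (3, [57499975683, 57499975691, 57485295629, 57485295631, 57468780557, 57468780559, 57481625630, 57481625631]), (7, [57499975687, 57499975695, 57499746319, 57499975711, 57497681935, 57498140703, 57496076319, 57499975743])]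

def wit4 : List (Nat × List Nat) := [(0, [57499975680, 57347670017, 57345605633, 57346752515, 57328861185, 57332072451, 57315557379, 57346752523, 57194676225, 57199951875, 57183436803, 57229312011, 57049481219, 57097191435, 56963235851, 57346752587]), (1, [57499975681, 57353175043, 57352945667, 57353175047, 57336659980, 57332989965, 57316245517, 57346752527, 57202704396, 57200869389, 57184124941, 57229312015, 57346752588, 57346752589, 57344917581, 57346752591]), (3, [57499975683, 57382535179, 57353175053, 57353175055, 57336659981, 57336659983, 57347670046, 57347670047, 57202704460, 57200869453, 57230229590, 57230229591, 57098109014, 57098109015, 57346752606, 57346752607]), (11, [57499975691, 57499975755, 57353175117, 57353175119, 57336660045, 57336660047, 57347670110, 57347670111, 57202704461, 57202704463, 57230229598, 57230229599, 57098109022, 57098109023, 57347670238, 57347670239]), (7, [57499975687, 57382535183, 57382305807, 57382535199, 57380241423, 57380700191, 57378635807, 57382535231, 57480937588, 57346752629, 57344917621, 57346752631, 57328402549, 57332072567, 57315557495, 57346752639]), (12, [57499975692, 57499975756, 57485066316, 57353175126, 57468321868, 57336660054, 57382535284, 57347670133, 57449742412, 57250185332, 57185960022, 57228165237, 57051775062,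 57093980277, 56945115253, 57346752747]), (13, [57499975693, 57499975757, 57485066317, 57353175127, 57380700246, 57380700254, 57382535285, 57353175159, 57244680278, 57250185333, 57244680286, 57235505271, 57101779180, 57332990189, 57184125165, 57346752751]), (15, [57499975695, 57499975759, 57382535255, 57382535263, 57380700247, 57380700255, 57382535287, 57382535295, 57480937589, 57250414827, 57235734765, 57235734767, 57101779181, 57101779183, 57347670270, 57347670271]), (30, [57499975710, 57499975774, 57499746398, 57499975902, 57462816862, 57498140909, 57496076525, 57382535422, 57462587486, 57481625837, 57479561453, 57250414846, 57462816990, 57110495486, 56978374910, 57346753019]), (31, [57499975711, 57499975775, 57499746399, 57499975903, 57497682039, 57382535407, 57382306031, 57382535423, 57480937591, 57250414831, 57250185455, 57250414847, 57462817022, 57353175547, 57352946171, 57353175551]), (63, [57499975743, 57499975807, 57499746431, 57499975935, 57497682047, 57498140927, 57496076543, 57499976191, 57480937599, 57481625855, 57479561471, 57485296127, 57462817023, 57468781055, 57452036607, 57499976703])]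

def wit5 : List (Nat × List Nat) := [(0, [57499975680, 56274190337, 56272125953, 56273043459, 56255381505, 56258363395, 56241848323, 56273043467, 56121196545, 56126242819, 56109727747, 56155602955, 55975772163, 56023482379, 55889526795, 56273043531, 55047487489, 55054598147, 55038083075, 55098638347, 54904127491, 54966517771, 54832562187, 55333519435, 53830647811, 53894873099, 53760917515, 54276554827, 52687437835, 53204910155, 52131430475, 56273044555]), (1, [57499975681, 56281530371, 56281300995, 56281530375, 56265015308, 56259510285, 56242765837, 56273043471, 56131059724, 56127389709, 56110645261, 56155602959, 56273043532, 56273043533, 56271208525, 56273043535, 55057580044, 55055745037, 55039000589, 55098638351, 55333519436, 55333519437, 55331684429, 55333519439, 54276554828, 54276554829, 54274719821, 54276554831, 56273044556, 56273044557, 56271209549, 56273044559]), (3, [57499975683, 56325570571, 56281530381, 56281530383, 56265015309, 56265015311, 56274190366, 56274190367, 56131059788, 56127389773, 56156749910, 56156749911, 56024629334, 56024629335, 56273043550, 56273043551, 55057580108, 55055745101, 55099785302, 55099785303, 54967664726, 54967664727, 55333519454, 55333519455, 53896021076, 53896021077, 56273044566, 56273044567, 56258364502, 56258364503, 56273044574,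 56273044575]), (11, [57499975691, 56560451659, 56281530445, 56281530447, 56265015373, 56265015375, 56274190430, 56274190431, 56131059789, 56131059791, 56156749918, 56156749919, 56024629342, 56024629343, 56274190558, 56274190559, 55057581132, 55055746125, 55099786326, 55099786327, 54967665750, 54967665751, 55334667422, 55334667423, 53896021078, 53896021079, 54277702814, 54277702815, 53206058142, 53206058143, 56273044702, 56273044703]), (75, [57499975755, 57499976779, 56281531469, 56281531471, 56265016397, 56265016399, 56274191454, 56274191455, 56131060813, 56131060815, 56156750942, 56156750943, 56024630366, 56024630367, 56274191582, 56274191583, 55057581133, 55057581135, 55099786334, 55099786335, 54967665758, 54967665759, 55334667486, 55334667487, 53896021086, 53896021087, 54277702878, 54277702879, 53206058206, 53206058207, 56274193630, 56274193631]), (7, [57499975687, 56325570575, 56325341199, 56325570591, 56323276815, 56323735583, 56321671199, 56325570623, 56541413492, 56273043573, 56271208565, 56273043575, 56254693493, 56258363511, 56241848439, 56273043583, 55467704436, 55333519477, 55331684469, 55333519479, 55315169397, 55318839415, 55302324343, 55333519487, 56273044596, 56273044597, 56271209589, 56273044599, 56254694517, 56258364535, 56241849463, 56273044607]), (12, [57499975692,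 56560451660, 56545542220, 56281530454, 56528797772, 56265015382, 56325570676, 56274190453, 56510218316, 56193220724, 56114315350, 56154685557, 55980130390, 56020500597, 55871635573, 56273043691, 55121806496, 55334667425, 54275638433, 56273044643, 53201929377, 56258364579, 56273044650, 56273044651, 52113540257, 56153769130, 56109728931, 56153769131, 55975773347, 56019813547, 55871177899, 56273044715]), (13, [57499975693, 56560451661, 56545542221, 56281530455, 56323735638, 56323735646, 56325570677, 56281530487, 56187715670, 56193220725, 56187715678, 56163860599, 56030134508, 56259510509, 56110645485, 56273043695, 55121806497, 55107126435, 54167372963, 55107126439, 55319987372, 55319987373, 56273044654, 56273044655, 54231598252, 56153769134, 54231598253, 56153769135, 56273044716, 56273044717, 56153769197, 56273044719]), (15, [57499975695, 56560451663, 56325570647, 56325570655, 56323735639, 56323735647, 56325570679, 56325570687, 56541413493, 56193450219, 56164090093, 56164090095, 56030134509, 56030134511, 56274190590, 56274190591, 55468623018, 55334667435, 55334667438, 55334667439, 55319987374, 55319987375, 55334667454, 55334667455, 56273044724, 56273044725, 56273044726, 56273044727, 56258364662, 56258364663, 56273044734, 56273044735]), (76, [57499975756, 57499976780, 56325571668,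 56281531478, 56323736660, 56265016406, 56325571700, 56274191477, 56542102689, 56193451178, 56164091052, 56164091054, 56030135468, 56030135470, 56274191604, 56274191605, 55468623009, 55121806506, 55107126444, 55107126446, 54973170860, 54973170862, 55334667508, 55334667509, 54284813744, 54284813748, 54275638705, 54275638709, 53201929649, 53201929653, 56273046762, 56273046763]), (77, [57499975757, 57499976781, 56325571669, 56281531479, 56323736662, 56323736670, 56325571701, 56281531511, 56193451171, 56193451179, 56164091053, 56164091055, 56030135532, 56259511533, 56274191606, 56274191607, 55121806499, 55121806507, 55107126445, 55107126447, 54973170924, 55319987437, 55334667510, 55334667511, 54284813745, 54284813749, 54284813747, 54284813751, 56259513580, 56259513581, 56273046766, 56273046767]), (79, [57499975759, 57499976783, 56325571671, 56325571679, 56323736663, 56323736671, 56325571703, 56325571711, 56542102699, 56193451243, 56164091117, 56164091119, 56030135533, 56030135535, 56274191614, 56274191615, 55468623019, 55121806571, 55107126509, 55107126511, 54973170925, 54973170927, 55334667518, 55334667519, 56274193642, 56274193643, 56274193646, 56274193647, 56259513582, 56259513583, 56274193662, 56274193663]), (30, [57499975710, 56560451678, 56560222302, 56560451806, 56523292766,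 56558616813, 56556552429, 56325570814, 56523063390, 56542101741, 56540037357, 56193450238, 56523292894, 56053530878, 55921410302, 56273043963, 57346753968, 56273044913, 56271209905, 56273044915, 55975773617, 56273044921, 56271209913, 56273044923, 55973938609, 56155604409, 56153769401, 56155604411, 55975773619, 55975773627, 55858333115, 56273044987]), (31, [57499975711, 56560451679, 56560222303, 56560451807, 56558157943, 56325570799, 56325341423, 56325570815, 56541413495, 56193450223, 56193220847, 56193450239, 56523292926, 56281530875, 56281301499, 56281530879, 57346753972, 56273044917, 56271209909, 56273044919, 56273044924, 56273044925, 56271209917, 56273044927, 56155604412, 56155604413, 56153769405, 56155604415, 56273044988, 56273044989, 56271209981, 56273044991]), (86, [57499975766, 57499976790, 57382306902, 56325571742, 57497683107, 56325571758, 55385818286, 56325571774, 56542102700, 56193451244, 56193451252, 56164091126, 56529257905, 56059495865, 56281531836, 56274191805, 55466558636, 55121577204, 55121577196, 55106897142, 55440868785, 55341778364, 54853666233, 55332603325, 54285045104, 56156753265, 55097724273, 56273046899, 52706479480, 56273046905, 55331687801, 56273046907]), (87, [57499975767, 57499976791, 57382306903, 56325571743, 56325571751, 56325571759, 55385818287,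 56325571775, 56542102702, 56193451245, 56193451253, 56164091127, 56281531833, 56281531835, 56281531837, 56281531839, 55466558638, 55121577205, 55121577197, 55106897143, 55341778361, 55341778365, 55341778363, 55341778367, 54285045105, 54285045107, 54167375219, 54285045111, 56273046908, 56273046909, 55331687805, 56273046911]), (94, [57499975774, 57499976798, 56560452766, 56560452830, 56558617773, 56558617837, 56325571830, 56325571838, 56542102701, 56542102765, 56193451254, 56193451262, 56529257907, 56059495867, 56281531900, 56274191869, 57346753969, 55121808618, 55107128556, 55107128558, 55342009720, 56274193785, 55342009724, 56274193789, 54285045112, 56156753273, 54285045116, 56156753277, 56274193912, 56274193913, 56273047034, 56273047035]), (95, [57499975775, 57499976799, 56560452767, 56560452831, 56558617775, 56325571823, 56325571831, 56325571839, 56542102703, 56193451247, 56193451255, 56193451263, 56529257915, 56281531899, 56281531901, 56281531903, 57346753973, 55121808619, 55107128557, 55107128559, 55342009721, 55342009723, 55342009725, 55342009727, 54285045113, 54285045115, 54285045117, 54285045119, 56274193914, 56274193915, 56274193918, 56274193919]), (222, [57499975902, 57499976926, 57499747550, 57499978974, 57497683379, 56325573870, 56325344494, 56325573886, 57480938931,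 56193453294, 56193223918, 56193453310, 56281533944, 56281533946, 56281304570, 56281533950, 57346753971, 55121808622, 55121579246, 55121808638, 55342009848, 55342009850, 55341780474, 55342009854, 54285045240, 54285045242, 54284815866, 54285045246, 56281538040, 56274198009, 56272133625, 56273051131]), (223, [57499975903, 57499976927, 57499747551, 57499978975, 57497683383, 56325573871, 56325344495, 56325573887, 57480938935, 56193453295, 56193223919, 56193453311, 56281533945, 56281533947, 56281304571, 56281533951, 57346753975, 55121808623, 55121579247, 55121808639, 55342009849, 55342009851, 55341780475, 55342009855, 54285045241, 54285045243, 54284815867, 54285045247, 56281538041, 56281538043, 56281308667, 56281538047]), (63, [57499975743, 56560451711, 56560222335, 56560451839, 56558157951, 56558616831, 56556552447, 56560452095, 56541413503, 56542101759, 56540037375, 56545772031, 56523292927, 56529256959, 56512512511, 56560452607, 57346754484, 56273045429, 56271210421, 56273045431, 56254695349, 56258365367, 56241850295, 56273045439, 56120739765, 56126244791, 56109729719, 56155604927, 55975774135, 56023484351, 55889528767, 56273045503]), (116, [57499975796, 57499976820, 57499747498, 56560452852, 57497683114, 56558617844, 56560453044, 56325572028, 57480938666, 56542102772, 56545772980,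 56193451452, 56529257908, 56059495868, 56560453556, 56274192309, 56963236980, 57347673889, 52265616628, 55308750627, 52263781620, 55308521251, 52030735804, 55308750631, 52247266548, 54234812195, 51898615228, 54235270951, 51764659644, 53161561895, 51979356085, 56273047403]), (117, [57499975797, 57499976821, 57499747499, 56560452853, 57497683118, 56558617846, 56560453045, 56325572029, 57480938670, 56542102774, 56545772981, 56193451453, 56529257916, 56529257980, 56560453557, 56281532343, 56963237108, 57347673891, 56963927274, 56274194215, 54853668209, 56259514157, 54853668217, 55308750639, 53780188529, 56127393581, 53780188537, 54235270959, 51987386220, 56273047405, 51987386222, 56273047407]), (119, [57499975799, 57499976823, 57499747503, 56560452855, 57497683119, 56558617847, 56560453047, 56325572031, 56542102718, 56542102782, 56545772989, 56545773053, 56529257917, 56529257981, 56560453559, 56325572543, 57315558844, 55499591463, 55440870777, 56274194223, 55440641401, 56259514159, 55440870905, 56274194239, 56127393644, 56127393645, 56156753782, 56156753783, 56024633206, 56024633207, 56273047422, 56273047423]), (127, [57499975807, 57499976831, 56560452799, 56560452863, 56558617791, 56558617855, 56560453055, 56560453119, 56542102719, 56542102783, 56545772991, 56545773055, 56529257919,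 56529257983, 56560453567, 56560453631, 57346754485, 57347673963, 56274194286, 56274194287, 56259514222, 56259514223, 56274194302, 56274194303, 56127393646, 56127393647, 56156753790, 56156753791, 56024633214, 56024633215, 56274194430, 56274194431]), (235, [57499975915, 57499976939, 57499747573, 57499978987, 57380242677, 57380703467, 56325574003, 56325574011, 57246057717, 57246747883, 56193453427, 56193453435, 57462820647, 56560455531, 56281534317, 56281534319, 57097192693, 57098112235, 57345609511, 55501655915, 54987853171, 54987853179, 55325495149, 55325495151, 53914373491, 53914373499, 54252015469, 54252015471, 53061095277, 53061095279, 56274198238, 56274198239]), (236, [57499975916, 57499976940, 57485067500, 57499978988, 57336202476, 57380703468, 57496079729, 56325574012, 57185502444, 57481629041, 57244683500, 56193224060, 57051778417, 56560455532, 56545546092, 56281534326, 57049482476, 57332993393, 57184128369, 55501655916, 57093983468, 54987394428, 55457156972, 55325495158, 56945118444, 54366932844, 53779729788, 54235271030, 52704185724, 53027606390, 51836456822, 56273051371]), (237, [57499975917, 57499976941, 57485067501, 57499978989, 57380242678, 57380703470, 56560225651, 56325574013, 57244222710, 56545774963, 57244683502, 56193224061, 56560455469, 56560455533, 56545546093,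 56281534327, 57332073913, 57332993401, 57184128377, 55501655918, 55457156476, 55457615354, 55384215414, 55384215422, 54366932348, 54308671350, 54367391226, 54308671358, 54973177580, 55319994093, 54231604973, 56273051375]), (239, [57499975919, 57499976943, 57499747575, 57499978991, 57380242679, 57380703471, 56325574007, 56325574015, 57480938941, 56545774971, 56545545597, 56545775099, 56560455471, 56560455535, 56325574519, 56325574527, 57332073917, 55457615227, 55501655855, 55501655919, 55457156477, 55457615355, 55384215415, 55384215423, 57194680182, 54314409707, 56164097773, 56164097775, 54973177581, 54973177583, 56274198270, 56274198271]), (254, [57499975934, 57499976958, 57499747582, 57499979006, 57497683387, 57498144125, 57496079741, 56560455166, 57480938939, 57481629053, 57479564669, 56545775102, 57051778553, 56560455550, 56560226174, 56560455678, 57049482748, 57347673965, 57345609581, 55503494878, 57049943546, 55501659885, 55499595501, 55386054398, 57047879162, 54428180205, 54426115821, 54314409726, 57051782649, 56274198521, 56272134137, 56273051643]), (255, [57499975935, 57499976959, 57499747583, 57499979007, 57497683391, 56560455039, 56560225663, 56560455167, 57480938943, 56545774975, 56545545599, 56545775103, 56560455487, 56560455551, 56560226175, 56560455679, 57346754487,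 57347673967, 57345609583, 55503494879, 57328865150, 55386054383, 55385825007, 55386054399, 57194680190, 54314409711, 54314180335, 54314409727, 56281538553, 56281538555, 56281309179, 56281538559]), (507, [57499976187, 57499977211, 57499747837, 57499979259, 57497683453, 57498144251, 57496079870, 57499983355, 57202017789, 57202707963, 57479565175, 57485303535, 57462820727, 57468788463, 56556560126, 56560459771, 57199953405, 57200872955, 57345609591, 57353182959, 57328865143, 57336667887, 55499595518, 55503495163, 57194679806, 57202712059, 54376111870, 54384140283, 53319147262, 53327175675, 56274206686, 56274206687]), (511, [57499976191, 57499977215, 57499747839, 57499979263, 57497683455, 57498144255, 57496079871, 57499983359, 57480939455, 57481629567, 57479565183, 56560459519, 57462820735, 56558624511, 56556560127, 56560459775, 57346754495, 57347673983, 57345609599, 55503494911, 57328865151, 55501659903, 55499595519, 55503495167, 57194680318, 57202712571, 57185968123, 56325586911, 57051783163, 56323751903, 56321687519, 56325586943]), (1023, [57499976703, 57499977727, 57499748351, 57499979775, 57497683967, 57498144767, 57496080383, 57499983871, 57480939519, 57481629695, 57479565311, 57485303807, 57462820863, 57468788735, 57452044287, 57499992063, 57346754559, 57347674111, 57345609727,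 57353183231, 57328865279, 57336668159, 57319923711, 57382551551, 57194680319, 57202712575, 57185968127, 57250430975, 57051783167, 57116475391, 56982290431, 57500008447])]

theorem chk_c0 : ((reps6.drop 0).take 12).all (fun c => (List.range 64).all (chk c)) = true := by
  decide +kernel
theorem chk_c1 : ((reps6.drop 12).take 12).all (fun c => (List.range 64).all (chk c)) = true := by
  decide +kernel
theorem chk_c2 : ((reps6.drop 24).take 12).all (fun c => (List.range 64).all (chk c)) = true := by
  decide +kernel
theorem chk_c3 : ((reps6.drop 36).take 12).all (fun c => (List.range 64).all (chk c)) = true := by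
  decide +kernel
theorem chk_c4 : ((reps6.drop 48).take 12).all (fun c => (List.range 64).all (chk c)) = true := by
  decide +kernel
theorem chk_c5 : ((reps6.drop 60).take 12).all (fun c => (List.range 64).all (chk c)) = true := by
  decide +kernel
theorem chk_c6 : ((reps6.drop 72).take 12).all (fun c => (List.range 64).all (chk c)) = true := by
  decide +kernel
theorem chk_c7 : ((reps6.drop 84).take 12).all (fun c => (List.range 64).all (chk c)) = true := by
  decide +kernel
theorem chk_c8 : ((reps6.drop 96).take 12).all (fun c => (List.range 64).all (chk c)) = true := by
  decide +kernel
theorem chk_c9 : ((reps6.drop 108).take 12).all (fun c => (List.range 64).all (chk c)) = true := by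
  decide +kernel
theorem chk_c10 : ((reps6.drop 120).take 12).all (fun c => (List.range 64).all (chk c)) = true := by
  decide +kernel
theorem chk_c11 : ((reps6.drop 132).take 12).all (fun c => (List.range 64).all (chk c)) = true := by
  decide +kernel
theorem chk_c12 : ((reps6.drop 144).take 12).all (fun c => (List.range 64).all (chk c)) = true := by
  decide +kernel

theorem chk_all : ∀ c ∈ reps6, ∀ m < 64, chk c m = true := by
  have key : ∀ c ∈ ((reps6.drop 0).take 12 ++ ((reps6.drop 12).take 12 ++ ((reps6.drop 24).take 12 ++ ((reps6.drop 36).take 12 ++ ((reps6.drop 48).take 12 ++ ((reps6.drop 60).take 12 ++ ((reps6.drop 72).take 12 ++ ((reps6.drop 84).take 12 ++ ((reps6.drop 96).take 12 ++ ((reps6.drop 108).take 12 ++ ((reps6.drop 120).take 12 ++ ((reps6.drop 132).take 12 ++ ((reps6.drop 144).take 12))))))))))))), ∀ m < 64, chk c m = true := by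
    have h : ∀ l : List ℕ, l.all (fun c => (List.range 64).all (chk c)) = true →
        ∀ c ∈ l, ∀ m < 64, chk c m = true := by
      intro l hl c hc m hm
      exact List.all_eq_true.1 (List.all_eq_true.1 hl c hc) m (List.mem_range.2 hm)
    intro c hc
    simp only [List.mem_append] at hc
    rcases hc with hc | hc | hc | hc | hc | hc | hc | hc | hc | hc | hc | hc | hc
    · exact h _ chk_c0 c hc
    · exact h _ chk_c1 c hc
    · exact h _ chk_c2 c hc
    · exact h _ chk_c3 c hc
    · exact h _ chk_c4 c hc
    · exact h _ chk_c5 c hc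
    · exact h _ chk_c6 c hc
    · exact h _ chk_c7 c hc
    · exact h _ chk_c8 c hc
    · exact h _ chk_c9 c hc
    · exact h _ chk_c10 c hc
    · exact h _ chk_c11 c hc
    · exact h _ chk_c12 c hc
  have e : reps6 = ((reps6.drop 0).take 12 ++ ((reps6.drop 12).take 12 ++ ((reps6.drop 24).take 12 ++ ((reps6.drop 36).take 12 ++ ((reps6.drop 48).take 12 ++ ((reps6.drop 60).take 12 ++ ((reps6.drop 72).take 12 ++ ((reps6.drop 84).take 12 ++ ((reps6.drop 96).take 12 ++ ((reps6.drop 108).take 12 ++ ((reps6.drop 120).take 12 ++ ((reps6.drop 132).take 12 ++ ((reps6.drop 144).take 12))))))))))))) := by decide +kernel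
  rw [e]; exact key

/-- index of the pair i<j -/
def ix (i j : Nat) : Nat := Nat.add (Nat.div (Nat.mul j (Nat.sub j 1)) 2) i
def vl (n c m i j : Nat) : Nat := bif Nat.blt j n then bt c (ix i j) else bt m i
def vs (n c m i j : Nat) : Nat := bif Nat.blt i j then vl n c m i j else vl n c m j i
def pf (h i : Nat) : Nat := Nat.mod (Nat.shiftRight h (Nat.add 15 (Nat.mul 3 i))) 8

def stepOK (n : Nat) (R : List Nat) (c m h : Nat) : Bool :=
  (R.any (Nat.beq (Nat.mod h 32768))) &&
  ((List.range 7).all (fun i => Nat.blt (pf h i) 7 && (bif Nat.ble i n then Nat.ble (pf h i) n else Nat.beq (pf h i) i))) &&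
  ((List.range 7).all (fun j => (List.range j).all (fun i => ! Nat.beq (pf h i) (pf h j)))) &&
  ((List.range (n+1)).all (fun j => (List.range j).all (fun i =>
    Nat.beq (bt (Nat.mod h 32768) (ix i j)) (vs n c m (pf h i) (pf h j)))))

def levelOK (n : Nat) (R : List Nat) (H : List (Nat × List Nat)) : Bool :=
  H.all (fun e => (List.range (2 ^ n)).all (fun m => stepOK n R e.1 m (e.2.getD m 0)))

theorem lev1 : levelOK 1 reps2 wit1 = true := by decide +kernel
theorem lev2 : levelOK 2 reps3 wit2 = true := by decide +kernel
theorem lev3 : levelOK 3 reps4 wit3 = true := by decide +kernel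
theorem lev4 : levelOK 4 reps5 wit4 = true := by decide +kernel
theorem lev5 : levelOK 5 reps6 wit5 = true := by decide +kernel
theorem hk2 : wit2.map Prod.fst = reps2 := by decide +kernel
theorem hk3 : wit3.map Prod.fst = reps3 := by decide +kernel
theorem hk4 : wit4.map Prod.fst = reps4 := by decide +kernel
theorem hk5 : wit5.map Prod.fst = reps5 := by decide +kernel

theorem exists_bits (n : ℕ) : ∀ (b : ℕ → ℕ), (∀ i, b i ≤ 1) → ∃ m < 2 ^ n, ∀ i < n, bt m i = b i := by
  induction n with
  | zero => intro b _; exact ⟨0, by norm_num, by simp⟩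
  | succ n ih =>
    intro b hb
    obtain ⟨m, hm, h⟩ := ih (fun i => b (i + 1)) (fun i => hb _)
    refine ⟨b 0 + 2 * m, by have := hb 0; rw [pow_succ]; omega, ?_⟩
    intro i hi
    have h0 := hb 0
    cases i with
    | zero => show ((b 0 + 2 * m) >>> 0) % 2 = b 0; simp only [Nat.shiftRight_zero]; omega
    | succ i =>
      have := h i (by omega)
      rw [← this]
      show ((b 0 + 2 * m) >>> (i + 1)) % 2 = (m >>> i) % 2
      rw [Nat.shiftRight_eq_div_pow, Nat.shiftRight_eq_div_pow, pow_succ', ← Nat.div_div_eq_div_mul]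
      congr 2; omega

/-- partial code relation -/
def CodeRel (n : ℕ) (a : Fin 7 → Fin 7 → ℕ) (σ : Equiv.Perm (Fin 7)) (c : ℕ) : Prop :=
  ∀ i j : Fin 7, i < j → j.val < n → a (σ i) (σ j) = bt c (ix i j)

theorem ladder_step (n : ℕ) (hn : n < 6) (R : List ℕ) (H : List (ℕ × List ℕ)) (hl : levelOK n R H = true)
    (a : Fin 7 → Fin 7 → ℕ) (hs : ∀ i j, a i j = a j i) (h1 : ∀ i j, a i j ≤ 1)
    (σ : Equiv.Perm (Fin 7)) (c : ℕ) (hc : c ∈ H.map Prod.fst) (hr : CodeRel n a σ c) :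
    ∃ σ' : Equiv.Perm (Fin 7), σ' 6 = σ 6 ∧ ∃ c' ∈ R, CodeRel (n + 1) a σ' c' := by
  obtain ⟨e, he, rfl⟩ := List.mem_map.1 hc
  obtain ⟨m, hm, hb⟩ := exists_bits n (fun i => a (σ (Fin.ofNat 7 i)) (σ (Fin.ofNat 7 n))) (fun i => h1 _ _)
  have hk := List.all_eq_true.1 (List.all_eq_true.1 hl e he) m (List.mem_range.2 hm)
  set h := e.2.getD m 0
  clear_value h
  simp only [stepOK, Bool.and_eq_true, List.all_eq_true, List.mem_range, List.any_eq_true] at hk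
  obtain ⟨⟨⟨⟨c', hc', hcc⟩, hp⟩, hinj⟩, hbits⟩ := hk
  have hcc : h % 32768 = c' := Nat.eq_of_beq_eq_true hcc
  have hp7 : ∀ i < 7, pf h i < 7 := fun i hi => by
    have := (hp i hi).1; simpa [Nat.blt] using this
  have hpn : ∀ i < 7, i ≤ n → pf h i ≤ n := fun i hi hin => by
    have := (hp i hi).2
    rw [Nat.ble_eq_true_of_le hin] at this
    exact Nat.le_of_ble_eq_true this
  have hpid : ∀ i < 7, n < i → pf h i = i := fun i hi hin => by
    have := (hp i hi).2
    have h0 : Nat.ble i n = false := by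
      rw [← Bool.not_eq_true, Nat.ble_eq]; omega
    rw [h0] at this
    exact Nat.eq_of_beq_eq_true this
  have hinj' : ∀ i j, i < j → j < 7 → pf h i ≠ pf h j := fun i j hij hj heq => by
    have := hinj j hj i hij
    rw [heq] at this; simp at this
  let p : Fin 7 → Fin 7 := fun i => ⟨pf h i, hp7 i i.2⟩
  have pinj : Function.Injective p := by
    intro i j hij
    have e1 : pf h i = pf h j := congrArg Fin.val hij
    by_contra hne
    rcases lt_or_gt_of_ne hne with hlt | hlt
    · exact hinj' i j hlt j.2 e1
    · exact hinj' j i hlt i.2 e1.symm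
  let π : Equiv.Perm (Fin 7) := Equiv.ofBijective p (Finite.injective_iff_bijective.1 pinj)
  have hval : ∀ x y : Fin 7, x < y → y.val ≤ n → a (σ x) (σ y) = vl n e.1 m x y := by
    intro x y hxy hyn
    rcases Nat.lt_or_ge y.val n with hlt | hge
    · have : Nat.blt y.val n = true := by simpa [Nat.blt] using hlt
      rw [vl, this]; exact hr x y hxy hlt
    · have hyn' : y.val = n := le_antisymm hyn hge
      have : Nat.blt y.val n = false := by rw [← Bool.not_eq_true]; simp [Nat.blt]; omega
      rw [vl, this]
      have hx : x.val < n := by have : x.val < y.val := hxy; omega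
      have := hb x hx
      rw [cond_false, this]
      have e1 : Fin.ofNat 7 x.val = x := by ext; simp [Fin.ofNat, Nat.mod_eq_of_lt x.2]
      have e2 : Fin.ofNat 7 n = y := by ext; simp [Fin.ofNat]; omega
      simp only [e1, e2]
  refine ⟨π.trans σ, ?_, c', hc', ?_⟩
  · have : π 6 = 6 := by
      apply Fin.ext; exact hpid 6 (by norm_num) (by omega)
    simp [this]
  · intro i j hij hjn
    have hb := hbits j.val hjn i.val hij
    have hb : bt (h % 32768) (ix i j) = vs n e.1 m (pf h i) (pf h j) := Nat.eq_of_beq_eq_true hb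
    rw [← hcc, hb]
    have hi' : pf h i ≤ n := hpn i i.2 (by have : i.val < j.val := hij; omega)
    have hj' : pf h j ≤ n := hpn j j.2 (by omega)
    show a (σ (p i)) (σ (p j)) = _
    have hne : p i ≠ p j := fun h => hij.ne (pinj h)
    rcases lt_or_gt_of_ne hne with hlt | hlt
    · have : Nat.blt (pf h i) (pf h j) = true := by
        have : pf h i < pf h j := hlt
        simpa [Nat.blt] using this
      rw [vs, this]; exact hval _ _ hlt hj'
    · have : Nat.blt (pf h i) (pf h j) = false := by
        have : pf h j < pf h i := hlt
        rw [← Bool.not_eq_true]; simp [Nat.blt]; omega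
      rw [vs, this, hs]; exact hval _ _ hlt hi'

theorem ladder (a : Fin 7 → Fin 7 → ℕ) (hs : ∀ i j, a i j = a j i) (h1 : ∀ i j, a i j ≤ 1) (v : Fin 7) :
    ∃ σ : Equiv.Perm (Fin 7), σ 6 = v ∧ ∃ c ∈ reps6, CodeRel 6 a σ c := by
  obtain ⟨σ1, e1, c1, hc1, hr1⟩ : ∃ σ : Equiv.Perm (Fin 7), σ 6 = v ∧ ∃ c ∈ [0], CodeRel 1 a σ c := by
    refine ⟨Equiv.swap 6 v, by simp, 0, by simp, ?_⟩
    intro i j hij hj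
    exfalso; have : i.val < j.val := hij; omega
  obtain ⟨σ2, e2, c2, hc2, hr2⟩ := ladder_step 1 (by norm_num) reps2 wit1 lev1 a hs h1 σ1 c1 (by simpa [wit1] using hc1) hr1
  obtain ⟨σ3, e3, c3, hc3, hr3⟩ := ladder_step 2 (by norm_num) reps3 wit2 lev2 a hs h1 σ2 c2 (by rw [hk2]; exact hc2) hr2
  obtain ⟨σ4, e4, c4, hc4, hr4⟩ := ladder_step 3 (by norm_num) reps4 wit3 lev3 a hs h1 σ3 c3 (by rw [hk3]; exact hc3) hr3
  obtain ⟨σ5, e5, c5, hc5, hr5⟩ := ladder_step 4 (by norm_num) reps5 wit4 lev4 a hs h1 σ4 c4 (by rw [hk4]; exact hc4) hr4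
  obtain ⟨σ6, e6, c6, hc6, hr6⟩ := ladder_step 5 (by norm_num) reps6 wit5 lev5 a hs h1 σ5 c5 (by rw [hk5]; exact hc5) hr5
  exact ⟨σ6, by rw [e6, e5, e4, e3, e2, e1], c6, hc6, hr6⟩

theorem ladder_chk (a : Fin 7 → Fin 7 → ℕ) (hs : ∀ i j, a i j = a j i) (h1 : ∀ i j, a i j ≤ 1) (v : Fin 7) :
    ∃ σ : Equiv.Perm (Fin 7), σ 6 = v ∧
      chkA (a (σ 0) (σ 1)) (a (σ 0) (σ 2)) (a (σ 1) (σ 2)) (a (σ 0) (σ 3)) (a (σ 1) (σ 3)) (a (σ 2) (σ 3))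
        (a (σ 0) (σ 4)) (a (σ 1) (σ 4)) (a (σ 2) (σ 4)) (a (σ 3) (σ 4))
        (a (σ 0) (σ 5)) (a (σ 1) (σ 5)) (a (σ 2) (σ 5)) (a (σ 3) (σ 5)) (a (σ 4) (σ 5))
        (a (σ 0) (σ 6)) (a (σ 1) (σ 6)) (a (σ 2) (σ 6)) (a (σ 3) (σ 6)) (a (σ 4) (σ 6)) (a (σ 5) (σ 6)) = true := by
  obtain ⟨σ, hv, c, hc, hr⟩ := ladder a hs h1 v
  obtain ⟨m, hm, hb⟩ := exists_bits 6 (fun i => a (σ (Fin.ofNat 7 i)) (σ 6)) (fun i => h1 _ _)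
  refine ⟨σ, hv, ?_⟩
  have key := chk_all c hc m hm
  rw [hr 0 1 (by decide) (by decide), hr 0 2 (by decide) (by decide), hr 1 2 (by decide) (by decide),
    hr 0 3 (by decide) (by decide), hr 1 3 (by decide) (by decide), hr 2 3 (by decide) (by decide),
    hr 0 4 (by decide) (by decide), hr 1 4 (by decide) (by decide), hr 2 4 (by decide) (by decide), hr 3 4 (by decide) (by decide),
    hr 0 5 (by decide) (by decide), hr 1 5 (by decide) (by decide), hr 2 5 (by decide) (by decide), hr 3 5 (by decide) (by decide), hr 4 5 (by decide) (by decide)]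
  have b0 : bt m 0 = a (σ 0) (σ 6) := hb 0 (by norm_num)
  have b1 : bt m 1 = a (σ 1) (σ 6) := hb 1 (by norm_num)
  have b2 : bt m 2 = a (σ 2) (σ 6) := hb 2 (by norm_num)
  have b3 : bt m 3 = a (σ 3) (σ 6) := hb 3 (by norm_num)
  have b4 : bt m 4 = a (σ 4) (σ 6) := hb 4 (by norm_num)
  have b5 : bt m 5 = a (σ 5) (σ 6) := hb 5 (by norm_num)
  rw [← b0, ← b1, ← b2, ← b3, ← b4, ← b5]
  exact key

set_option linter.unusedSimpArgs false

section pointwise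

def dg (a : Fin 7 → Fin 7 → ℕ) (i : Fin 7) : ℕ := ∑ j, a i j
def cg (a : Fin 7 → Fin 7 → ℕ) (i j : Fin 7) : ℕ := ∑ k, a i k * a j k
def sg (a : Fin 7 → Fin 7 → ℕ) (i : Fin 7) : ℕ := ∑ j, a i j * dg a j
def tg (a : Fin 7 → Fin 7 → ℕ) (i : Fin 7) : ℕ := ∑ j, a i j * cg a i j
def gg (a : Fin 7 → Fin 7 → ℕ) (i : Fin 7) : ℕ := dg a i * dg a i + (2 * sg a i + 30 * tg a i)
def wg (a : Fin 7 → Fin 7 → ℕ) (i : Fin 7) : ℕ := (5 * sg a i + 5 * tg a i) - 4 * dg a i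
def dD (a : Fin 7 → Fin 7 → ℕ) : ℕ := ∑ i, dg a i
def dQ (a : Fin 7 → Fin 7 → ℕ) : ℕ := ∑ i, dg a i * dg a i
def dT (a : Fin 7 → Fin 7 → ℕ) : ℕ := ∑ i, tg a i
def pairA (F : ℕ → ℕ → ℕ → ℕ → ℕ → ℕ → ℕ → ℕ → ℕ → ℕ) (a : Fin 7 → Fin 7 → ℕ) (x y : Fin 7) : ℕ :=
  F (dQ a + 10 * dT a) (a x y) (cg a x y) (dg a x) (dg a y) (gg a x) (gg a y) (wg a x) (wg a y)
def X5 (F : ℕ → ℕ → ℕ → ℕ → ℕ → ℕ → ℕ → ℕ → ℕ → ℕ) (a : Fin 7 → Fin 7 → ℕ) : ℕ :=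
  ∑ x, ∑ y ∈ univ.erase x, pairA F a x y
def sl (a : Fin 7 → Fin 7 → ℕ) (r : Fin 7) (A : Finset (Fin 7)) : ℕ :=
  ∑ i ∈ A, a r i + ∑ i ∈ A, ∑ j ∈ A, a i j * (3 + a r i)
def X1r (W : ℕ → ℕ → ℕ) (a : Fin 7 → Fin 7 → ℕ) (r : Fin 7) : ℕ :=
  ∑ A ∈ powersetCard 3 (univ.erase r), W (13 * sl a r A) (13 * sl a r ((univ.erase r) \ A))
def X1 (W : ℕ → ℕ → ℕ) (a : Fin 7 → Fin 7 → ℕ) : ℕ := ∑ r, X1r W a r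

/-- relabelling -/
def rl (a : Fin 7 → Fin 7 → ℕ) (σ : Equiv.Perm (Fin 7)) : Fin 7 → Fin 7 → ℕ := fun i j => a (σ i) (σ j)

theorem dg_rl (a σ i) : dg (rl a σ) i = dg a (σ i) := Equiv.sum_comp σ (fun j => a (σ i) j)
theorem cg_rl (a σ i j) : cg (rl a σ) i j = cg a (σ i) (σ j) :=
  Equiv.sum_comp σ (fun k => a (σ i) k * a (σ j) k)
theorem sg_rl (a σ i) : sg (rl a σ) i = sg a (σ i) := by
  simp only [sg, dg_rl]; exact Equiv.sum_comp σ (fun j => a (σ i) j * dg a j)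
theorem tg_rl (a σ i) : tg (rl a σ) i = tg a (σ i) := by
  simp only [tg, cg_rl]; exact Equiv.sum_comp σ (fun j => a (σ i) j * cg a (σ i) j)
theorem gg_rl (a σ i) : gg (rl a σ) i = gg a (σ i) := by simp only [gg, dg_rl, sg_rl, tg_rl]
theorem wg_rl (a σ i) : wg (rl a σ) i = wg a (σ i) := by simp only [wg, dg_rl, sg_rl, tg_rl]
theorem dD_rl (a σ) : dD (rl a σ) = dD a := by
  simp only [dD, dg_rl]; exact Equiv.sum_comp σ (fun j => dg a j)
theorem dQ_rl (a σ) : dQ (rl a σ) = dQ a := by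
  simp only [dQ, dg_rl]; exact Equiv.sum_comp σ (fun j => dg a j * dg a j)
theorem dT_rl (a σ) : dT (rl a σ) = dT a := by
  simp only [dT, tg_rl]; exact Equiv.sum_comp σ (fun j => tg a j)
theorem pairA_rl (F a σ x y) : pairA F (rl a σ) x y = pairA F a (σ x) (σ y) := by
  simp only [pairA, dg_rl, cg_rl, gg_rl, wg_rl, dQ_rl, dT_rl]; rfl
theorem X5_rl (F a) (σ : Equiv.Perm (Fin 7)) : X5 F (rl a σ) = X5 F a := by
  rw [X5, X5, ← Equiv.sum_comp σ (fun x => ∑ y ∈ univ.erase x, pairA F a x y)]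
  refine Finset.sum_congr rfl (fun x _ => ?_)
  have e : univ.erase (σ x) = (univ.erase x).map σ.toEmbedding := by
    rw [Finset.map_erase]; simp
  rw [e, Finset.sum_map]
  exact Finset.sum_congr rfl (fun y _ => pairA_rl F a σ x y)
theorem sl_rl (a σ r A) : sl (rl a σ) r A = sl a (σ r) (A.map σ.toEmbedding) := by
  simp only [sl, Finset.sum_map]; rfl
theorem X1r_rl (W a σ r) : X1r W (rl a σ) r = X1r W a (σ r) := by
  have e : univ.erase (σ r) = (univ.erase r).map σ.toEmbedding := by
    rw [Finset.map_erase]; simp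
  simp only [X1r, e, powersetCard_map, Finset.sum_map, sl_rl]
  apply Finset.sum_congr rfl
  intro A _
  congr 3
  ext x
  simp only [Finset.mem_map, Finset.mem_sdiff, mapEmbedding, RelEmbedding.coe_toEmbedding,
    OrderEmbedding.coe_ofMapLEIff]
  constructor
  · rintro ⟨y, ⟨hy, hyA⟩, rfl⟩
    refine ⟨⟨y, hy, rfl⟩, ?_⟩
    rintro ⟨z, hz, hzy⟩
    exact hyA (by rwa [← σ.toEmbedding.injective hzy])
  · rintro ⟨⟨y, hy, rfl⟩, h⟩
    exact ⟨y, ⟨hy, fun hA => h ⟨y, hA, rfl⟩⟩, rfl⟩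
theorem X1_rl (W a) (σ : Equiv.Perm (Fin 7)) : X1 W (rl a σ) = X1 W a := by
  simp only [X1, X1r_rl]; exact Equiv.sum_comp σ (fun j => X1r W a j)

theorem gT_comm (x y) : gT x y = gT y x := by
  show x * y + 4096 * (16384 - (x + y)) = y * x + 4096 * (16384 - (y + x))
  rw [mul_comm x y, add_comm x y]
theorem wL_nil (k x y) : wL k [] x y = 50331648 * k := rfl
theorem wL_cons (k p l x y) : wL k (p :: l) x y = gT ((p >>> x) % 8192) ((p >>> y) % 8192) + wL k l x y := rfl
theorem wL_comm (k l x y) : wL k l x y = wL k l y x := by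
  induction l with
  | nil => rfl
  | cons p l ih => rw [wL_cons, wL_cons, ih, gT_comm]
theorem wT_comm (t x y) : wT t x y = wT t y x := by
  cases t with
  | em => rfl
  | lf k l => exact wL_comm _ _ _ _
  | nd _ _ => rfl
theorem cg_comm (a i j) : cg a i j = cg a j i := by
  simp only [cg]; exact Finset.sum_congr rfl (fun k _ => mul_comm _ _)
theorem nadd (x y : ℕ) : Nat.add x y = x + y := Eq.trans rfl rfl
theorem nmul (x y : ℕ) : Nat.mul x y = x * y := Eq.trans rfl rfl
theorem nsub (x y : ℕ) : Nat.sub x y = x - y := Eq.trans rfl rfl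
theorem nmod (x y : ℕ) : Nat.mod x y = x % y := Eq.trans rfl rfl
theorem pairT_symm (b a c dx dy gx gy wx wy) :
    pairT b a c dx dy gx gy wx wy = pairT b a c dy dx gy gx wy wx := by
  rw [pairT, pairT, wT_comm]
  congr 2
  simp only [nadd, nmul, nsub]
  rw [add_comm dx, add_comm gx]
theorem pairA_comm (F) (hF : ∀ b a c dx dy gx gy wx wy, F b a c dx dy gx gy wx wy = F b a c dy dx gy gx wy wx)
    (a) (hs : ∀ i j, a i j = a j i) (x y) : pairA F a x y = pairA F a y x := by
  rw [pairA, pairA, hs x y, cg_comm a x y, hF]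

theorem root0 (W : ℕ → ℕ → ℕ) (hW : ∀ x y, W x y = W y x) (b : Fin 7 → Fin 7 → ℕ) (hs : ∀ i j, b i j = b j i) (h0 : ∀ i, b i i = 0) :
    X1r W b 0 = 2 * rootT W (b 0 1) (b 0 2) (b 0 3) (b 0 4) (b 0 5) (b 0 6) (b 1 2) (b 1 3) (b 1 4) (b 1 5) (b 1 6)
      (b 2 3) (b 2 4) (b 2 5) (b 2 6) (b 3 4) (b 3 5) (b 3 6) (b 4 5) (b 4 6) (b 5 6) := by
  have hS : powersetCard 3 (univ.erase (0 : Fin 7)) = ([{1,2,3},{1,2,4},{1,2,5},{1,2,6},{1,3,4},{1,3,5},{1,3,6},{1,4,5},{1,4,6},{1,5,6},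
     {4,5,6},{3,5,6},{3,4,6},{3,4,5},{2,5,6},{2,4,6},{2,4,5},{2,3,6},{2,3,5},{2,3,4}] : List (Finset (Fin 7))).toFinset := by decide
  have hsl : ∀ i j k : Fin 7, i ≠ j → i ≠ k → j ≠ k → sl b 0 {i, j, k} =
     (b 0 i + b 0 j + b 0 k) + ((b i j * (6 + 1 * (b 0 i + b 0 j)) + b i k * (6 + 1 * (b 0 i + b 0 k))) + b j k * (6 + 1 * (b 0 j + b 0 k))) := by
    intro i j k h1 h2 h3
    simp only [sl]
    have e : ∀ f : Fin 7 → ℕ, ∑ x ∈ ({i, j, k} : Finset (Fin 7)), f x = f i + (f j + f k) := by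
      intro f
      rw [Finset.sum_insert, Finset.sum_insert, Finset.sum_singleton]
      · simpa using h3
      · simp only [Finset.mem_insert, Finset.mem_singleton, not_or]; exact ⟨h1, h2⟩
    simp only [e]
    rw [h0, h0, h0, hs j i, hs k i, hs k j]
    ring
  rw [X1r, hS, List.sum_toFinset _ (by decide)]
  simp only [List.map_cons, List.map_nil, List.sum_cons, List.sum_nil]
  rw [show (univ.erase (0 : Fin 7)) \ {1,2,3} = {4,5,6} by decide, show (univ.erase (0 : Fin 7)) \ {1,2,4} = {3,5,6} by decide,
    show (univ.erase (0 : Fin 7)) \ {1,2,5} = {3,4,6} by decide, show (univ.erase (0 : Fin 7)) \ {1,2,6} = {3,4,5} by decide,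
    show (univ.erase (0 : Fin 7)) \ {1,3,4} = {2,5,6} by decide, show (univ.erase (0 : Fin 7)) \ {1,3,5} = {2,4,6} by decide,
    show (univ.erase (0 : Fin 7)) \ {1,3,6} = {2,4,5} by decide, show (univ.erase (0 : Fin 7)) \ {1,4,5} = {2,3,6} by decide,
    show (univ.erase (0 : Fin 7)) \ {1,4,6} = {2,3,5} by decide, show (univ.erase (0 : Fin 7)) \ {1,5,6} = {2,3,4} by decide,
    show (univ.erase (0 : Fin 7)) \ {4,5,6} = {1,2,3} by decide, show (univ.erase (0 : Fin 7)) \ {3,5,6} = {1,2,4} by decide,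
    show (univ.erase (0 : Fin 7)) \ {3,4,6} = {1,2,5} by decide, show (univ.erase (0 : Fin 7)) \ {3,4,5} = {1,2,6} by decide,
    show (univ.erase (0 : Fin 7)) \ {2,5,6} = {1,3,4} by decide, show (univ.erase (0 : Fin 7)) \ {2,4,6} = {1,3,5} by decide,
    show (univ.erase (0 : Fin 7)) \ {2,4,5} = {1,3,6} by decide, show (univ.erase (0 : Fin 7)) \ {2,3,6} = {1,4,5} by decide,
    show (univ.erase (0 : Fin 7)) \ {2,3,5} = {1,4,6} by decide, show (univ.erase (0 : Fin 7)) \ {2,3,4} = {1,5,6} by decide]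
  rw [hW (13 * sl b 0 {4,5,6}), hW (13 * sl b 0 {3,5,6}), hW (13 * sl b 0 {3,4,6}), hW (13 * sl b 0 {3,4,5}),
    hW (13 * sl b 0 {2,5,6}), hW (13 * sl b 0 {2,4,6}), hW (13 * sl b 0 {2,4,5}), hW (13 * sl b 0 {2,3,6}),
    hW (13 * sl b 0 {2,3,5}), hW (13 * sl b 0 {2,3,4})]
  simp only [rootT, rootT2]
  rw [hsl 1 2 3 (by decide) (by decide) (by decide), hsl 4 5 6 (by decide) (by decide) (by decide),
   hsl 1 2 4 (by decide) (by decide) (by decide), hsl 3 5 6 (by decide) (by decide) (by decide),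
   hsl 1 2 5 (by decide) (by decide) (by decide), hsl 3 4 6 (by decide) (by decide) (by decide),
   hsl 1 2 6 (by decide) (by decide) (by decide), hsl 3 4 5 (by decide) (by decide) (by decide),
   hsl 1 3 4 (by decide) (by decide) (by decide), hsl 2 5 6 (by decide) (by decide) (by decide),
   hsl 1 3 5 (by decide) (by decide) (by decide), hsl 2 4 6 (by decide) (by decide) (by decide),
   hsl 1 3 6 (by decide) (by decide) (by decide), hsl 2 4 5 (by decide) (by decide) (by decide),
   hsl 1 4 5 (by decide) (by decide) (by decide), hsl 2 3 6 (by decide) (by decide) (by decide),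
   hsl 1 4 6 (by decide) (by decide) (by decide), hsl 2 3 5 (by decide) (by decide) (by decide),
   hsl 1 5 6 (by decide) (by decide) (by decide), hsl 2 3 4 (by decide) (by decide) (by decide)]
  simp only [nadd, nmul]
  ring

theorem chkF_imp (D Q T x5 x1 : ℕ) (h : chkF D Q T x5 x1 = true) :
    (if D = 20 then 8427240 else 0) + (x5 + x1) + 100 * (21 * D + 4 * T) ≤ 27483992928 + 600 * Q := by
  have h := Nat.le_of_ble_eq_true h
  simp only [nadd, nmul] at h
  have e : (bif Nat.beq D 20 then 8427240 else 0) = if D = 20 then 8427240 else 0 := by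
    by_cases hD : D = 20
    · rw [if_pos hD, hD]; rfl
    · have : Nat.beq D 20 = false := by
        rw [← Bool.not_eq_true]; exact fun h => hD (Nat.eq_of_beq_eq_true h)
      rw [if_neg hD, this]; rfl
  rw [e] at h; exact h

theorem chkA_imp (a : Fin 7 → Fin 7 → ℕ) (hs : ∀ i j, a i j = a j i) (h0 : ∀ i, a i i = 0)
    (hm : ∀ i, dg a i ≤ dg a 6)
    (h : chkA (a 0 1) (a 0 2) (a 1 2) (a 0 3) (a 1 3) (a 2 3) (a 0 4) (a 1 4) (a 2 4) (a 3 4) (a 0 5) (a 1 5) (a 2 5) (a 3 5) (a 4 5) (a 0 6) (a 1 6) (a 2 6) (a 3 6) (a 4 6) (a 5 6) = true) :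
    chkF (dD a) (dQ a) (dT a) (x5C pairT (dQ a + 10 * dT a) (a 0 1) (a 0 2) (a 1 2) (a 0 3) (a 1 3) (a 2 3) (a 0 4) (a 1 4) (a 2 4) (a 3 4) (a 0 5) (a 1 5) (a 2 5) (a 3 5) (a 4 5) (a 0 6) (a 1 6) (a 2 6) (a 3 6) (a 4 6) (a 5 6) (cg a 0 1) (cg a 0 2) (cg a 1 2) (cg a 0 3) (cg a 1 3) (cg a 2 3) (cg a 0 4) (cg a 1 4) (cg a 2 4) (cg a 3 4) (cg a 0 5) (cg a 1 5) (cg a 2 5) (cg a 3 5) (cg a 4 5) (cg a 0 6) (cg a 1 6) (cg a 2 6) (cg a 3 6) (cg a 4 6) (cg a 5 6) (dg a 0) (dg a 1) (dg a 2) (dg a 3) (dg a 4) (dg a 5) (dg a 6) (gg a 0) (gg a 1) (gg a 2) (gg a 3) (gg a 4) (gg a 5) (gg a 6) (wg a 0) (wg a 1) (wg a 2) (wg a 3) (wg a 4) (wg a 5) (wg a 6)) (x1C (wL 2 tab1) (a 0 1) (a 0 2) (a 1 2) (a 0 3) (a 1 3) (a 2 3) (a 0 4) (a 1 4) (a 2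 4) (a 3 4) (a 0 5) (a 1 5) (a 2 5) (a 3 5) (a 4 5) (a 0 6) (a 1 6) (a 2 6) (a 3 6) (a 4 6) (a 5 6)) = true := by
  have s10 : a 1 0 = a 0 1 := hs _ _
  have s20 : a 2 0 = a 0 2 := hs _ _
  have s21 : a 2 1 = a 1 2 := hs _ _
  have s30 : a 3 0 = a 0 3 := hs _ _
  have s31 : a 3 1 = a 1 3 := hs _ _
  have s32 : a 3 2 = a 2 3 := hs _ _
  have s40 : a 4 0 = a 0 4 := hs _ _
  have s41 : a 4 1 = a 1 4 := hs _ _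
  have s42 : a 4 2 = a 2 4 := hs _ _
  have s43 : a 4 3 = a 3 4 := hs _ _
  have s50 : a 5 0 = a 0 5 := hs _ _
  have s51 : a 5 1 = a 1 5 := hs _ _
  have s52 : a 5 2 = a 2 5 := hs _ _
  have s53 : a 5 3 = a 3 5 := hs _ _
  have s54 : a 5 4 = a 4 5 := hs _ _
  have s60 : a 6 0 = a 0 6 := hs _ _
  have s61 : a 6 1 = a 1 6 := hs _ _
  have s62 : a 6 2 = a 2 6 := hs _ _
  have s63 : a 6 3 = a 3 6 := hs _ _
  have s64 : a 6 4 = a 4 6 := hs _ _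
  have s65 : a 6 5 = a 5 6 := hs _ _
  have hc01 : (Nat.add (Nat.add (Nat.add (Nat.add (Nat.mul (a 0 2) (a 1 2)) (Nat.mul (a 0 3) (a 1 3))) (Nat.mul (a 0 4) (a 1 4))) (Nat.mul (a 0 5) (a 1 5))) (Nat.mul (a 0 6) (a 1 6))) = cg a 0 1 := by
    simp only [cg, Fin.sum_univ_seven, h0, nadd, nmul, s10, s20, s21, s30, s31, s32, s40, s41, s42, s43, s50, s51, s52, s53, s54, s60, s61, s62, s63, s64, s65]; ring
  have hc02 : (Nat.add (Nat.add (Nat.add (Nat.add (Nat.mul (a 0 1) (a 1 2)) (Nat.mul (a 0 3) (a 2 3))) (Nat.mul (a 0 4) (a 2 4))) (Nat.mul (a 0 5) (a 2 5))) (Nat.mul (a 0 6) (a 2 6))) = cg a 0 2 := by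
    simp only [cg, Fin.sum_univ_seven, h0, nadd, nmul, s10, s20, s21, s30, s31, s32, s40, s41, s42, s43, s50, s51, s52, s53, s54, s60, s61, s62, s63, s64, s65]; ring
  have hc12 : (Nat.add (Nat.add (Nat.add (Nat.add (Nat.mul (a 0 1) (a 0 2)) (Nat.mul (a 1 3) (a 2 3))) (Nat.mul (a 1 4) (a 2 4))) (Nat.mul (a 1 5) (a 2 5))) (Nat.mul (a 1 6) (a 2 6))) = cg a 1 2 := by
    simp only [cg, Fin.sum_univ_seven, h0, nadd, nmul, s10, s20, s21, s30, s31, s32, s40, s41, s42, s43, s50, s51, s52, s53, s54, s60, s61, s62, s63, s64, s65]; ring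
  have hc03 : (Nat.add (Nat.add (Nat.add (Nat.add (Nat.mul (a 0 1) (a 1 3)) (Nat.mul (a 0 2) (a 2 3))) (Nat.mul (a 0 4) (a 3 4))) (Nat.mul (a 0 5) (a 3 5))) (Nat.mul (a 0 6) (a 3 6))) = cg a 0 3 := by
    simp only [cg, Fin.sum_univ_seven, h0, nadd, nmul, s10, s20, s21, s30, s31, s32, s40, s41, s42, s43, s50, s51, s52, s53, s54, s60, s61, s62, s63, s64, s65]; ring
  have hc13 : (Nat.add (Nat.add (Nat.add (Nat.add (Nat.mul (a 0 1) (a 0 3)) (Nat.mul (a 1 2) (a 2 3))) (Nat.mul (a 1 4) (a 3 4))) (Nat.mul (a 1 5) (a 3 5))) (Nat.mul (a 1 6) (a 3 6))) = cg a 1 3 := by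
    simp only [cg, Fin.sum_univ_seven, h0, nadd, nmul, s10, s20, s21, s30, s31, s32, s40, s41, s42, s43, s50, s51, s52, s53, s54, s60, s61, s62, s63, s64, s65]; ring
  have hc23 : (Nat.add (Nat.add (Nat.add (Nat.add (Nat.mul (a 0 2) (a 0 3)) (Nat.mul (a 1 2) (a 1 3))) (Nat.mul (a 2 4) (a 3 4))) (Nat.mul (a 2 5) (a 3 5))) (Nat.mul (a 2 6) (a 3 6))) = cg a 2 3 := by
    simp only [cg, Fin.sum_univ_seven, h0, nadd, nmul, s10, s20, s21, s30, s31, s32, s40, s41, s42, s43, s50, s51, s52, s53, s54, s60, s61, s62, s63, s64, s65]; ring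
  have hc04 : (Nat.add (Nat.add (Nat.add (Nat.add (Nat.mul (a 0 1) (a 1 4)) (Nat.mul (a 0 2) (a 2 4))) (Nat.mul (a 0 3) (a 3 4))) (Nat.mul (a 0 5) (a 4 5))) (Nat.mul (a 0 6) (a 4 6))) = cg a 0 4 := by
    simp only [cg, Fin.sum_univ_seven, h0, nadd, nmul, s10, s20, s21, s30, s31, s32, s40, s41, s42, s43, s50, s51, s52, s53, s54, s60, s61, s62, s63, s64, s65]; ring
  have hc14 : (Nat.add (Nat.add (Nat.add (Nat.add (Nat.mul (a 0 1) (a 0 4)) (Nat.mul (a 1 2) (a 2 4))) (Nat.mul (a 1 3) (a 3 4))) (Nat.mul (a 1 5) (a 4 5))) (Nat.mul (a 1 6) (a 4 6))) = cg a 1 4 := by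
    simp only [cg, Fin.sum_univ_seven, h0, nadd, nmul, s10, s20, s21, s30, s31, s32, s40, s41, s42, s43, s50, s51, s52, s53, s54, s60, s61, s62, s63, s64, s65]; ring
  have hc24 : (Nat.add (Nat.add (Nat.add (Nat.add (Nat.mul (a 0 2) (a 0 4)) (Nat.mul (a 1 2) (a 1 4))) (Nat.mul (a 2 3) (a 3 4))) (Nat.mul (a 2 5) (a 4 5))) (Nat.mul (a 2 6) (a 4 6))) = cg a 2 4 := by
    simp only [cg, Fin.sum_univ_seven, h0, nadd, nmul, s10, s20, s21, s30, s31, s32, s40, s41, s42, s43, s50, s51, s52, s53, s54, s60, s61, s62, s63, s64, s65]; ring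
  have hc34 : (Nat.add (Nat.add (Nat.add (Nat.add (Nat.mul (a 0 3) (a 0 4)) (Nat.mul (a 1 3) (a 1 4))) (Nat.mul (a 2 3) (a 2 4))) (Nat.mul (a 3 5) (a 4 5))) (Nat.mul (a 3 6) (a 4 6))) = cg a 3 4 := by
    simp only [cg, Fin.sum_univ_seven, h0, nadd, nmul, s10, s20, s21, s30, s31, s32, s40, s41, s42, s43, s50, s51, s52, s53, s54, s60, s61, s62, s63, s64, s65]; ring
  have hc05 : (Nat.add (Nat.add (Nat.add (Nat.add (Nat.mul (a 0 1) (a 1 5)) (Nat.mul (a 0 2) (a 2 5))) (Nat.mul (a 0 3) (a 3 5))) (Nat.mul (a 0 4) (a 4 5))) (Nat.mul (a 0 6) (a 5 6))) = cg a 0 5 := by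
    simp only [cg, Fin.sum_univ_seven, h0, nadd, nmul, s10, s20, s21, s30, s31, s32, s40, s41, s42, s43, s50, s51, s52, s53, s54, s60, s61, s62, s63, s64, s65]; ring
  have hc15 : (Nat.add (Nat.add (Nat.add (Nat.add (Nat.mul (a 0 1) (a 0 5)) (Nat.mul (a 1 2) (a 2 5))) (Nat.mul (a 1 3) (a 3 5))) (Nat.mul (a 1 4) (a 4 5))) (Nat.mul (a 1 6) (a 5 6))) = cg a 1 5 := by
    simp only [cg, Fin.sum_univ_seven, h0, nadd, nmul, s10, s20, s21, s30, s31, s32, s40, s41, s42, s43, s50, s51, s52, s53, s54, s60, s61, s62, s63, s64, s65]; ring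
  have hc25 : (Nat.add (Nat.add (Nat.add (Nat.add (Nat.mul (a 0 2) (a 0 5)) (Nat.mul (a 1 2) (a 1 5))) (Nat.mul (a 2 3) (a 3 5))) (Nat.mul (a 2 4) (a 4 5))) (Nat.mul (a 2 6) (a 5 6))) = cg a 2 5 := by
    simp only [cg, Fin.sum_univ_seven, h0, nadd, nmul, s10, s20, s21, s30, s31, s32, s40, s41, s42, s43, s50, s51, s52, s53, s54, s60, s61, s62, s63, s64, s65]; ring
  have hc35 : (Nat.add (Nat.add (Nat.add (Nat.add (Nat.mul (a 0 3) (a 0 5)) (Nat.mul (a 1 3) (a 1 5))) (Nat.mul (a 2 3) (a 2 5))) (Nat.mul (a 3 4) (a 4 5))) (Nat.mul (a 3 6) (a 5 6))) = cg a 3 5 := by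
    simp only [cg, Fin.sum_univ_seven, h0, nadd, nmul, s10, s20, s21, s30, s31, s32, s40, s41, s42, s43, s50, s51, s52, s53, s54, s60, s61, s62, s63, s64, s65]; ring
  have hc45 : (Nat.add (Nat.add (Nat.add (Nat.add (Nat.mul (a 0 4) (a 0 5)) (Nat.mul (a 1 4) (a 1 5))) (Nat.mul (a 2 4) (a 2 5))) (Nat.mul (a 3 4) (a 3 5))) (Nat.mul (a 4 6) (a 5 6))) = cg a 4 5 := by
    simp only [cg, Fin.sum_univ_seven, h0, nadd, nmul, s10, s20, s21, s30, s31, s32, s40, s41, s42, s43, s50, s51, s52, s53, s54, s60, s61, s62, s63, s64, s65]; ring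
  have hc06 : (Nat.add (Nat.add (Nat.add (Nat.add (Nat.mul (a 0 1) (a 1 6)) (Nat.mul (a 0 2) (a 2 6))) (Nat.mul (a 0 3) (a 3 6))) (Nat.mul (a 0 4) (a 4 6))) (Nat.mul (a 0 5) (a 5 6))) = cg a 0 6 := by
    simp only [cg, Fin.sum_univ_seven, h0, nadd, nmul, s10, s20, s21, s30, s31, s32, s40, s41, s42, s43, s50, s51, s52, s53, s54, s60, s61, s62, s63, s64, s65]; ring
  have hc16 : (Nat.add (Nat.add (Nat.add (Nat.add (Nat.mul (a 0 1) (a 0 6)) (Nat.mul (a 1 2) (a 2 6))) (Nat.mul (a 1 3) (a 3 6))) (Nat.mul (a 1 4) (a 4 6))) (Nat.mul (a 1 5) (a 5 6))) = cg a 1 6 := by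
    simp only [cg, Fin.sum_univ_seven, h0, nadd, nmul, s10, s20, s21, s30, s31, s32, s40, s41, s42, s43, s50, s51, s52, s53, s54, s60, s61, s62, s63, s64, s65]; ring
  have hc26 : (Nat.add (Nat.add (Nat.add (Nat.add (Nat.mul (a 0 2) (a 0 6)) (Nat.mul (a 1 2) (a 1 6))) (Nat.mul (a 2 3) (a 3 6))) (Nat.mul (a 2 4) (a 4 6))) (Nat.mul (a 2 5) (a 5 6))) = cg a 2 6 := by
    simp only [cg, Fin.sum_univ_seven, h0, nadd, nmul, s10, s20, s21, s30, s31, s32, s40, s41, s42, s43, s50, s51, s52, s53, s54, s60, s61, s62, s63, s64, s65]; ring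
  have hc36 : (Nat.add (Nat.add (Nat.add (Nat.add (Nat.mul (a 0 3) (a 0 6)) (Nat.mul (a 1 3) (a 1 6))) (Nat.mul (a 2 3) (a 2 6))) (Nat.mul (a 3 4) (a 4 6))) (Nat.mul (a 3 5) (a 5 6))) = cg a 3 6 := by
    simp only [cg, Fin.sum_univ_seven, h0, nadd, nmul, s10, s20, s21, s30, s31, s32, s40, s41, s42, s43, s50, s51, s52, s53, s54, s60, s61, s62, s63, s64, s65]; ring
  have hc46 : (Nat.add (Nat.add (Nat.add (Nat.add (Nat.mul (a 0 4) (a 0 6)) (Nat.mul (a 1 4) (a 1 6))) (Nat.mul (a 2 4) (a 2 6))) (Nat.mul (a 3 4) (a 3 6))) (Nat.mul (a 4 5) (a 5 6))) = cg a 4 6 := by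
    simp only [cg, Fin.sum_univ_seven, h0, nadd, nmul, s10, s20, s21, s30, s31, s32, s40, s41, s42, s43, s50, s51, s52, s53, s54, s60, s61, s62, s63, s64, s65]; ring
  have hc56 : (Nat.add (Nat.add (Nat.add (Nat.add (Nat.mul (a 0 5) (a 0 6)) (Nat.mul (a 1 5) (a 1 6))) (Nat.mul (a 2 5) (a 2 6))) (Nat.mul (a 3 5) (a 3 6))) (Nat.mul (a 4 5) (a 4 6))) = cg a 5 6 := by
    simp only [cg, Fin.sum_univ_seven, h0, nadd, nmul, s10, s20, s21, s30, s31, s32, s40, s41, s42, s43, s50, s51, s52, s53, s54, s60, s61, s62, s63, s64, s65]; ring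
  have hd0 : (Nat.add (Nat.add (Nat.add (Nat.add (Nat.add (a 0 1) (a 0 2)) (a 0 3)) (a 0 4)) (a 0 5)) (a 0 6)) = dg a 0 := by
    simp only [dg, Fin.sum_univ_seven, h0, nadd, s10, s20, s21, s30, s31, s32, s40, s41, s42, s43, s50, s51, s52, s53, s54, s60, s61, s62, s63, s64, s65]; ring
  have hd1 : (Nat.add (Nat.add (Nat.add (Nat.add (Nat.add (a 0 1) (a 1 2)) (a 1 3)) (a 1 4)) (a 1 5)) (a 1 6)) = dg a 1 := by
    simp only [dg, Fin.sum_univ_seven, h0, nadd, s10, s20, s21, s30, s31, s32, s40, s41, s42, s43, s50, s51, s52, s53, s54, s60, s61, s62, s63, s64, s65]; ring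
  have hd2 : (Nat.add (Nat.add (Nat.add (Nat.add (Nat.add (a 0 2) (a 1 2)) (a 2 3)) (a 2 4)) (a 2 5)) (a 2 6)) = dg a 2 := by
    simp only [dg, Fin.sum_univ_seven, h0, nadd, s10, s20, s21, s30, s31, s32, s40, s41, s42, s43, s50, s51, s52, s53, s54, s60, s61, s62, s63, s64, s65]; ring
  have hd3 : (Nat.add (Nat.add (Nat.add (Nat.add (Nat.add (a 0 3) (a 1 3)) (a 2 3)) (a 3 4)) (a 3 5)) (a 3 6)) = dg a 3 := by
    simp only [dg, Fin.sum_univ_seven, h0, nadd, s10, s20, s21, s30, s31, s32, s40, s41, s42, s43, s50, s51, s52, s53, s54, s60, s61, s62, s63, s64, s65]; ring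
  have hd4 : (Nat.add (Nat.add (Nat.add (Nat.add (Nat.add (a 0 4) (a 1 4)) (a 2 4)) (a 3 4)) (a 4 5)) (a 4 6)) = dg a 4 := by
    simp only [dg, Fin.sum_univ_seven, h0, nadd, s10, s20, s21, s30, s31, s32, s40, s41, s42, s43, s50, s51, s52, s53, s54, s60, s61, s62, s63, s64, s65]; ring
  have hd5 : (Nat.add (Nat.add (Nat.add (Nat.add (Nat.add (a 0 5) (a 1 5)) (a 2 5)) (a 3 5)) (a 4 5)) (a 5 6)) = dg a 5 := by
    simp only [dg, Fin.sum_univ_seven, h0, nadd, s10, s20, s21, s30, s31, s32, s40, s41, s42, s43, s50, s51, s52, s53, s54, s60, s61, s62, s63, s64, s65]; ring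
  have hd6 : (Nat.add (Nat.add (Nat.add (Nat.add (Nat.add (a 0 6) (a 1 6)) (a 2 6)) (a 3 6)) (a 4 6)) (a 5 6)) = dg a 6 := by
    simp only [dg, Fin.sum_univ_seven, h0, nadd, s10, s20, s21, s30, s31, s32, s40, s41, s42, s43, s50, s51, s52, s53, s54, s60, s61, s62, s63, s64, s65]; ring
  have hs0 : (Nat.add (Nat.add (Nat.add (Nat.add (Nat.add (Nat.mul (a 0 1) (dg a 1)) (Nat.mul (a 0 2) (dg a 2))) (Nat.mul (a 0 3) (dg a 3))) (Nat.mul (a 0 4) (dg a 4))) (Nat.mul (a 0 5) (dg a 5))) (Nat.mul (a 0 6) (dg a 6))) = sg a 0 := by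
    simp only [sg, Fin.sum_univ_seven, h0, nadd, nmul, s10, s20, s21, s30, s31, s32, s40, s41, s42, s43, s50, s51, s52, s53, s54, s60, s61, s62, s63, s64, s65]; ring
  have hs1 : (Nat.add (Nat.add (Nat.add (Nat.add (Nat.add (Nat.mul (a 0 1) (dg a 0)) (Nat.mul (a 1 2) (dg a 2))) (Nat.mul (a 1 3) (dg a 3))) (Nat.mul (a 1 4) (dg a 4))) (Nat.mul (a 1 5) (dg a 5))) (Nat.mul (a 1 6) (dg a 6))) = sg a 1 := by
    simp only [sg, Fin.sum_univ_seven, h0, nadd, nmul, s10, s20, s21, s30, s31, s32, s40, s41, s42, s43, s50, s51, s52, s53, s54, s60, s61, s62, s63, s64, s65]; ring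
  have hs2 : (Nat.add (Nat.add (Nat.add (Nat.add (Nat.add (Nat.mul (a 0 2) (dg a 0)) (Nat.mul (a 1 2) (dg a 1))) (Nat.mul (a 2 3) (dg a 3))) (Nat.mul (a 2 4) (dg a 4))) (Nat.mul (a 2 5) (dg a 5))) (Nat.mul (a 2 6) (dg a 6))) = sg a 2 := by
    simp only [sg, Fin.sum_univ_seven, h0, nadd, nmul, s10, s20, s21, s30, s31, s32, s40, s41, s42, s43, s50, s51, s52, s53, s54, s60, s61, s62, s63, s64, s65]; ring
  have hs3 : (Nat.add (Nat.add (Nat.add (Nat.add (Nat.add (Nat.mul (a 0 3) (dg a 0)) (Nat.mul (a 1 3) (dg a 1))) (Nat.mul (a 2 3) (dg a 2))) (Nat.mul (a 3 4) (dg a 4))) (Nat.mul (a 3 5) (dg a 5))) (Nat.mul (a 3 6) (dg a 6))) = sg a 3 := by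
    simp only [sg, Fin.sum_univ_seven, h0, nadd, nmul, s10, s20, s21, s30, s31, s32, s40, s41, s42, s43, s50, s51, s52, s53, s54, s60, s61, s62, s63, s64, s65]; ring
  have hs4 : (Nat.add (Nat.add (Nat.add (Nat.add (Nat.add (Nat.mul (a 0 4) (dg a 0)) (Nat.mul (a 1 4) (dg a 1))) (Nat.mul (a 2 4) (dg a 2))) (Nat.mul (a 3 4) (dg a 3))) (Nat.mul (a 4 5) (dg a 5))) (Nat.mul (a 4 6) (dg a 6))) = sg a 4 := by
    simp only [sg, Fin.sum_univ_seven, h0, nadd, nmul, s10, s20, s21, s30, s31, s32, s40, s41, s42, s43, s50, s51, s52, s53, s54, s60, s61, s62, s63, s64, s65]; ring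
  have hs5 : (Nat.add (Nat.add (Nat.add (Nat.add (Nat.add (Nat.mul (a 0 5) (dg a 0)) (Nat.mul (a 1 5) (dg a 1))) (Nat.mul (a 2 5) (dg a 2))) (Nat.mul (a 3 5) (dg a 3))) (Nat.mul (a 4 5) (dg a 4))) (Nat.mul (a 5 6) (dg a 6))) = sg a 5 := by
    simp only [sg, Fin.sum_univ_seven, h0, nadd, nmul, s10, s20, s21, s30, s31, s32, s40, s41, s42, s43, s50, s51, s52, s53, s54, s60, s61, s62, s63, s64, s65]; ring
  have hs6 : (Nat.add (Nat.add (Nat.add (Nat.add (Nat.add (Nat.mul (a 0 6) (dg a 0)) (Nat.mul (a 1 6) (dg a 1))) (Nat.mul (a 2 6) (dg a 2))) (Nat.mul (a 3 6) (dg a 3))) (Nat.mul (a 4 6) (dg a 4))) (Nat.mul (a 5 6) (dg a 5))) = sg a 6 := by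
    simp only [sg, Fin.sum_univ_seven, h0, nadd, nmul, s10, s20, s21, s30, s31, s32, s40, s41, s42, s43, s50, s51, s52, s53, s54, s60, s61, s62, s63, s64, s65]; ring
  have cc := cg_comm a
  have k10 : cg a 1 0 = cg a 0 1 := cc _ _
  have k20 : cg a 2 0 = cg a 0 2 := cc _ _
  have k21 : cg a 2 1 = cg a 1 2 := cc _ _
  have k30 : cg a 3 0 = cg a 0 3 := cc _ _
  have k31 : cg a 3 1 = cg a 1 3 := cc _ _
  have k32 : cg a 3 2 = cg a 2 3 := cc _ _
  have k40 : cg a 4 0 = cg a 0 4 := cc _ _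
  have k41 : cg a 4 1 = cg a 1 4 := cc _ _
  have k42 : cg a 4 2 = cg a 2 4 := cc _ _
  have k43 : cg a 4 3 = cg a 3 4 := cc _ _
  have k50 : cg a 5 0 = cg a 0 5 := cc _ _
  have k51 : cg a 5 1 = cg a 1 5 := cc _ _
  have k52 : cg a 5 2 = cg a 2 5 := cc _ _
  have k53 : cg a 5 3 = cg a 3 5 := cc _ _
  have k54 : cg a 5 4 = cg a 4 5 := cc _ _
  have k60 : cg a 6 0 = cg a 0 6 := cc _ _
  have k61 : cg a 6 1 = cg a 1 6 := cc _ _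
  have k62 : cg a 6 2 = cg a 2 6 := cc _ _
  have k63 : cg a 6 3 = cg a 3 6 := cc _ _
  have k64 : cg a 6 4 = cg a 4 6 := cc _ _
  have k65 : cg a 6 5 = cg a 5 6 := cc _ _
  have ht0 : (Nat.add (Nat.add (Nat.add (Nat.add (Nat.add (Nat.mul (a 0 1) (cg a 0 1)) (Nat.mul (a 0 2) (cg a 0 2))) (Nat.mul (a 0 3) (cg a 0 3))) (Nat.mul (a 0 4) (cg a 0 4))) (Nat.mul (a 0 5) (cg a 0 5))) (Nat.mul (a 0 6) (cg a 0 6))) = tg a 0 := by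
    simp only [tg, Fin.sum_univ_seven, h0, nadd, nmul, s10, s20, s21, s30, s31, s32, s40, s41, s42, s43, s50, s51, s52, s53, s54, s60, s61, s62, s63, s64, s65, k10, k20, k21, k30, k31, k32, k40, k41, k42, k43, k50, k51, k52, k53, k54, k60, k61, k62, k63, k64, k65]; ring
  have ht1 : (Nat.add (Nat.add (Nat.add (Nat.add (Nat.add (Nat.mul (a 0 1) (cg a 0 1)) (Nat.mul (a 1 2) (cg a 1 2))) (Nat.mul (a 1 3) (cg a 1 3))) (Nat.mul (a 1 4) (cg a 1 4))) (Nat.mul (a 1 5) (cg a 1 5))) (Nat.mul (a 1 6) (cg a 1 6))) = tg a 1 := by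
    simp only [tg, Fin.sum_univ_seven, h0, nadd, nmul, s10, s20, s21, s30, s31, s32, s40, s41, s42, s43, s50, s51, s52, s53, s54, s60, s61, s62, s63, s64, s65, k10, k20, k21, k30, k31, k32, k40, k41, k42, k43, k50, k51, k52, k53, k54, k60, k61, k62, k63, k64, k65]; ring
  have ht2 : (Nat.add (Nat.add (Nat.add (Nat.add (Nat.add (Nat.mul (a 0 2) (cg a 0 2)) (Nat.mul (a 1 2) (cg a 1 2))) (Nat.mul (a 2 3) (cg a 2 3))) (Nat.mul (a 2 4) (cg a 2 4))) (Nat.mul (a 2 5) (cg a 2 5))) (Nat.mul (a 2 6) (cg a 2 6))) = tg a 2 := by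
    simp only [tg, Fin.sum_univ_seven, h0, nadd, nmul, s10, s20, s21, s30, s31, s32, s40, s41, s42, s43, s50, s51, s52, s53, s54, s60, s61, s62, s63, s64, s65, k10, k20, k21, k30, k31, k32, k40, k41, k42, k43, k50, k51, k52, k53, k54, k60, k61, k62, k63, k64, k65]; ring
  have ht3 : (Nat.add (Nat.add (Nat.add (Nat.add (Nat.add (Nat.mul (a 0 3) (cg a 0 3)) (Nat.mul (a 1 3) (cg a 1 3))) (Nat.mul (a 2 3) (cg a 2 3))) (Nat.mul (a 3 4) (cg a 3 4))) (Nat.mul (a 3 5) (cg a 3 5))) (Nat.mul (a 3 6) (cg a 3 6))) = tg a 3 := by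
    simp only [tg, Fin.sum_univ_seven, h0, nadd, nmul, s10, s20, s21, s30, s31, s32, s40, s41, s42, s43, s50, s51, s52, s53, s54, s60, s61, s62, s63, s64, s65, k10, k20, k21, k30, k31, k32, k40, k41, k42, k43, k50, k51, k52, k53, k54, k60, k61, k62, k63, k64, k65]; ring
  have ht4 : (Nat.add (Nat.add (Nat.add (Nat.add (Nat.add (Nat.mul (a 0 4) (cg a 0 4)) (Nat.mul (a 1 4) (cg a 1 4))) (Nat.mul (a 2 4) (cg a 2 4))) (Nat.mul (a 3 4) (cg a 3 4))) (Nat.mul (a 4 5) (cg a 4 5))) (Nat.mul (a 4 6) (cg a 4 6))) = tg a 4 := by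
    simp only [tg, Fin.sum_univ_seven, h0, nadd, nmul, s10, s20, s21, s30, s31, s32, s40, s41, s42, s43, s50, s51, s52, s53, s54, s60, s61, s62, s63, s64, s65, k10, k20, k21, k30, k31, k32, k40, k41, k42, k43, k50, k51, k52, k53, k54, k60, k61, k62, k63, k64, k65]; ring
  have ht5 : (Nat.add (Nat.add (Nat.add (Nat.add (Nat.add (Nat.mul (a 0 5) (cg a 0 5)) (Nat.mul (a 1 5) (cg a 1 5))) (Nat.mul (a 2 5) (cg a 2 5))) (Nat.mul (a 3 5) (cg a 3 5))) (Nat.mul (a 4 5) (cg a 4 5))) (Nat.mul (a 5 6) (cg a 5 6))) = tg a 5 := by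
    simp only [tg, Fin.sum_univ_seven, h0, nadd, nmul, s10, s20, s21, s30, s31, s32, s40, s41, s42, s43, s50, s51, s52, s53, s54, s60, s61, s62, s63, s64, s65, k10, k20, k21, k30, k31, k32, k40, k41, k42, k43, k50, k51, k52, k53, k54, k60, k61, k62, k63, k64, k65]; ring
  have ht6 : (Nat.add (Nat.add (Nat.add (Nat.add (Nat.add (Nat.mul (a 0 6) (cg a 0 6)) (Nat.mul (a 1 6) (cg a 1 6))) (Nat.mul (a 2 6) (cg a 2 6))) (Nat.mul (a 3 6) (cg a 3 6))) (Nat.mul (a 4 6) (cg a 4 6))) (Nat.mul (a 5 6) (cg a 5 6))) = tg a 6 := by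
    simp only [tg, Fin.sum_univ_seven, h0, nadd, nmul, s10, s20, s21, s30, s31, s32, s40, s41, s42, s43, s50, s51, s52, s53, s54, s60, s61, s62, s63, s64, s65, k10, k20, k21, k30, k31, k32, k40, k41, k42, k43, k50, k51, k52, k53, k54, k60, k61, k62, k63, k64, k65]; ring
  rw [chkA, hc01, hc02, hc12, hc03, hc13, hc23, hc04, hc14, hc24, hc34, hc05, hc15, hc25, hc35, hc45, hc06, hc16, hc26, hc36, hc46, hc56, hd0, hd1, hd2, hd3, hd4, hd5, hd6] at h
  have hmx : maxD (dg a 0) (dg a 1) (dg a 2) (dg a 3) (dg a 4) (dg a 5) (dg a 6) = true := by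
    simp only [maxD, Nat.ble_eq_true_of_le (hm _), cond_true]
  rw [chkB, hmx, cond_true, hs0, hs1, hs2, hs3, hs4, hs5, hs6, ht0, ht1, ht2, ht3, ht4, ht5, ht6] at h
  have hg0 : (Nat.add (Nat.mul (dg a 0) (dg a 0)) (Nat.add (Nat.mul 2 (sg a 0)) (Nat.mul 30 (tg a 0)))) = gg a 0 := by
    simp only [gg, nadd, nmul]
  have hw0 : (Nat.sub (Nat.add (Nat.mul 5 (sg a 0)) (Nat.mul 5 (tg a 0))) (Nat.mul 4 (dg a 0))) = wg a 0 := by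
    simp only [wg, nadd, nmul, nsub]
  have hg1 : (Nat.add (Nat.mul (dg a 1) (dg a 1)) (Nat.add (Nat.mul 2 (sg a 1)) (Nat.mul 30 (tg a 1)))) = gg a 1 := by
    simp only [gg, nadd, nmul]
  have hw1 : (Nat.sub (Nat.add (Nat.mul 5 (sg a 1)) (Nat.mul 5 (tg a 1))) (Nat.mul 4 (dg a 1))) = wg a 1 := by
    simp only [wg, nadd, nmul, nsub]
  have hg2 : (Nat.add (Nat.mul (dg a 2) (dg a 2)) (Nat.add (Nat.mul 2 (sg a 2)) (Nat.mul 30 (tg a 2)))) = gg a 2 := by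
    simp only [gg, nadd, nmul]
  have hw2 : (Nat.sub (Nat.add (Nat.mul 5 (sg a 2)) (Nat.mul 5 (tg a 2))) (Nat.mul 4 (dg a 2))) = wg a 2 := by
    simp only [wg, nadd, nmul, nsub]
  have hg3 : (Nat.add (Nat.mul (dg a 3) (dg a 3)) (Nat.add (Nat.mul 2 (sg a 3)) (Nat.mul 30 (tg a 3)))) = gg a 3 := by
    simp only [gg, nadd, nmul]
  have hw3 : (Nat.sub (Nat.add (Nat.mul 5 (sg a 3)) (Nat.mul 5 (tg a 3))) (Nat.mul 4 (dg a 3))) = wg a 3 := by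
    simp only [wg, nadd, nmul, nsub]
  have hg4 : (Nat.add (Nat.mul (dg a 4) (dg a 4)) (Nat.add (Nat.mul 2 (sg a 4)) (Nat.mul 30 (tg a 4)))) = gg a 4 := by
    simp only [gg, nadd, nmul]
  have hw4 : (Nat.sub (Nat.add (Nat.mul 5 (sg a 4)) (Nat.mul 5 (tg a 4))) (Nat.mul 4 (dg a 4))) = wg a 4 := by
    simp only [wg, nadd, nmul, nsub]
  have hg5 : (Nat.add (Nat.mul (dg a 5) (dg a 5)) (Nat.add (Nat.mul 2 (sg a 5)) (Nat.mul 30 (tg a 5)))) = gg a 5 := by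
    simp only [gg, nadd, nmul]
  have hw5 : (Nat.sub (Nat.add (Nat.mul 5 (sg a 5)) (Nat.mul 5 (tg a 5))) (Nat.mul 4 (dg a 5))) = wg a 5 := by
    simp only [wg, nadd, nmul, nsub]
  have hg6 : (Nat.add (Nat.mul (dg a 6) (dg a 6)) (Nat.add (Nat.mul 2 (sg a 6)) (Nat.mul 30 (tg a 6)))) = gg a 6 := by
    simp only [gg, nadd, nmul]
  have hw6 : (Nat.sub (Nat.add (Nat.mul 5 (sg a 6)) (Nat.mul 5 (tg a 6))) (Nat.mul 4 (dg a 6))) = wg a 6 := by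
    simp only [wg, nadd, nmul, nsub]
  have hD : (Nat.add (Nat.add (Nat.add (Nat.add (Nat.add (Nat.add (dg a 0) (dg a 1)) (dg a 2)) (dg a 3)) (dg a 4)) (dg a 5)) (dg a 6)) = dD a := by
    simp only [dD, Fin.sum_univ_seven, nadd]
  have hQ : (Nat.add (Nat.add (Nat.add (Nat.add (Nat.add (Nat.add (Nat.mul (dg a 0) (dg a 0)) (Nat.mul (dg a 1) (dg a 1))) (Nat.mul (dg a 2) (dg a 2))) (Nat.mul (dg a 3) (dg a 3))) (Nat.mul (dg a 4) (dg a 4))) (Nat.mul (dg a 5) (dg a 5))) (Nat.mul (dg a 6) (dg a 6))) = dQ a := by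
    simp only [dQ, Fin.sum_univ_seven, nadd, nmul]
  have hT : (Nat.add (Nat.add (Nat.add (Nat.add (Nat.add (Nat.add (tg a 0) (tg a 1)) (tg a 2)) (tg a 3)) (tg a 4)) (tg a 5)) (tg a 6)) = dT a := by
    simp only [dT, Fin.sum_univ_seven, nadd]
  rw [chkC, hD, hQ, hT, hg0, hg1, hg2, hg3, hg4, hg5, hg6, hw0, hw1, hw2, hw3, hw4, hw5, hw6] at h
  simp only [nadd, nmul] at h
  exact h

theorem x5C_eq (F) (hF : ∀ b a c dx dy gx gy wx wy, F b a c dx dy gx gy wx wy = F b a c dy dx gy gx wy wx)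
    (a : Fin 7 → Fin 7 → ℕ) (hs : ∀ i j, a i j = a j i) (h0 : ∀ i, a i i = 0) :
    X5 F a = 2 * x5C F (dQ a + 10 * dT a) (a 0 1) (a 0 2) (a 1 2) (a 0 3) (a 1 3) (a 2 3) (a 0 4) (a 1 4) (a 2 4) (a 3 4) (a 0 5) (a 1 5) (a 2 5) (a 3 5) (a 4 5) (a 0 6) (a 1 6) (a 2 6) (a 3 6) (a 4 6) (a 5 6) (cg a 0 1) (cg a 0 2) (cg a 1 2) (cg a 0 3) (cg a 1 3) (cg a 2 3) (cg a 0 4) (cg a 1 4) (cg a 2 4) (cg a 3 4) (cg a 0 5) (cg a 1 5) (cg a 2 5) (cg a 3 5) (cg a 4 5) (cg a 0 6) (cg a 1 6) (cg a 2 6) (cg a 3 6) (cg a 4 6) (cg a 5 6) (dg a 0) (dg a 1) (dg a 2) (dg a 3) (dg a 4) (dg a 5) (dg a 6) (gg a 0) (gg a 1) (gg a 2) (gg a 3) (gg a 4) (gg a 5) (gg a 6) (wg a 0) (wg a 1) (wg a 2) (wg a 3) (wg a 4) (wg a 5) (wg a 6) := by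
  have e : ∀ x, ∑ y ∈ univ.erase x, pairA F a x y = (∑ y, if x = y then 0 else pairA F a x y) := by
    intro x
    rw [← Finset.sum_erase_add _ _ (Finset.mem_univ x), if_pos rfl, add_zero]
    refine Finset.sum_congr rfl (fun y hy => ?_)
    rw [if_neg (Finset.ne_of_mem_erase hy).symm]
  have hc := pairA_comm F hF a hs
  have p10 : pairA F a 1 0 = pairA F a 0 1 := hc _ _
  have p20 : pairA F a 2 0 = pairA F a 0 2 := hc _ _
  have p21 : pairA F a 2 1 = pairA F a 1 2 := hc _ _
  have p30 : pairA F a 3 0 = pairA F a 0 3 := hc _ _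
  have p31 : pairA F a 3 1 = pairA F a 1 3 := hc _ _
  have p32 : pairA F a 3 2 = pairA F a 2 3 := hc _ _
  have p40 : pairA F a 4 0 = pairA F a 0 4 := hc _ _
  have p41 : pairA F a 4 1 = pairA F a 1 4 := hc _ _
  have p42 : pairA F a 4 2 = pairA F a 2 4 := hc _ _
  have p43 : pairA F a 4 3 = pairA F a 3 4 := hc _ _
  have p50 : pairA F a 5 0 = pairA F a 0 5 := hc _ _
  have p51 : pairA F a 5 1 = pairA F a 1 5 := hc _ _
  have p52 : pairA F a 5 2 = pairA F a 2 5 := hc _ _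
  have p53 : pairA F a 5 3 = pairA F a 3 5 := hc _ _
  have p54 : pairA F a 5 4 = pairA F a 4 5 := hc _ _
  have p60 : pairA F a 6 0 = pairA F a 0 6 := hc _ _
  have p61 : pairA F a 6 1 = pairA F a 1 6 := hc _ _
  have p62 : pairA F a 6 2 = pairA F a 2 6 := hc _ _
  have p63 : pairA F a 6 3 = pairA F a 3 6 := hc _ _
  have p64 : pairA F a 6 4 = pairA F a 4 6 := hc _ _
  have p65 : pairA F a 6 5 = pairA F a 5 6 := hc _ _
  simp only [X5, e, Fin.sum_univ_seven]
  rw [x5C]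
  simp only [nadd]
  simp only [Fin.reduceEq, if_true, if_false, p10, p20, p21, p30, p31, p32, p40, p41, p42, p43, p50, p51, p52, p53, p54, p60, p61, p62, p63, p64, p65]
  simp only [pairA]
  ring

theorem x1C_eq (W : ℕ → ℕ → ℕ) (hW : ∀ x y, W x y = W y x) (a : Fin 7 → Fin 7 → ℕ) (hs : ∀ i j, a i j = a j i) (h0 : ∀ i, a i i = 0) :
    X1 W a = 2 * x1C W (a 0 1) (a 0 2) (a 1 2) (a 0 3) (a 1 3) (a 2 3) (a 0 4) (a 1 4) (a 2 4) (a 3 4) (a 0 5) (a 1 5) (a 2 5) (a 3 5) (a 4 5) (a 0 6) (a 1 6) (a 2 6) (a 3 6) (a 4 6) (a 5 6) := by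
  have s10 : a 1 0 = a 0 1 := hs _ _
  have s20 : a 2 0 = a 0 2 := hs _ _
  have s21 : a 2 1 = a 1 2 := hs _ _
  have s30 : a 3 0 = a 0 3 := hs _ _
  have s31 : a 3 1 = a 1 3 := hs _ _
  have s32 : a 3 2 = a 2 3 := hs _ _
  have s40 : a 4 0 = a 0 4 := hs _ _
  have s41 : a 4 1 = a 1 4 := hs _ _
  have s42 : a 4 2 = a 2 4 := hs _ _
  have s43 : a 4 3 = a 3 4 := hs _ _
  have s50 : a 5 0 = a 0 5 := hs _ _
  have s51 : a 5 1 = a 1 5 := hs _ _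
  have s52 : a 5 2 = a 2 5 := hs _ _
  have s53 : a 5 3 = a 3 5 := hs _ _
  have s54 : a 5 4 = a 4 5 := hs _ _
  have s60 : a 6 0 = a 0 6 := hs _ _
  have s61 : a 6 1 = a 1 6 := hs _ _
  have s62 : a 6 2 = a 2 6 := hs _ _
  have s63 : a 6 3 = a 3 6 := hs _ _
  have s64 : a 6 4 = a 4 6 := hs _ _
  have s65 : a 6 5 = a 5 6 := hs _ _
  have r0 : X1r W a 0 = 2 * rootT W (a 0 1) (a 0 2) (a 0 3) (a 0 4) (a 0 5) (a 0 6) (a 1 2) (a 1 3) (a 1 4) (a 1 5) (a 1 6) (a 2 3) (a 2 4) (a 2 5) (a 2 6) (a 3 4) (a 3 5) (a 3 6) (a 4 5) (a 4 6) (a 5 6) := by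
    let σ : Equiv.Perm (Fin 7) := Equiv.ofBijective ![0, 1, 2, 3, 4, 5, 6] (by decide)
    have e := X1r_rl W a σ 0
    rw [root0 W hW (rl a σ) (fun i j => hs _ _) (fun i => h0 _)] at e
    have e2 : σ 0 = 0 := rfl
    rw [e2] at e; rw [← e]
    have q1 : σ 1 = 1 := rfl
    have q2 : σ 2 = 2 := rfl
    have q3 : σ 3 = 3 := rfl
    have q4 : σ 4 = 4 := rfl
    have q5 : σ 5 = 5 := rfl
    have q6 : σ 6 = 6 := rfl
    simp only [rl, e2, q1, q2, q3, q4, q5, q6, s10, s20, s21, s30, s31, s32, s40, s41, s42, s43, s50, s51, s52, s53, s54, s60, s61, s62, s63, s64, s65]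
  have r1 : X1r W a 1 = 2 * rootT W (a 0 1) (a 1 2) (a 1 3) (a 1 4) (a 1 5) (a 1 6) (a 0 2) (a 0 3) (a 0 4) (a 0 5) (a 0 6) (a 2 3) (a 2 4) (a 2 5) (a 2 6) (a 3 4) (a 3 5) (a 3 6) (a 4 5) (a 4 6) (a 5 6) := by
    let σ : Equiv.Perm (Fin 7) := Equiv.ofBijective ![1, 0, 2, 3, 4, 5, 6] (by decide)
    have e := X1r_rl W a σ 0
    rw [root0 W hW (rl a σ) (fun i j => hs _ _) (fun i => h0 _)] at e
    have e2 : σ 0 = 1 := rfl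
    rw [e2] at e; rw [← e]
    have q1 : σ 1 = 0 := rfl
    have q2 : σ 2 = 2 := rfl
    have q3 : σ 3 = 3 := rfl
    have q4 : σ 4 = 4 := rfl
    have q5 : σ 5 = 5 := rfl
    have q6 : σ 6 = 6 := rfl
    simp only [rl, e2, q1, q2, q3, q4, q5, q6, s10, s20, s21, s30, s31, s32, s40, s41, s42, s43, s50, s51, s52, s53, s54, s60, s61, s62, s63, s64, s65]
  have r2 : X1r W a 2 = 2 * rootT W (a 0 2) (a 1 2) (a 2 3) (a 2 4) (a 2 5) (a 2 6) (a 0 1) (a 0 3) (a 0 4) (a 0 5) (a 0 6) (a 1 3) (a 1 4) (a 1 5) (a 1 6) (a 3 4) (a 3 5) (a 3 6) (a 4 5) (a 4 6) (a 5 6) := by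
    let σ : Equiv.Perm (Fin 7) := Equiv.ofBijective ![2, 0, 1, 3, 4, 5, 6] (by decide)
    have e := X1r_rl W a σ 0
    rw [root0 W hW (rl a σ) (fun i j => hs _ _) (fun i => h0 _)] at e
    have e2 : σ 0 = 2 := rfl
    rw [e2] at e; rw [← e]
    have q1 : σ 1 = 0 := rfl
    have q2 : σ 2 = 1 := rfl
    have q3 : σ 3 = 3 := rfl
    have q4 : σ 4 = 4 := rfl
    have q5 : σ 5 = 5 := rfl
    have q6 : σ 6 = 6 := rfl
    simp only [rl, e2, q1, q2, q3, q4, q5, q6, s10, s20, s21, s30, s31, s32, s40, s41, s42, s43, s50, s51, s52, s53, s54, s60, s61, s62, s63, s64, s65]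
  have r3 : X1r W a 3 = 2 * rootT W (a 0 3) (a 1 3) (a 2 3) (a 3 4) (a 3 5) (a 3 6) (a 0 1) (a 0 2) (a 0 4) (a 0 5) (a 0 6) (a 1 2) (a 1 4) (a 1 5) (a 1 6) (a 2 4) (a 2 5) (a 2 6) (a 4 5) (a 4 6) (a 5 6) := by
    let σ : Equiv.Perm (Fin 7) := Equiv.ofBijective ![3, 0, 1, 2, 4, 5, 6] (by decide)
    have e := X1r_rl W a σ 0
    rw [root0 W hW (rl a σ) (fun i j => hs _ _) (fun i => h0 _)] at e
    have e2 : σ 0 = 3 := rfl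
    rw [e2] at e; rw [← e]
    have q1 : σ 1 = 0 := rfl
    have q2 : σ 2 = 1 := rfl
    have q3 : σ 3 = 2 := rfl
    have q4 : σ 4 = 4 := rfl
    have q5 : σ 5 = 5 := rfl
    have q6 : σ 6 = 6 := rfl
    simp only [rl, e2, q1, q2, q3, q4, q5, q6, s10, s20, s21, s30, s31, s32, s40, s41, s42, s43, s50, s51, s52, s53, s54, s60, s61, s62, s63, s64, s65]
  have r4 : X1r W a 4 = 2 * rootT W (a 0 4) (a 1 4) (a 2 4) (a 3 4) (a 4 5) (a 4 6) (a 0 1) (a 0 2) (a 0 3) (a 0 5) (a 0 6) (a 1 2) (a 1 3) (a 1 5) (a 1 6) (a 2 3) (a 2 5) (a 2 6) (a 3 5) (a 3 6) (a 5 6) := by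
    let σ : Equiv.Perm (Fin 7) := Equiv.ofBijective ![4, 0, 1, 2, 3, 5, 6] (by decide)
    have e := X1r_rl W a σ 0
    rw [root0 W hW (rl a σ) (fun i j => hs _ _) (fun i => h0 _)] at e
    have e2 : σ 0 = 4 := rfl
    rw [e2] at e; rw [← e]
    have q1 : σ 1 = 0 := rfl
    have q2 : σ 2 = 1 := rfl
    have q3 : σ 3 = 2 := rfl
    have q4 : σ 4 = 3 := rfl
    have q5 : σ 5 = 5 := rfl
    have q6 : σ 6 = 6 := rfl
    simp only [rl, e2, q1, q2, q3, q4, q5, q6, s10, s20, s21, s30, s31, s32, s40, s41, s42, s43, s50, s51, s52, s53, s54, s60, s61, s62, s63, s64, s65]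
  have r5 : X1r W a 5 = 2 * rootT W (a 0 5) (a 1 5) (a 2 5) (a 3 5) (a 4 5) (a 5 6) (a 0 1) (a 0 2) (a 0 3) (a 0 4) (a 0 6) (a 1 2) (a 1 3) (a 1 4) (a 1 6) (a 2 3) (a 2 4) (a 2 6) (a 3 4) (a 3 6) (a 4 6) := by
    let σ : Equiv.Perm (Fin 7) := Equiv.ofBijective ![5, 0, 1, 2, 3, 4, 6] (by decide)
    have e := X1r_rl W a σ 0
    rw [root0 W hW (rl a σ) (fun i j => hs _ _) (fun i => h0 _)] at e
    have e2 : σ 0 = 5 := rfl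
    rw [e2] at e; rw [← e]
    have q1 : σ 1 = 0 := rfl
    have q2 : σ 2 = 1 := rfl
    have q3 : σ 3 = 2 := rfl
    have q4 : σ 4 = 3 := rfl
    have q5 : σ 5 = 4 := rfl
    have q6 : σ 6 = 6 := rfl
    simp only [rl, e2, q1, q2, q3, q4, q5, q6, s10, s20, s21, s30, s31, s32, s40, s41, s42, s43, s50, s51, s52, s53, s54, s60, s61, s62, s63, s64, s65]
  have r6 : X1r W a 6 = 2 * rootT W (a 0 6) (a 1 6) (a 2 6) (a 3 6) (a 4 6) (a 5 6) (a 0 1) (a 0 2) (a 0 3) (a 0 4) (a 0 5) (a 1 2) (a 1 3) (a 1 4) (a 1 5) (a 2 3) (a 2 4) (a 2 5) (a 3 4) (a 3 5) (a 4 5) := by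
    let σ : Equiv.Perm (Fin 7) := Equiv.ofBijective ![6, 0, 1, 2, 3, 4, 5] (by decide)
    have e := X1r_rl W a σ 0
    rw [root0 W hW (rl a σ) (fun i j => hs _ _) (fun i => h0 _)] at e
    have e2 : σ 0 = 6 := rfl
    rw [e2] at e; rw [← e]
    have q1 : σ 1 = 0 := rfl
    have q2 : σ 2 = 1 := rfl
    have q3 : σ 3 = 2 := rfl
    have q4 : σ 4 = 3 := rfl
    have q5 : σ 5 = 4 := rfl
    have q6 : σ 6 = 5 := rfl
    simp only [rl, e2, q1, q2, q3, q4, q5, q6, s10, s20, s21, s30, s31, s32, s40, s41, s42, s43, s50, s51, s52, s53, s54, s60, s61, s62, s63, s64, s65]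
  simp only [X1, Fin.sum_univ_seven, r0, r1, r2, r3, r4, r5, r6]
  rw [x1C]
  simp only [nadd]
  ring

theorem pointwise (a : Fin 7 → Fin 7 → ℕ) (hs : ∀ i j, a i j = a j i) (h0 : ∀ i, a i i = 0) (h1 : ∀ i j, a i j ≤ 1) :
    2 * (if dD a = 20 then 8427240 else 0) + (X5 pairT a + X1 (wL 2 tab1) a) + 200 * (21 * dD a + 4 * dT a) ≤
      54967985856 + 1200 * dQ a := by
  obtain ⟨v, -, hv⟩ := Finset.exists_max_image univ (dg a) univ_nonempty
  obtain ⟨σ, h6, hk⟩ := ladder_chk a hs h1 v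
  have hs' : ∀ i j, rl a σ i j = rl a σ j i := fun i j => hs _ _
  have h0' : ∀ i, rl a σ i i = 0 := fun i => h0 _
  have h := chkF_imp _ _ _ _ _ (chkA_imp (rl a σ) hs' h0'
    (fun i => by rw [dg_rl, dg_rl, h6]; exact hv _ (mem_univ _)) hk)
  have e5 := x5C_eq pairT pairT_symm (rl a σ) hs' h0'
  have e1 := x1C_eq (wL 2 tab1) (wL_comm _ _) (rl a σ) hs' h0'
  rw [X5_rl] at e5
  rw [X1_rl] at e1
  rw [e5, e1]
  generalize x5C pairT _ _ _ _ _ _ _ _ _ _ _ _ _ _ _ _ _ _ _ _ _ _ _ _ _ _ _ _ _ _ _ _ _ _ _ _ _ _ _ _ _ _ _ _ _ _ _ _ _ _ _ _ _ _ _ _ _ _ _ _ _ _ _ _ = y5 at *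
  generalize x1C (wL 2 tab1) _ _ _ _ _ _ _ _ _ _ _ _ _ _ _ _ _ _ _ _ _ = y1 at *
  rw [dD_rl, dQ_rl, dT_rl] at h
  split_ifs at h ⊢ <;> omega

end pointwise


section flags

variable {V : Type} [Fintype V]

/-- weighted expectation over maps -/
noncomputable def Ex (μ : V → ℝ) {ι : Type} [Fintype ι] (φ : (ι → V) → ℝ) : ℝ :=
  ∑ f : ι → V, (∏ i, μ (f i)) * φ f

theorem Ex_add (μ : V → ℝ) {ι : Type} [Fintype ι] (φ ψ : (ι → V) → ℝ) :
    Ex μ (fun f => φ f + ψ f) = Ex μ φ + Ex μ ψ := by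
  simp only [Ex, mul_add, Finset.sum_add_distrib]
theorem Ex_smul (μ : V → ℝ) {ι : Type} [Fintype ι] (c : ℝ) (φ : (ι → V) → ℝ) :
    Ex μ (fun f => c * φ f) = c * Ex μ φ := by
  simp only [Ex, Finset.mul_sum]; exact Finset.sum_congr rfl (fun f _ => by ring)
theorem Ex_sum (μ : V → ℝ) {ι κ : Type} [Fintype ι] (s : Finset κ) (φ : κ → (ι → V) → ℝ) :
    Ex μ (fun f => ∑ k ∈ s, φ k f) = ∑ k ∈ s, Ex μ (φ k) := by
  simp only [Ex, Finset.mul_sum]; exact Finset.sum_comm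
theorem Ex_mono (μ : V → ℝ) (hμ : ∀ v, 0 ≤ μ v) {ι : Type} [Fintype ι] (φ ψ : (ι → V) → ℝ) (h : ∀ f, φ f ≤ ψ f) :
    Ex μ φ ≤ Ex μ ψ :=
  Finset.sum_le_sum (fun f _ => mul_le_mul_of_nonneg_left (h f) (Finset.prod_nonneg (fun i _ => hμ _)))
theorem Ex_total (μ : V → ℝ) (h1 : ∑ v, μ v = 1) (ι : Type) [Fintype ι] : ∑ f : ι → V, ∏ i, μ (f i) = 1 := by
  have := (Fintype.piFinset_univ (α := ι) (β := fun _ => V))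
  rw [← this, ← Finset.prod_univ_sum (fun _ => univ) (fun (_ : ι) v => μ v)]
  simp [h1]
theorem Ex_const (μ : V → ℝ) (h1 : ∑ v, μ v = 1) {ι : Type} [Fintype ι] (c : ℝ) : Ex μ (fun _ : ι → V => c) = c := by
  rw [Ex, ← Finset.sum_mul, Ex_total μ h1, one_mul]
theorem Ex_equiv (μ : V → ℝ) {ι κ : Type} [Fintype ι] [Fintype κ] (e : κ ≃ ι) (φ : (κ → V) → ℝ) :
    Ex μ (fun f : ι → V => φ (f ∘ e)) = Ex μ φ := by
  rw [Ex, Ex]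
  apply Fintype.sum_equiv (Equiv.arrowCongr e.symm (Equiv.refl V))
  intro f
  congr 1
  exact (Equiv.prod_comp e (fun i => μ (f i))).symm
theorem Ex_def (μ : V → ℝ) {ι : Type} [Fintype ι] (inst : Fintype (ι → V)) (φ : (ι → V) → ℝ) :
    Ex μ φ = ∑ f : ι → V, (∏ i, μ (f i)) * φ f := by
  rw [Ex]; congr; exact Subsingleton.elim _ _
theorem Ex_sumType (μ : V → ℝ) {τ ρ : Type} [Fintype τ] [Fintype ρ] (φ : (τ ⊕ ρ → V) → ℝ) :
    Ex μ φ = Ex μ (fun g : τ → V => Ex μ (fun u : ρ → V => φ (Sum.elim g u))) := by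
  rw [Ex_def μ inferInstance]
  refine (Fintype.sum_equiv (Equiv.sumArrowEquivProdArrow τ ρ V) _
    (fun p => (∏ i, μ (Sum.elim p.1 p.2 i)) * φ (Sum.elim p.1 p.2)) ?_).trans ?_
  · intro f
    have : Sum.elim ((Equiv.sumArrowEquivProdArrow τ ρ V) f).1 ((Equiv.sumArrowEquivProdArrow τ ρ V) f).2 = f :=
      (Equiv.sumArrowEquivProdArrow τ ρ V).symm_apply_apply f
    rw [this]
  rw [Fintype.sum_prod_type]
  simp only [Ex, Finset.mul_sum]
  refine Finset.sum_congr rfl (fun g _ => Finset.sum_congr rfl (fun u _ => ?_))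
  rw [Fintype.prod_sum_type, ← mul_assoc]
  rfl
/-- marginalization -/
theorem Ex_marg (μ : V → ℝ) (h1 : ∑ v, μ v = 1) {ι τ ρ : Type} [Fintype ι] [Fintype τ] [Fintype ρ] (e : τ ⊕ ρ ≃ ι)
    (φ : (τ → V) → ℝ) : Ex μ (fun f : ι → V => φ (fun i => f (e (Sum.inl i)))) = Ex μ φ := by
  refine (Ex_equiv μ e (fun h => φ (fun i => h (Sum.inl i)))).trans ?_
  rw [Ex_sumType]
  simp only [Sum.elim_inl, Ex_const μ h1]

theorem gT_cast (x y : ℕ) (hx : x < 8192) (hy : y < 8192) :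
    (gT x y : ℝ) = ((x : ℝ) - 4096) * ((y : ℝ) - 4096) + 50331648 := by
  have : gT x y = x * y + 4096 * (16384 - (x + y)) := rfl
  rw [this]
  have h2 : x + y ≤ 16384 := by omega
  push_cast [Nat.cast_sub h2]
  ring

theorem sos_wL {U : Type} [Fintype U] (p : U → ℝ) (x : U → ℕ) (k : ℕ) (l : List ℕ) :
    50331648 * ((k : ℝ) + l.length) * (∑ u, p u) ^ 2 ≤ ∑ u, p u * ∑ u', p u' * (wL k l (x u) (x u') : ℝ) := by
  induction l with
  | nil =>
    simp only [wL_nil]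
    rw [← Finset.sum_mul, ← Finset.sum_mul]
    apply le_of_eq; push_cast; simp; ring
  | cons q l ih =>
    have e : ∀ u u', (wL k (q :: l) (x u) (x u') : ℝ) =
      (((q >>> x u) % 8192 : ℕ) - 4096 : ℝ) * ((((q >>> x u') % 8192 : ℕ) : ℝ) - 4096) + 50331648 + wL k l (x u) (x u') := by
      intro u u'
      rw [wL_cons, Nat.cast_add, gT_cast _ _ (Nat.mod_lt _ (by norm_num)) (Nat.mod_lt _ (by norm_num))]
    simp only [e]
    set y : U → ℝ := fun u => (((q >>> x u) % 8192 : ℕ) - 4096 : ℝ) with hy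
    have e2 : ∑ u, p u * ∑ u', p u' * (y u * y u' + 50331648 + (wL k l (x u) (x u') : ℝ)) =
      (∑ u, p u * y u) ^ 2 + 50331648 * (∑ u, p u) ^ 2 + ∑ u, p u * ∑ u', p u' * (wL k l (x u) (x u') : ℝ) := by
      rw [sq, sq, Finset.sum_mul_sum, Finset.sum_mul_sum]
      simp only [Finset.mul_sum, ← Finset.sum_add_distrib]
      refine Finset.sum_congr rfl (fun g _ => Finset.sum_congr rfl (fun u _ => ?_))
      ring
    rw [e2]
    have := sq_nonneg (∑ u, p u * y u)
    simp only [List.length_cons]; push_cast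
    nlinarith

def goodT : TTree → Bool
  | .em => true
  | .lf k l => k + l.length == 6
  | .nd x y => goodT x && goodT y

theorem goodT_sel (t : TTree) : goodT t = true → ∀ h, goodT (tSel t h) = true := by
  induction t with
  | em => intro _ h; rfl
  | lf k l => intro ht h; exact ht
  | nd x y ihx ihy =>
    intro ht h
    rw [goodT, Bool.and_eq_true] at ht
    have e : tSel (.nd x y) h = Nat.rec (tSel x (Nat.div h 2)) (fun _ _ => tSel y (Nat.div h 2)) (Nat.mod h 2) := rfl
    rw [e]
    cases Nat.mod h 2 with
    | zero => exact ihx ht.1 _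
    | succ _ => exact ihy ht.2 _

theorem goodT_tab5 : goodT tab5 = true := by decide +kernel

theorem sos_wT {U : Type} [Fintype U] (p : U → ℝ) (x : U → ℕ) (t : TTree) (ht : goodT t = true) :
    301989888 * (∑ u, p u) ^ 2 ≤ ∑ u, p u * ∑ u', p u' * (wT t (x u) (x u') : ℝ) := by
  have hc : ∀ c : ℝ, (∑ u, p u * ∑ u', p u' * c) = c * (∑ u, p u) ^ 2 := by
    intro c
    rw [← Finset.sum_mul, ← Finset.sum_mul]; ring
  cases t with
  | em =>
    have : ∀ u u', (wT .em (x u) (x u') : ℝ) = 301989888 := fun u u' => by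
      have : wT .em (x u) (x u') = 301989888 := rfl
      rw [this]; norm_num
    simp only [this, hc]; exact le_rfl
  | nd a b =>
    have : ∀ u u', (wT (.nd a b) (x u) (x u') : ℝ) = 301989888 := fun u u' => by
      have : wT (.nd a b) (x u) (x u') = 301989888 := rfl
      rw [this]; norm_num
    simp only [this, hc]; exact le_rfl
  | lf k l =>
    have h := sos_wL p (fun u => 13 * x u) k l
    have h6 : (k : ℝ) + l.length = 6 := by
      have : k + l.length = 6 := by simpa [goodT] using ht
      exact_mod_cast this
    rw [h6] at h
    have e : ∀ u u', wT (.lf k l) (x u) (x u') = wL k l (13 * x u) (13 * x u') := fun _ _ => rfl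
    simp only [e]
    linarith

theorem flagE (μ : V → ℝ) (hμ : ∀ v, 0 ≤ μ v) (h1 : ∑ v, μ v = 1) {ι τ ρ : Type} [Fintype ι] [Fintype τ] [Fintype ρ]
    (e : τ ⊕ (ρ ⊕ ρ) ≃ ι) (t : (τ → V) → TTree) (ht : ∀ g, goodT (t g) = true) (x : (τ → V) → (ρ → V) → ℕ)
    (φ : (ι → V) → ℝ) (hφ : ∀ f, φ f = (wT (t (fun i => f (e (Sum.inl i))))
      (x (fun i => f (e (Sum.inl i))) (fun i => f (e (Sum.inr (Sum.inl i)))))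
      (x (fun i => f (e (Sum.inl i))) (fun i => f (e (Sum.inr (Sum.inr i))))) : ℝ)) :
    301989888 ≤ Ex μ φ := by
  let ψ : (τ ⊕ (ρ ⊕ ρ) → V) → ℝ := fun h => (wT (t (fun i => h (Sum.inl i)))
      (x (fun i => h (Sum.inl i)) (fun i => h (Sum.inr (Sum.inl i))))
      (x (fun i => h (Sum.inl i)) (fun i => h (Sum.inr (Sum.inr i)))) : ℝ)
  have e1 : φ = fun f => ψ (f ∘ e) := by
    funext f; exact hφ f
  rw [e1]
  refine le_of_le_of_eq ?_ (Ex_equiv μ e ψ).symm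
  rw [Ex_sumType]
  calc (301989888 : ℝ) = Ex μ (fun _ : τ → V => (301989888 : ℝ)) := (Ex_const μ h1 _).symm
    _ ≤ _ := by
      apply Ex_mono μ hμ
      intro g
      rw [Ex_sumType]
      have := sos_wT (fun u : ρ → V => ∏ i, μ (u i)) (fun u => x g u) (t g) (ht g)
      rw [Ex_total μ h1] at this
      simpa [Ex, ψ] using this

variable (A : V → V → ℕ)

/-- pull back -/
def pull {ι : Type} (A : V → V → ℕ) (f : ι → V) : ι → ι → ℕ := fun i j => A (f i) (f j)

/-- keys of the 5-vertex type and of the flags -/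
def key5 (b : Fin 5 → Fin 5 → ℕ) : ℕ := (∑ i, (∑ j, b i j) * (∑ j, b i j)) + 10 * ∑ i, ∑ j, b i j * ∑ k, b i k * b j k
def keyF (b : Fin 5 → Fin 5 → ℕ) (u : Fin 5 → ℕ) : ℕ :=
  ∑ i, u i + 5 * ∑ i, u i * ∑ j, b i j + 5 * ∑ i, u i * ∑ j, u j * b i j

set_option maxHeartbeats 1600000 in
theorem keys01 (a : Fin 7 → Fin 7 → ℕ) (hs : ∀ i j, a i j = a j i) (h0 : ∀ i, a i i = 0) (h1 : ∀ i j, a i j ≤ 1) :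
    dQ a + 10 * dT a + (dg a 0 + dg a 1) + (2 * cg a 0 1 + a 0 1 * (2 * (dg a 0 + dg a 1) + 60 * cg a 0 1 - 2)) - (gg a 0 + gg a 1)
      = key5 (fun i j => a i.succ.succ j.succ.succ) ∧
    wg a 0 - (5 * cg a 0 1 + a 0 1 * (5 * dg a 1 + 10 * cg a 0 1 - 4)) =
      keyF (fun i j => a i.succ.succ j.succ.succ) (fun i => a 0 i.succ.succ) ∧
    wg a 1 - (5 * cg a 0 1 + a 0 1 * (5 * dg a 0 + 10 * cg a 0 1 - 4)) =
      keyF (fun i j => a i.succ.succ j.succ.succ) (fun i => a 1 i.succ.succ) := by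
  have hsq : ∀ i j, a i j * a i j = a i j := by
    intro i j
    have := h1 i j
    interval_cases a i j <;> rfl
  set b : Fin 5 → Fin 5 → ℕ := fun i j => a i.succ.succ j.succ.succ with hb
  set u : Fin 5 → ℕ := fun i => a 0 i.succ.succ with hu
  set v : Fin 5 → ℕ := fun i => a 1 i.succ.succ with hv
  obtain ⟨e, he⟩ : ∃ e, a 0 1 = e := ⟨_, rfl⟩
  have e1 : e ≤ 1 := he ▸ h1 0 1
  have he' : a 1 0 = e := by rw [hs, he]
  have hu' : ∀ i : Fin 5, a i.succ.succ 0 = u i := fun i => hs _ _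
  have hv' : ∀ i : Fin 5, a i.succ.succ 1 = v i := fun i => hs _ _
  have hu2 : ∀ i : Fin 5, a 0 i.succ.succ = u i := fun i => rfl
  have hv2 : ∀ i : Fin 5, a 1 i.succ.succ = v i := fun i => rfl
  have hb2 : ∀ i j : Fin 5, a i.succ.succ j.succ.succ = b i j := fun i j => rfl
  have usq : ∀ i, u i * u i = u i := fun i => hsq _ _
  have vsq : ∀ i, v i * v i = v i := fun i => hsq _ _
  have bs : ∀ i j, b i j = b j i := fun i j => hs _ _
  clear_value b u v
  have S2 : ∀ f : Fin 7 → ℕ, ∑ i, f i = f 0 + f 1 + ∑ i : Fin 5, f i.succ.succ := by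
    intro f; rw [Fin.sum_univ_succ, Fin.sum_univ_succ, ← add_assoc]; rfl
  have d0 : dg a 0 = e + ∑ i, u i := by simp only [dg, S2, h0, he, hu2]; ring
  have d1 : dg a 1 = e + ∑ i, v i := by simp only [dg, S2, h0, he', hv2]; ring
  have di : ∀ i : Fin 5, dg a i.succ.succ = u i + v i + ∑ j, b i j := fun i => by
    simp only [dg, S2, hu', hv', hb2]
  have c01 : cg a 0 1 = ∑ i, u i * v i := by simp only [cg, S2, h0, hu2, hv2]; ring
  have c0i : ∀ i : Fin 5, cg a 0 i.succ.succ = e * v i + ∑ k, u k * b i k := fun i => by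
    simp only [cg, S2, h0, he, hu2, hv', hb2]; ring
  have c1i : ∀ i : Fin 5, cg a 1 i.succ.succ = e * u i + ∑ k, v k * b i k := fun i => by
    simp only [cg, S2, h0, he', hv2, hu', hb2]; ring
  have cij : ∀ i j : Fin 5, cg a i.succ.succ j.succ.succ = u i * u j + v i * v j + ∑ k, b i k * b j k := fun i j => by
    simp only [cg, S2, hv', hu', hb2]
  obtain ⟨U, hU⟩ : ∃ U, ∑ i, u i = U := ⟨_, rfl⟩
  obtain ⟨W, hW⟩ : ∃ W, ∑ i, v i = W := ⟨_, rfl⟩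
  obtain ⟨c, hc⟩ : ∃ c, ∑ i, u i * v i = c := ⟨_, rfl⟩
  obtain ⟨P, hP⟩ : ∃ P, ∑ i, u i * ∑ j, b i j = P := ⟨_, rfl⟩
  obtain ⟨P', hP'⟩ : ∃ P, ∑ i, v i * ∑ j, b i j = P := ⟨_, rfl⟩
  obtain ⟨I, hI⟩ : ∃ I, ∑ i, u i * ∑ j, u j * b i j = I := ⟨_, rfl⟩
  obtain ⟨J, hJ⟩ : ∃ I, ∑ i, v i * ∑ j, v j * b i j = I := ⟨_, rfl⟩
  obtain ⟨q, hq⟩ : ∃ q, ∑ i, (∑ j, b i j) * (∑ j, b i j) = q := ⟨_, rfl⟩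
  obtain ⟨t, ht⟩ : ∃ q, ∑ i, ∑ j, b i j * ∑ k, b i k * b j k = q := ⟨_, rfl⟩
  have s0 : sg a 0 = e * (e + W) + (U + c + P) := by
    simp only [sg, S2, h0, he, d1, di, hu2]
    rw [hW, ← hU, ← hc, ← hP, ← Finset.sum_add_distrib, ← Finset.sum_add_distrib, zero_mul, zero_add]
    refine congrArg (HAdd.hAdd _) ?_
    refine Finset.sum_congr rfl (fun i _ => ?_)
    rw [mul_add, mul_add, usq]
  have s1 : sg a 1 = e * (e + U) + (W + c + P') := by
    simp only [sg, S2, h0, he', d0, di, hv2]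
    rw [hU, ← hW, ← hc, ← hP', ← Finset.sum_add_distrib, ← Finset.sum_add_distrib, zero_mul, add_zero]
    refine congrArg (HAdd.hAdd _) ?_
    refine Finset.sum_congr rfl (fun i _ => ?_)
    rw [mul_add, mul_add, vsq]; ring
  have t0 : tg a 0 = e * c + (e * c + I) := by
    simp only [tg, S2, h0, he, c01, c0i, hu2]
    rw [zero_mul, zero_add, hc]
    refine congrArg (HAdd.hAdd _) ?_
    rw [← hc, ← hI, Finset.mul_sum, ← Finset.sum_add_distrib]
    refine Finset.sum_congr rfl (fun i _ => ?_)
    ring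
  have t1 : tg a 1 = e * c + (e * c + J) := by
    simp only [tg, S2, h0, he', cg_comm a 1 0, c01, c1i, hv2]
    rw [zero_mul, add_zero, hc]
    refine congrArg (HAdd.hAdd _) ?_
    rw [← hc, ← hJ, Finset.mul_sum, ← Finset.sum_add_distrib]
    refine Finset.sum_congr rfl (fun i _ => ?_)
    ring
  have hQ : dQ a = (e + U) * (e + U) + (e + W) * (e + W) + (U + W + q + 2 * c + 2 * P + 2 * P') := by
    simp only [dQ, S2, d0, d1, di]
    rw [hU, hW]
    refine congrArg (HAdd.hAdd _) ?_
    rw [← hU, ← hW, ← hq, ← hc, ← hP, ← hP']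
    simp only [Finset.mul_sum, ← Finset.sum_add_distrib]
    refine Finset.sum_congr rfl (fun i _ => ?_)
    rw [← Finset.mul_sum, ← Finset.mul_sum, ← Finset.mul_sum, ← Finset.mul_sum, ← Finset.mul_sum]
    nlinarith [usq i, vsq i]
  have hT : dT a = 6 * (e * c) + 3 * I + 3 * J + t := by
    have ti : ∀ i : Fin 5, tg a i.succ.succ = (u i * (e * v i + ∑ k, u k * b i k)) + (v i * (e * u i + ∑ k, v k * b i k))
        + (u i * ∑ j, u j * b i j) + (v i * ∑ j, v j * b i j) + ∑ j, b i j * ∑ k, b i k * b j k := by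
      intro i
      simp only [tg, S2, hu', hv', cg_comm a _ 0, cg_comm a _ 1, c0i, c1i, cij, hb2]
      rw [add_assoc (_ + _), add_assoc (_ + _)]
      refine congrArg (HAdd.hAdd _) ?_
      simp only [Finset.mul_sum, ← Finset.sum_add_distrib]
      refine Finset.sum_congr rfl (fun j _ => ?_)
      rw [← Finset.mul_sum]; ring
    simp only [dT, S2, t0, t1, ti, Finset.sum_add_distrib]
    rw [hI, hJ, ht]
    have z1 : ∑ i, u i * (e * v i + ∑ k, u k * b i k) = e * c + I := by
      rw [← hc, ← hI, Finset.mul_sum, ← Finset.sum_add_distrib]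
      refine Finset.sum_congr rfl (fun i _ => ?_)
      ring
    have z2 : ∑ i, v i * (e * u i + ∑ k, v k * b i k) = e * c + J := by
      rw [← hc, ← hJ, Finset.mul_sum, ← Finset.sum_add_distrib]
      refine Finset.sum_congr rfl (fun i _ => ?_)
      ring
    rw [z1, z2]; ring
  have hk5 : key5 b = q + 10 * t := by rw [key5, hq, ht]
  have hkx : keyF b u = U + 5 * P + 5 * I := by rw [keyF, hU, hP, hI]
  have hky : keyF b v = W + 5 * P' + 5 * J := by rw [keyF, hW, hP', hJ]
  rw [hk5, hkx, hky, he, c01, gg, gg, wg, wg, d0, d1, s0, s1, t0, t1, hQ, hT, hc, hU, hW]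
  clear hk5 hkx hky d0 d1 di c01 c0i c1i cij s0 s1 t0 t1 hQ hT hU hW hc hP hP' hI hJ hq ht S2 bs usq vsq hb2 hu2 hv2 hu' hv' he he' hsq hs h0 h1
  refine ⟨?_, ?_, ?_⟩
  · interval_cases e
    · simp only [zero_mul, mul_zero, zero_add, add_zero]
      apply Nat.sub_eq_of_eq_add; ring
    · have : 2 * (1 + U + (1 + W)) + 60 * c - 2 = 2 + 2 * U + 2 * W + 60 * c := by omega
      rw [this]
      apply Nat.sub_eq_of_eq_add; ring
  · interval_cases e <;> omega
  · interval_cases e <;> omega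

theorem pairA01 (a : Fin 7 → Fin 7 → ℕ) (hs : ∀ i j, a i j = a j i) (h0 : ∀ i, a i i = 0) (h1 : ∀ i j, a i j ≤ 1) :
    pairA pairT a 0 1 = wT (tSel tab5 (key5 (fun i j => a i.succ.succ j.succ.succ) % 49))
      (keyF (fun i j => a i.succ.succ j.succ.succ) (fun i => a 0 i.succ.succ) % 40)
      (keyF (fun i j => a i.succ.succ j.succ.succ) (fun i => a 1 i.succ.succ) % 40) := by
  obtain ⟨k1, k2, k3⟩ := keys01 a hs h0 h1
  rw [pairA, pairT]
  simp only [nadd, nmul, nsub, nmod]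
  rw [k1, k2, k3]

end flags


section flags2

variable {V : Type} [Fintype V]

theorem E01 (μ : V → ℝ) (hμ : ∀ v, 0 ≤ μ v) (h1 : ∑ v, μ v = 1) (A : V → V → ℕ)
    (hs : ∀ i j, A i j = A j i) (h0 : ∀ i, A i i = 0) (hA : ∀ i j, A i j ≤ 1) :
    301989888 ≤ Ex μ (fun f : Fin 7 → V => (pairA pairT (pull A f) 0 1 : ℝ)) := by
  have hb : Function.Bijective (Sum.elim (fun i : Fin 5 => i.succ.succ) (Sum.elim (fun _ : Unit => (0 : Fin 7)) (fun _ : Unit => 1))) := by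
    decide
  refine flagE μ hμ h1 (Equiv.ofBijective _ hb)
    (fun g : Fin 5 → V => tSel tab5 (key5 (pull A g) % 49)) (fun g => goodT_sel _ goodT_tab5 _)
    (fun g u => keyF (pull A g) (fun i => A (u ()) (g i)) % 40) _ ?_
  intro f
  rw [pairA01 (pull A f) (fun _ _ => hs _ _) (fun _ => h0 _) (fun _ _ => hA _ _)]
  rfl

theorem perm2 (x y : Fin 7) (h : x ≠ y) : ∃ σ : Equiv.Perm (Fin 7), σ 0 = x ∧ σ 1 = y := by
  refine ⟨(Equiv.swap 1 (Equiv.swap 0 x y)).trans (Equiv.swap 0 x), ?_, ?_⟩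
  · have : Equiv.swap 0 x y ≠ 0 := by
      intro h2
      have := congrArg (Equiv.swap 0 x) h2
      rw [Equiv.swap_apply_self, Equiv.swap_apply_left] at this
      exact h this.symm
    rw [Equiv.trans_apply, Equiv.swap_apply_of_ne_of_ne (by decide) this.symm, Equiv.swap_apply_left]
  · rw [Equiv.trans_apply, Equiv.swap_apply_left, Equiv.swap_apply_self]

theorem EX5 (μ : V → ℝ) (A : V → V → ℕ) (F) (c : ℝ)
    (h : c ≤ Ex μ (fun f : Fin 7 → V => (pairA F (pull A f) 0 1 : ℝ))) :
    42 * c ≤ Ex μ (fun f : Fin 7 → V => (X5 F (pull A f) : ℝ)) := by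
  have e : (fun f : Fin 7 → V => (X5 F (pull A f) : ℝ)) = fun f => ∑ x, ∑ y ∈ univ.erase x, (pairA F (pull A f) x y : ℝ) := by
    funext f
    rw [X5]; push_cast; rfl
  rw [e, Ex_sum]
  have : ∀ x : Fin 7, 6 * c ≤ Ex μ (fun f : Fin 7 → V => ∑ y ∈ univ.erase x, (pairA F (pull A f) x y : ℝ)) := by
    intro x
    rw [Ex_sum]
    have hc : (univ.erase x).card = 6 := by rw [Finset.card_erase_of_mem (mem_univ _)]; rfl
    have : ∑ y ∈ univ.erase x, c = 6 * c := by rw [Finset.sum_const, hc]; simp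
    rw [← this]
    refine Finset.sum_le_sum (fun y hy => ?_)
    obtain ⟨σ, hx, hy⟩ := perm2 x y (Finset.ne_of_mem_erase hy).symm
    refine h.trans (le_of_eq ?_)
    have : (fun f : Fin 7 → V => (pairA F (pull A f) x y : ℝ)) = fun f => (fun g : Fin 7 → V => (pairA F (pull A g) 0 1 : ℝ)) (f ∘ σ) := by
      funext f
      have : pull A (f ∘ σ) = rl (pull A f) σ := rfl
      simp only [this, pairA_rl, hx, hy]
    rw [this]
    exact (Ex_equiv μ σ (fun g : Fin 7 → V => (pairA F (pull A g) 0 1 : ℝ))).symm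
  calc 42 * c = ∑ x : Fin 7, 6 * c := by simp; ring
    _ ≤ _ := Finset.sum_le_sum (fun x _ => this x)

theorem good1 : goodT (.lf 2 tab1) = true := by decide +kernel

theorem sum_emb (A : Finset (Fin 7)) (h : A.card = 3) (g : Fin 7 → ℕ) : ∑ i ∈ A, g i = ∑ k : Fin 3, g (A.orderEmbOfFin h k) := by
  conv_lhs => rw [← Finset.map_orderEmbOfFin_univ A h]
  rw [Finset.sum_map]; rfl

theorem E1r (μ : V → ℝ) (hμ : ∀ v, 0 ≤ μ v) (h1 : ∑ v, μ v = 1) (A : V → V → ℕ)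
    (r : Fin 7) (S : Finset (Fin 7)) (hS : S ∈ powersetCard 3 (univ.erase r)) (k : ℕ) (l : List ℕ) (hg : goodT (.lf k l) = true) :
    301989888 ≤ Ex μ (fun f : Fin 7 → V => (wL k l (13 * sl (pull A f) r S) (13 * sl (pull A f) r ((univ.erase r) \ S)) : ℝ)) := by
  obtain ⟨hsub, hc⟩ := Finset.mem_powersetCard.1 hS
  have hc2 : ((univ.erase r) \ S).card = 3 := by
    rw [Finset.card_sdiff_of_subset hsub, hc, Finset.card_erase_of_mem (mem_univ _)]; rfl
  set S' := (univ.erase r) \ S with hS'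
  let e0 : Unit ⊕ (Fin 3 ⊕ Fin 3) → Fin 7 := Sum.elim (fun _ => r) (Sum.elim (S.orderEmbOfFin hc) (S'.orderEmbOfFin hc2))
  have m1 : ∀ k, S.orderEmbOfFin hc k ∈ S := fun k => Finset.orderEmbOfFin_mem _ _ _
  have m2 : ∀ k, S'.orderEmbOfFin hc2 k ∈ S' := fun k => Finset.orderEmbOfFin_mem _ _ _
  have r1 : r ∉ S := fun h => by simpa using hsub h
  have r2 : r ∉ S' := fun h => by simp [hS'] at h
  have dj : ∀ x, x ∈ S → x ∈ S' → False := fun x h h' => by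
    rw [hS', Finset.mem_sdiff] at h'; exact h'.2 h
  have hb : Function.Bijective e0 := by
    rw [Fintype.bijective_iff_injective_and_card]
    refine ⟨?_, rfl⟩
    apply Function.Injective.sumElim
    · intro a b _; rfl
    · apply Function.Injective.sumElim
      · exact (S.orderEmbOfFin hc).injective
      · exact (S'.orderEmbOfFin hc2).injective
      · intro a b h; exact dj _ (m1 a) (h ▸ m2 b)
    · rintro _ (b | b) h
      · exact r1 (h ▸ m1 b)
      · exact r2 (h ▸ m2 b)
  refine flagE μ hμ h1 (Equiv.ofBijective _ hb) (fun _ => .lf k l) (fun _ => hg)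
    (fun g u => ∑ i : Fin 3, A (g ()) (u i) + ∑ i : Fin 3, ∑ j : Fin 3, A (u i) (u j) * (3 + A (g ()) (u i))) _ ?_
  intro f
  have e : ∀ x y, wT (.lf k l) x y = wL k l (13 * x) (13 * y) := fun _ _ => rfl
  rw [e]
  simp only [sl, sum_emb S hc, sum_emb S' hc2]
  rfl

theorem EX1 (μ : V → ℝ) (hμ : ∀ v, 0 ≤ μ v) (h1 : ∑ v, μ v = 1) (A : V → V → ℕ)
    (k : ℕ) (l : List ℕ) (hg : goodT (.lf k l) = true) :
    140 * 301989888 ≤ Ex μ (fun f : Fin 7 → V => (X1 (wL k l) (pull A f) : ℝ)) := by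
  have e : (fun f : Fin 7 → V => (X1 (wL k l) (pull A f) : ℝ)) = fun f => ∑ r, ∑ S ∈ powersetCard 3 (univ.erase r),
      (wL k l (13 * sl (pull A f) r S) (13 * sl (pull A f) r ((univ.erase r) \ S)) : ℝ) := by
    funext f
    simp only [X1, X1r]; push_cast; rfl
  rw [e, Ex_sum]
  have : ∀ r : Fin 7, 20 * (301989888 : ℝ) ≤ Ex μ (fun f : Fin 7 → V => ∑ S ∈ powersetCard 3 (univ.erase r),
      (wL k l (13 * sl (pull A f) r S) (13 * sl (pull A f) r ((univ.erase r) \ S)) : ℝ)) := by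
    intro r
    rw [Ex_sum]
    have hc : (powersetCard 3 (univ.erase r)).card = 20 := by
      rw [Finset.card_powersetCard, Finset.card_erase_of_mem (mem_univ _)]; rfl
    have : ∑ y ∈ powersetCard 3 (univ.erase r), (301989888 : ℝ) = 20 * 301989888 := by rw [Finset.sum_const, hc]; simp
    rw [← this]
    exact Finset.sum_le_sum (fun S hS => E1r μ hμ h1 A r S hS k l hg)
  calc (140 : ℝ) * 301989888 = ∑ x : Fin 7, 20 * (301989888 : ℝ) := by simp; norm_num
    _ ≤ _ := Finset.sum_le_sum (fun x _ => this x)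

/-- parity of the number of edges of a triple -/
def odd3 (A : V → V → ℕ) (x y z : V) : ℕ := (A x y + A x z + A y z) % 2

theorem sum_odd (a : Fin 7 → Fin 7 → ℕ) (hs : ∀ i j, a i j = a j i) (h1 : ∀ i j, a i j ≤ 1) :
    (∑ i, ∑ j, ∑ k, odd3 a i j k) + 6 * dQ a = 21 * dD a + 4 * dT a := by
  have key : ∀ x y z : ℕ, x ≤ 1 → y ≤ 1 → z ≤ 1 → (x + y + z) % 2 + 2 * (x * y + x * z + y * z) = x + y + z + 4 * (x * (y * z)) := by
    intro x y z hx hy hz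
    interval_cases x <;> interval_cases y <;> interval_cases z <;> rfl
  have hQ : dQ a = ∑ i, ∑ j, ∑ k, a i j * a i k := by
    simp only [dQ, dg, Finset.sum_mul_sum]
  have hQ2 : dQ a = ∑ i, ∑ j, ∑ k, a i j * a j k := by
    rw [Finset.sum_comm, hQ]
    refine Finset.sum_congr rfl (fun i _ => Finset.sum_congr rfl (fun j _ => Finset.sum_congr rfl (fun k _ => ?_)))
    rw [hs j i]
  have hQ3 : dQ a = ∑ i, ∑ j, ∑ k, a i k * a j k := by
    have : ∀ i, ∑ j, ∑ k, a i k * a j k = ∑ j, ∑ k, a i j * a j k := by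
      intro i
      rw [Finset.sum_comm]
      refine (Finset.sum_congr rfl (fun j _ => Finset.sum_congr rfl (fun k _ => ?_)))
      rw [hs k j]
    rw [Finset.sum_congr rfl (fun i _ => this i), hQ2]
  have hD : 7 * dD a = ∑ i, ∑ j, ∑ k : Fin 7, a i j := by
    simp only [dD, dg, Finset.sum_const, Finset.card_univ, Fintype.card_fin, smul_eq_mul, Finset.mul_sum]
  have hD2 : 7 * dD a = ∑ i, ∑ j : Fin 7, ∑ k : Fin 7, a i k := by
    simp only [dD, dg, Finset.sum_const, Finset.card_univ, Fintype.card_fin, smul_eq_mul, Finset.mul_sum]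
  have hD3 : 7 * dD a = ∑ i : Fin 7, ∑ j : Fin 7, ∑ k : Fin 7, a j k := by
    simp only [dD, dg, Finset.sum_const, Finset.card_univ, Fintype.card_fin, smul_eq_mul, Finset.mul_sum]
  have hT : dT a = ∑ i, ∑ j, ∑ k, a i j * (a i k * a j k) := by
    simp only [dT, tg, cg, Finset.mul_sum]
  have main : (∑ i, ∑ j, ∑ k, odd3 a i j k) + 2 * (dQ a + dQ a + dQ a) = 7 * dD a + 7 * dD a + 7 * dD a + 4 * dT a := by
    conv_rhs => rw [hD3, ← hD3]
    have l : 2 * (dQ a + dQ a + dQ a) = 2 * ((∑ i, ∑ j, ∑ k, a i j * a i k) + (∑ i, ∑ j, ∑ k, a i j * a j k) + (∑ i, ∑ j, ∑ k, a i k * a j k)) := by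
      rw [← hQ, ← hQ2, ← hQ3]
    have r : 7 * dD a + 7 * dD a + 7 * dD a + 4 * dT a = (∑ i, ∑ j, ∑ k : Fin 7, a i j) + (∑ i, ∑ j : Fin 7, ∑ k : Fin 7, a i k) +
      (∑ i : Fin 7, ∑ j : Fin 7, ∑ k : Fin 7, a j k) + 4 * (∑ i, ∑ j, ∑ k, a i j * (a i k * a j k)) := by
      rw [← hD, ← hD2, ← hD3, ← hT]
    rw [l, r]
    clear l r hQ hQ2 hQ3 hD hD2 hD3 hT
    simp only [Finset.mul_sum, ← Finset.sum_add_distrib]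
    exact Finset.sum_congr rfl (fun i _ => Finset.sum_congr rfl (fun j _ => Finset.sum_congr rfl (fun k _ =>
      key _ _ _ (h1 _ _) (h1 _ _) (h1 _ _))))
  omega

theorem pw2 (a : Fin 7 → Fin 7 → ℕ) (hs : ∀ i j, a i j = a j i) (h0 : ∀ i, a i i = 0) (h1 : ∀ i j, a i j ≤ 1) :
    2 * (if dD a = 20 then 8427240 else 0) + (X5 pairT a + X1 (wL 2 tab1) a) + 200 * odd3 a 0 1 2 ≤ 54967985856 := by
  have p := pointwise a hs h0 h1
  have s := sum_odd a hs h1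
  have : odd3 a 0 1 2 ≤ ∑ i, ∑ j, ∑ k, odd3 a i j k := by
    refine le_trans ?_ (Finset.single_le_sum (f := fun i => ∑ j, ∑ k, odd3 a i j k) (fun _ _ => Nat.zero_le _) (mem_univ 0))
    refine le_trans ?_ (Finset.single_le_sum (f := fun j => ∑ k, odd3 a 0 j k) (fun _ _ => Nat.zero_le _) (mem_univ 1))
    exact Finset.single_le_sum (f := fun k => odd3 a 0 1 k) (fun _ _ => Nat.zero_le _) (mem_univ 2)
  revert p
  generalize X5 pairT a = x5
  generalize X1 (wL 2 tab1) a = x1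
  generalize (if dD a = 20 then 8427240 else 0) = z
  intro p
  omega

/-- the indicator of ten edges -/
noncomputable def ten (A : V → V → ℕ) (f : Fin 7 → V) : ℝ := if dD (pull A f) = 20 then 1 else 0

theorem Ex_comb (μ : V → ℝ) {ι : Type} [Fintype ι] (φ₁ φ₂ φ₃ φ₄ : (ι → V) → ℝ) (c d : ℝ) :
    Ex μ (fun f => c * φ₁ f + (φ₂ f + φ₃ f) + d * φ₄ f) = c * Ex μ φ₁ + (Ex μ φ₂ + Ex μ φ₃) + d * Ex μ φ₄ := by
  rw [Ex_add, Ex_add, Ex_add, Ex_smul, Ex_smul]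

theorem flag_ineq (μ : V → ℝ) (hμ : ∀ v, 0 ≤ μ v) (h1 : ∑ v, μ v = 1) (A : V → V → ℕ)
    (hs : ∀ i j, A i j = A j i) (h0 : ∀ i, A i i = 0) (hA : ∀ i j, A i j ≤ 1) :
    Ex μ (ten A) + 100 / 8427240 * Ex μ (fun g : Fin 3 → V => (odd3 A (g 0) (g 1) (g 2) : ℝ)) ≤ 28 / 81 := by
  have e5 := EX5 μ A pairT _ (E01 μ hμ h1 A hs h0 hA)
  have e1 := EX1 μ hμ h1 A 2 tab1 good1
  have em := Ex_marg μ h1 (finSumFinEquiv : Fin 3 ⊕ Fin 4 ≃ Fin 7) (fun g : Fin 3 → V => (odd3 A (g 0) (g 1) (g 2) : ℝ))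
  rw [← em]
  clear em
  have pw : ∀ f : Fin 7 → V, (2 * 8427240) * ten A f + ((X5 pairT (pull A f) : ℝ) + (X1 (wL 2 tab1) (pull A f) : ℝ)) +
     200 * (odd3 A (f 0) (f 1) (f 2) : ℝ) ≤ 54967985856 := by
    intro f
    have p := pw2 (pull A f) (fun _ _ => hs _ _) (fun _ => h0 _) (fun _ _ => hA _ _)
    have o : odd3 (pull A f) 0 1 2 = odd3 A (f 0) (f 1) (f 2) := rfl
    rw [o] at p
    revert p
    generalize X5 pairT (pull A f) = x5
    generalize X1 (wL 2 tab1) (pull A f) = x1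
    intro p
    rw [ten]
    split_ifs at p ⊢ with h
    · have : (2 * 8427240 + (x5 + x1) + 200 * odd3 A (f 0) (f 1) (f 2) : ℝ) ≤ 54967985856 := by exact_mod_cast p
      linarith
    · have : (2 * 0 + (x5 + x1) + 200 * odd3 A (f 0) (f 1) (f 2) : ℝ) ≤ 54967985856 := by exact_mod_cast p
      linarith
  have h := Ex_mono μ hμ _ _ pw
  rw [Ex_const μ h1, Ex_comb μ (ten A) (fun f : Fin 7 → V => (X5 pairT (pull A f) : ℝ))
    (fun f => (X1 (wL 2 tab1) (pull A f) : ℝ)) (fun f => (odd3 A (f 0) (f 1) (f 2) : ℝ))] at h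
  have o : (fun f : Fin 7 → V => (fun g : Fin 3 → V => (odd3 A (g 0) (g 1) (g 2) : ℝ))
     (fun i => f ((finSumFinEquiv : Fin 3 ⊕ Fin 4 ≃ Fin 7) (Sum.inl i)))) = fun f => (odd3 A (f 0) (f 1) (f 2) : ℝ) := rfl
  rw [o]
  clear o pw
  linarith
end flags2


set_option linter.unusedSectionVars false

section tools

variable {V : Type} [Fintype V]

theorem sum_insertNth {k : ℕ} (i : Fin (k + 1)) (inst : Fintype (Fin (k + 1) → V)) (inst' : Fintype (Fin k → V)) (ψ : (Fin (k + 1) → V) → ℝ) :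
    ∑ f, ψ f = ∑ x : V, ∑ g : Fin k → V, ψ (i.insertNth x g) := by
  rw [← Fintype.sum_prod_type' (f := fun (x : V) (g : Fin k → V) => ψ (i.insertNth x g))]
  exact (Fintype.sum_equiv (Fin.insertNthEquiv (fun _ => V) i) _ _ (fun p => rfl)).symm

theorem Ex_insert (μ : V → ℝ) {k : ℕ} (i : Fin (k + 1)) (φ : (Fin (k + 1) → V) → ℝ) :
    Ex μ φ = ∑ x, μ x * Ex μ (fun g : Fin k → V => φ (i.insertNth x g)) := by
  rw [Ex, sum_insertNth i _ inferInstance]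
  refine Finset.sum_congr rfl (fun x _ => ?_)
  rw [Ex_def μ inferInstance, Finset.mul_sum]
  refine Finset.sum_congr rfl (fun g _ => ?_)
  rw [Fin.prod_univ_succAbove _ i]
  simp only [Fin.insertNth_apply_same, Fin.insertNth_apply_succAbove]
  ring

theorem Ex_c1 (μ : V → ℝ) (h1 : ∑ v, μ v = 1) {k : ℕ} (i : Fin (k + 1)) (φ : V → ℝ) :
    Ex μ (fun f : Fin (k + 1) → V => φ (f i)) = ∑ x, μ x * φ x := by
  rw [Ex_insert μ i]
  simp only [Fin.insertNth_apply_same, Ex_const μ h1]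

theorem Ex_c2 (μ : V → ℝ) (h1 : ∑ v, μ v = 1) {k : ℕ} (i j : Fin (k + 2)) (h : i ≠ j) (φ : V → V → ℝ) :
    Ex μ (fun f : Fin (k + 2) → V => φ (f i) (f j)) = ∑ x, μ x * ∑ y, μ y * φ x y := by
  obtain ⟨j', rfl⟩ := Fin.exists_succAbove_eq h.symm
  rw [Ex_insert μ i]
  simp only [Fin.insertNth_apply_same, Fin.insertNth_apply_succAbove]
  exact Finset.sum_congr rfl (fun x _ => by rw [Ex_c1 μ h1 j' (fun y => φ x y)])

theorem Ex_c3 (μ : V → ℝ) (h1 : ∑ v, μ v = 1) {k : ℕ} (i j l : Fin (k + 3)) (h : i ≠ j) (h' : i ≠ l) (h'' : j ≠ l) (φ : V → V → V → ℝ) :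
    Ex μ (fun f : Fin (k + 3) → V => φ (f i) (f j) (f l)) = ∑ x, μ x * ∑ y, μ y * ∑ z, μ z * φ x y z := by
  obtain ⟨j', rfl⟩ := Fin.exists_succAbove_eq h.symm
  obtain ⟨l', rfl⟩ := Fin.exists_succAbove_eq h'.symm
  rw [Ex_insert μ i]
  simp only [Fin.insertNth_apply_same, Fin.insertNth_apply_succAbove]
  exact Finset.sum_congr rfl (fun x _ => by rw [Ex_c2 μ h1 j' l' (fun h => h'' (by rw [h])) (fun y z => φ x y z)])

/-- push-forward -/
theorem Ex_push {U : Type} [Fintype U] (μ : U → ℝ) (h : U → V) (μ' : V → ℝ) [∀ u v, Decidable (h u = v)] (hμ : ∀ v, μ' v = ∑ u, if h u = v then μ u else 0)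
    {ι : Type} [Fintype ι] (φ : (ι → V) → ℝ) : Ex μ' φ = Ex μ (fun g => φ (h ∘ g)) := by
  rw [Ex, Ex]
  have e : ∀ f : ι → V, ∏ i, μ' (f i) = ∑ g : ι → U, if h ∘ g = f then ∏ i, μ (g i) else 0 := by
    intro f
    simp only [hμ]
    rw [Finset.prod_univ_sum, Fintype.piFinset_univ]
    refine Finset.sum_congr rfl (fun g _ => ?_)
    split_ifs with hg
    · refine Finset.prod_congr rfl (fun i _ => ?_)
      exact if_pos (congrFun hg i)
    · obtain ⟨i, hi⟩ := Function.ne_iff.1 hg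
      exact Finset.prod_eq_zero (mem_univ i) (if_neg hi)
  simp only [e, Finset.sum_mul]
  rw [Finset.sum_comm]
  refine Finset.sum_congr rfl (fun g _ => ?_)
  rw [Finset.sum_eq_single (h ∘ g)]
  · rw [if_pos rfl]
  · intro f _ hf
    rw [if_neg (Ne.symm hf), zero_mul]
  · intro h; exact absurd (mem_univ _) h

theorem ten_perm (A : V → V → ℕ) (f : Fin 7 → V) (σ : Equiv.Perm (Fin 7)) : ten A (f ∘ σ) = ten A f := by
  have : pull A (f ∘ σ) = rl (pull A f) σ := rfl
  rw [ten, ten, this, dD_rl]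

theorem insertNth_eq (i : Fin 7) (v : V) (g : Fin 6 → V) : ∃ σ : Equiv.Perm (Fin 7), (i.insertNth v g : Fin 7 → V) ∘ σ = Fin.cons v g := by
  refine ⟨(finSuccEquiv' (0 : Fin 7)).trans (finSuccEquiv' i).symm, ?_⟩
  funext j
  refine Fin.cases ?_ (fun j => ?_) j
  · simp
  · rw [Function.comp_apply, Equiv.trans_apply, ← Fin.zero_succAbove, finSuccEquiv'_succAbove, finSuccEquiv'_symm_some, Fin.insertNth_apply_succAbove, Fin.zero_succAbove, Fin.cons_succ]

theorem ten_insert (A : V → V → ℕ) (i : Fin 7) (v : V) (g : Fin 6 → V) : ten A (i.insertNth v g) = ten A (Fin.cons v g) := by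
  obtain ⟨σ, h⟩ := insertNth_eq i v g
  rw [← h, ten_perm]

theorem ten_nonneg (A : V → V → ℕ) (f) : 0 ≤ ten A f := by rw [ten]; split_ifs <;> norm_num
theorem ten_le (A : V → V → ℕ) (f) : ten A f ≤ 1 := by rw [ten]; split_ifs <;> norm_num
theorem Ex_nonneg (μ : V → ℝ) (hμ : ∀ v, 0 ≤ μ v) {ι : Type} [Fintype ι] (φ : (ι → V) → ℝ) (h : ∀ f, 0 ≤ φ f) : 0 ≤ Ex μ φ :=
  Finset.sum_nonneg (fun f _ => mul_nonneg (Finset.prod_nonneg (fun i _ => hμ _)) (h f))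

theorem prod_lin {ι : Type} [DecidableEq ι] (s : Finset ι) (a b : ι → ℝ) (ha : ∀ i, 0 ≤ a i) (hb : ∀ i, 0 ≤ b i) :
    ∏ i ∈ s, b i + ∑ i ∈ s, a i * ∏ j ∈ s.erase i, b j ≤ ∏ i ∈ s, (a i + b i) := by
  induction s using Finset.induction_on with
  | empty => simp
  | insert x s hx ih =>
    rw [Finset.prod_insert hx, Finset.prod_insert hx, Finset.sum_insert hx, Finset.erase_insert hx]
    have e : ∑ i ∈ s, a i * ∏ j ∈ (insert x s).erase i, b j = b x * ∑ i ∈ s, a i * ∏ j ∈ s.erase i, b j := by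
      rw [Finset.mul_sum]
      refine Finset.sum_congr rfl (fun i hi => ?_)
      have hne : x ≠ i := fun h => hx (h ▸ hi)
      rw [Finset.erase_insert_of_ne hne, Finset.prod_insert (fun h => hx (Finset.mem_of_mem_erase h))]
      ring
    rw [e]
    have h1 := mul_le_mul_of_nonneg_left ih (add_nonneg (ha x) (hb x))
    have h2 : 0 ≤ a x * ∑ i ∈ s, a i * ∏ j ∈ s.erase i, b j :=
      mul_nonneg (ha x) (Finset.sum_nonneg (fun i _ => mul_nonneg (ha i) (Finset.prod_nonneg (fun j _ => hb j))))
    nlinarith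

theorem Ex_first (μ ν δ : V → ℝ) (o : V) (η : ℝ) (hη : 0 ≤ η) (hη1 : η ≤ 1) (hν : ∀ v, 0 ≤ ν v)
    (hδo : δ o = 1) (hδ : ∀ v, v ≠ o → δ v = 0)
    (hμ : ∀ v, μ v = η * δ v + (1 - η) * ν v) (A : V → V → ℕ) :
    (1 - η) ^ 7 * Ex ν (ten A) + 7 * (η * (1 - η) ^ 6 * Ex ν (fun g : Fin 6 → V => ten A (Fin.cons o g))) ≤ Ex μ (ten A) := by
  have hδ0 : ∀ v, 0 ≤ δ v := fun v => by
    by_cases h : v = o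
    · rw [h, hδo]; norm_num
    · rw [hδ v h]
  have p : ∀ f : Fin 7 → V, (1 - η) ^ 7 * ∏ i, ν (f i) + ∑ i, (η * (1 - η) ^ 6 * (δ (f i) * ∏ j, ν (f (i.succAbove j)))) ≤ ∏ i, μ (f i) := by
    intro f
    have h := prod_lin univ (fun i => η * δ (f i)) (fun i => (1 - η) * ν (f i)) (fun i => mul_nonneg hη (hδ0 _))
      (fun i => mul_nonneg (by linarith) (hν _))
    simp only [hμ]
    refine le_trans (le_of_eq ?_) h
    rw [Finset.prod_mul_distrib, Finset.prod_const, Finset.card_univ, Fintype.card_fin]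
    congr 1
    refine Finset.sum_congr rfl (fun i _ => ?_)
    have : ∀ ψ : Fin 7 → ℝ, ∏ j ∈ univ.erase i, ψ j = ∏ j ∈ univ.image i.succAbove, ψ j := by
      intro ψ
      refine Finset.prod_congr ?_ (fun _ _ => rfl)
      rw [Fin.image_succAbove_univ]; ext; simp
    have t : ∏ j ∈ univ.erase i, (1 - η) * ν (f j) = ∏ j ∈ univ.image i.succAbove, (1 - η) * ν (f j) := by
      convert this _
    rw [t, Finset.prod_image (fun a _ b _ h => Fin.succAbove_right_injective h), Finset.prod_mul_distrib, Finset.prod_const, Finset.card_univ, Fintype.card_fin]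
    ring
  have s : ∀ i : Fin 7, ∑ f : Fin 7 → V, (δ (f i) * ∏ j, ν (f (i.succAbove j))) * ten A f = Ex ν (fun g : Fin 6 → V => ten A (Fin.cons o g)) := by
    intro i
    rw [sum_insertNth i _ inferInstance]
    simp only [Fin.insertNth_apply_same, Fin.insertNth_apply_succAbove, ten_insert]
    rw [Finset.sum_eq_single o]
    · simp only [hδo, one_mul]
      rw [Ex_def ν inferInstance]
    · intro b _ hb
      simp only [hδ b hb, zero_mul, Finset.sum_const_zero]
    · intro h; exact absurd (mem_univ _) h
  have e : (1 - η) ^ 7 * Ex ν (ten A) + 7 * (η * (1 - η) ^ 6 * Ex ν (fun g : Fin 6 → V => ten A (Fin.cons o g))) =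
    ∑ f : Fin 7 → V, ((1 - η) ^ 7 * ∏ i, ν (f i) + ∑ i, (η * (1 - η) ^ 6 * (δ (f i) * ∏ j, ν (f (i.succAbove j))))) * ten A f := by
    have e2 : 7 * (η * (1 - η) ^ 6 * Ex ν (fun g : Fin 6 → V => ten A (Fin.cons o g))) =
      ∑ i : Fin 7, η * (1 - η) ^ 6 * ∑ f : Fin 7 → V, (δ (f i) * ∏ j, ν (f (i.succAbove j))) * ten A f := by
      simp only [s]
      rw [Finset.sum_const, Finset.card_univ, Fintype.card_fin]
      simp
    rw [e2]
    rw [Ex_def ν inferInstance]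
    simp only [add_mul, Finset.sum_add_distrib, Finset.mul_sum, Finset.sum_mul]
    congr 1
    · exact Finset.sum_congr rfl (fun f _ => by ring)
    · rw [Finset.sum_comm]
      exact Finset.sum_congr rfl (fun f _ => Finset.sum_congr rfl (fun i _ => by ring))
  rw [e, Ex_def μ inferInstance]
  exact Finset.sum_le_sum (fun f _ => mul_le_mul_of_nonneg_right (p f) (ten_nonneg A f))

/-- matrix on `Option V` with a new vertex -/
def optM (K : V → V → ℕ) (z : V → ℕ) : Option V → Option V → ℕ
  | none, none => 0
  | none, some u => z u
  | some u, none => z u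
  | some u, some w => K u w

theorem rooted (ν : V → ℝ) (hν : ∀ v, 0 ≤ ν v) (h1 : ∑ v, ν v = 1) (K : V → V → ℕ)
    (hs : ∀ i j, K i j = K j i) (h0 : ∀ i, K i i = 0) (hK : ∀ i j, K i j ≤ 1) (z : V → ℕ) (hz : ∀ u, z u ≤ 1)
    (hE : Ex ν (ten K) = 28 / 81) :
    100 / 8427240 * (∑ u, ν u * ∑ w, ν w * (((z u + z w + K u w) % 2 : ℕ) : ℝ)) ≤
      7 * (28 / 81 - Ex ν (fun g : Fin 6 → V => ten (optM K z) (Fin.cons none (some ∘ g)))) := by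
  set F := Ex ν (fun g : Fin 6 → V => ten (optM K z) (Fin.cons none (some ∘ g))) with hF
  set b := ∑ u, ν u * ∑ w, ν w * (((z u + z w + K u w) % 2 : ℕ) : ℝ) with hb
  let ν' : Option V → ℝ := fun o => o.elim 0 ν
  have hν' : ∀ o, ν' o = ∑ u, if some u = o then ν u else 0 := by
    intro o
    cases o with
    | none => simp [ν']
    | some w => simp [ν']
  have hν0 : ∀ o, 0 ≤ ν' o := by
    intro o; cases o with
    | none => exact le_rfl
    | some w => exact hν w
  have e7 : Ex ν' (ten (optM K z)) = 28 / 81 := by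
    rw [Ex_push ν some ν' hν', ← hE]; rfl
  have e6 : Ex ν' (fun g : Fin 6 → Option V => ten (optM K z) (Fin.cons none g)) = F := by
    rw [Ex_push ν some ν' hν']
  have main : ∀ η : ℝ, 0 ≤ η → η ≤ 1 →
      (1 - η) ^ 7 * (28 / 81) + 7 * (η * (1 - η) ^ 6 * F) + 100 / 8427240 * (η * (1 - η) ^ 2 * b) ≤ 28 / 81 := by
    intro η hη hη1
    let δ : Option V → ℝ := fun v => if v = none then 1 else 0
    let μ : Option V → ℝ := fun v => η * δ v + (1 - η) * ν' v
    have hμ0 : ∀ v, 0 ≤ μ v := fun v => by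
      have : 0 ≤ δ v := by simp only [δ]; split_ifs <;> norm_num
      exact add_nonneg (mul_nonneg hη this) (mul_nonneg (by linarith) (hν0 v))
    have hμ1 : ∑ v, μ v = 1 := by
      rw [Fintype.sum_option]
      simp [μ, δ, ν', ← Finset.mul_sum, h1]
    have fl := flag_ineq μ hμ0 hμ1 (optM K z)
      (by
        rintro (_ | i) (_ | j)
        · rfl
        · rfl
        · rfl
        · exact hs i j)
      (by rintro (_ | i) <;> simp [optM, h0])
      (by rintro (_ | i) (_ | j) <;> simp [optM, hz, hK])
    have f1 := Ex_first μ ν' δ none η hη hη1 hν0 (if_pos rfl) (fun v hv => if_neg hv) (fun _ => rfl) (optM K z)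
    rw [e7, e6] at f1
    have f2 : η * (1 - η) ^ 2 * b ≤ Ex μ (fun g : Fin 3 → Option V => (odd3 (optM K z) (g 0) (g 1) (g 2) : ℝ)) := by
      rw [Ex_c3 μ hμ1 0 1 2 (by decide) (by decide) (by decide) (fun x y w => (odd3 (optM K z) x y w : ℝ))]
      have nn : ∀ x y w, (0 : ℝ) ≤ odd3 (optM K z) x y w := fun x y w => Nat.cast_nonneg _
      have nn2 : ∀ x y, 0 ≤ ∑ w, μ w * (odd3 (optM K z) x y w : ℝ) := fun x y =>
        Finset.sum_nonneg (fun w _ => mul_nonneg (hμ0 w) (nn x y w))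
      have nn3 : ∀ x, 0 ≤ ∑ y, μ y * ∑ w, μ w * (odd3 (optM K z) x y w : ℝ) := fun x =>
        Finset.sum_nonneg (fun w _ => mul_nonneg (hμ0 w) (nn2 x w))
      have mn : μ none = η := by simp [μ, δ, ν']
      have ms : ∀ u, μ (some u) = (1 - η) * ν u := fun u => by simp [μ, δ, ν']
      rw [Fintype.sum_option]
      refine le_trans ?_ (le_add_of_nonneg_right (Finset.sum_nonneg (fun u _ => mul_nonneg (hμ0 _) (nn3 _))))
      rw [mn, mul_assoc]
      refine mul_le_mul_of_nonneg_left ?_ hη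
      rw [Fintype.sum_option]
      refine le_trans ?_ (le_add_of_nonneg_left (mul_nonneg (hμ0 _) (nn2 _ _)))
      have : ∀ u, (1 - η) ^ 2 * (ν u * ∑ w, ν w * (((z u + z w + K u w) % 2 : ℕ) : ℝ)) ≤ μ (some u) * ∑ w, μ w * (odd3 (optM K z) none (some u) w : ℝ) := by
        intro u
        rw [Fintype.sum_option, ms]
        have : (1 - η) ^ 2 * (ν u * ∑ w, ν w * (((z u + z w + K u w) % 2 : ℕ) : ℝ)) =
          (1 - η) * ν u * ∑ w, (1 - η) * ν w * (((z u + z w + K u w) % 2 : ℕ) : ℝ) := by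
          simp only [Finset.mul_sum]
          exact Finset.sum_congr rfl (fun w _ => by ring)
        rw [this]
        refine mul_le_mul_of_nonneg_left ?_ (mul_nonneg (by linarith) (hν u))
        refine le_trans (le_of_eq ?_) (le_add_of_nonneg_left (mul_nonneg (hμ0 _) (nn _ _ _)))
        refine Finset.sum_congr rfl (fun w _ => ?_)
        rw [ms]
        rfl
      rw [hb, Finset.mul_sum]
      exact Finset.sum_le_sum (fun u _ => this u)
    linarith
  have hF1 : 0 ≤ F := Ex_nonneg ν hν _ (fun g => ten_nonneg _ _)
  -- let η tend to zero
  have key : ∀ η : ℝ, 0 < η → η < 1 → 7 * ((1 - η) ^ 6 * F) + 100 / 8427240 * ((1 - η) ^ 2 * b) ≤ 7 * (28 / 81) := by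
    intro η h0 h1
    have m := main η h0.le h1.le
    have bern : 1 - 7 * η ≤ (1 - η) ^ 7 := by
      have := one_add_mul_le_pow (a := -η) (by linarith) 7
      have e : 1 + -η = 1 - η := by ring
      rw [e] at this
      push_cast at this; linarith
    have : η * (7 * ((1 - η) ^ 6 * F) + 100 / 8427240 * ((1 - η) ^ 2 * b)) ≤ η * (7 * (28 / 81)) := by nlinarith
    exact le_of_mul_le_mul_left this h0
  have lim : Filter.Tendsto (fun η : ℝ => 7 * ((1 - η) ^ 6 * F) + 100 / 8427240 * ((1 - η) ^ 2 * b)) (nhdsWithin 0 (Set.Ioi 0))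
      (nhds (7 * ((1 - 0) ^ 6 * F) + 100 / 8427240 * ((1 - 0) ^ 2 * b))) := by
    apply Filter.Tendsto.mono_left _ nhdsWithin_le_nhds
    apply Continuous.tendsto
    fun_prop
  have := le_of_tendsto lim (by
    filter_upwards [Ioo_mem_nhdsGT (zero_lt_one' ℝ)] with η hη
    exact key η hη.1 hη.2)
  norm_num at this
  linarith
end tools

set_option linter.unusedSectionVars false

section bip

/-- adjacency of the two-vertex complete bipartite pattern -/
def KB (x y : Bool) : ℕ := if x = y then 0 else 1

def cnt {k : ℕ} (f : Fin k → Bool) : ℕ := ∑ i, (f i).toNat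

theorem prod_cnt {k : ℕ} (m : Bool → ℝ) (f : Fin k → Bool) : ∏ i, m (f i) = m true ^ cnt f * m false ^ (k - cnt f) := by
  induction k with
  | zero => simp [cnt]
  | succ k ih =>
    rw [Fin.prod_univ_succ, ih (fun i => f i.succ)]
    have h : cnt f = (f 0).toNat + cnt (fun i => f i.succ) := by rw [cnt, Fin.sum_univ_succ]; rfl
    have hle : cnt (fun i => f i.succ) ≤ k := by
      rw [cnt]
      refine (Finset.sum_le_sum (fun i _ => Bool.toNat_le _)).trans ?_
      simp
    rw [h]
    cases f 0
    · have : k + 1 - (false.toNat + cnt (fun i => f i.succ)) = (k - cnt (fun i => f i.succ)) + 1 := by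
        simp only [Bool.toNat_false]; omega
      rw [this, pow_succ]; simp; ring
    · have : k + 1 - (true.toNat + cnt (fun i => f i.succ)) = (k - cnt (fun i => f i.succ)) := by
        simp only [Bool.toNat_true]; omega
      rw [this, pow_add]; simp; ring

theorem Ex_two (k : ℕ) (m : Bool → ℝ) (φ : (Fin k → Bool) → ℝ) (p q : ℕ) (hpq : p ≠ q)
    (h : ∀ f, φ f = if cnt f = p ∨ cnt f = q then 1 else 0) :
    Ex m φ = ((univ : Finset (Fin k → Bool)).filter (fun f => cnt f = p)).card * (m true ^ p * m false ^ (k - p))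
     + ((univ : Finset (Fin k → Bool)).filter (fun f => cnt f = q)).card * (m true ^ q * m false ^ (k - q)) := by
  have e : ∀ f : Fin k → Bool, (∏ i, m (f i)) * φ f = (if cnt f = p then 1 else 0) * (m true ^ p * m false ^ (k - p)) +
     (if cnt f = q then 1 else 0) * (m true ^ q * m false ^ (k - q)) := by
    intro f
    rw [prod_cnt, h]
    by_cases h1 : cnt f = p
    · simp [h1, hpq]
    · by_cases h2 : cnt f = q
      · simp [h2, hpq.symm]
      · simp [h1, h2]
  rw [Ex_def m inferInstance, Finset.sum_congr rfl (fun f _ => e f), Finset.sum_add_distrib, ← Finset.sum_mul, ← Finset.sum_mul,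
    Finset.sum_boole, Finset.sum_boole]

theorem ExK7 (m : Bool → ℝ) : Ex m (ten KB) = 21 * (m true ^ 2 * m false ^ 5) + 21 * (m true ^ 5 * m false ^ 2) := by
  have hd : ∀ f : Fin 7 → Bool, dD (pull KB f) = 20 ↔ (cnt f = 2 ∨ cnt f = 5) := by decide +kernel
  rw [Ex_two 7 m (ten KB) 2 5 (by decide) (fun f => by rw [ten]; exact if_congr (hd f) rfl rfl)]
  have c2 : ((univ : Finset (Fin 7 → Bool)).filter (fun f => cnt f = 2)).card = 21 := by decide +kernel
  have c5 : ((univ : Finset (Fin 7 → Bool)).filter (fun f => cnt f = 5)).card = 21 := by decide +kernel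
  rw [c2, c5]; norm_num

theorem ExK6t (m : Bool → ℝ) : Ex m (fun g : Fin 6 → Bool => ten KB (Fin.cons true g)) = 6 * (m true ^ 1 * m false ^ 5) + 15 * (m true ^ 4 * m false ^ 2) := by
  have hd : ∀ f : Fin 6 → Bool, dD (pull KB (Fin.cons true f)) = 20 ↔ (cnt f = 1 ∨ cnt f = 4) := by decide +kernel
  rw [Ex_two 6 m _ 1 4 (by decide) (fun f => by rw [ten]; exact if_congr (hd f) rfl rfl)]
  have c2 : ((univ : Finset (Fin 6 → Bool)).filter (fun f => cnt f = 1)).card = 6 := by decide +kernel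
  have c5 : ((univ : Finset (Fin 6 → Bool)).filter (fun f => cnt f = 4)).card = 15 := by decide +kernel
  rw [c2, c5]; norm_num

theorem ExK6f (m : Bool → ℝ) : Ex m (fun g : Fin 6 → Bool => ten KB (Fin.cons false g)) = 15 * (m true ^ 2 * m false ^ 4) + 6 * (m true ^ 5 * m false ^ 1) := by
  have hd : ∀ f : Fin 6 → Bool, dD (pull KB (Fin.cons false f)) = 20 ↔ (cnt f = 2 ∨ cnt f = 5) := by decide +kernel
  rw [Ex_two 6 m _ 2 5 (by decide) (fun f => by rw [ten]; exact if_congr (hd f) rfl rfl)]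
  have c2 : ((univ : Finset (Fin 6 → Bool)).filter (fun f => cnt f = 2)).card = 15 := by decide +kernel
  have c5 : ((univ : Finset (Fin 6 → Bool)).filter (fun f => cnt f = 5)).card = 6 := by decide +kernel
  rw [c2, c5]; norm_num

variable {V : Type} [Fintype V]

/-- adjacency of the complete bipartite graph given by a colouring -/
def Kc (c : V → Bool) (u w : V) : ℕ := KB (c u) (c w)

theorem Kc_symm (c : V → Bool) (u w) : Kc c u w = Kc c w u := by simp only [Kc, KB, eq_comm]
theorem Kc_irr (c : V → Bool) (u) : Kc c u u = 0 := by simp [Kc, KB]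
theorem Kc_le (c : V → Bool) (u w) : Kc c u w ≤ 1 := by rw [Kc, KB]; split_ifs <;> norm_num

/-- colour masses -/
noncomputable def mass (ν : V → ℝ) (c : V → Bool) (b : Bool) : ℝ := ∑ u, if c u = b then ν u else 0

theorem Ex_Kc7 (ν : V → ℝ) (c : V → Bool) : Ex ν (ten (Kc c)) = Ex (mass ν c) (ten KB) :=
  (Ex_push ν c (mass ν c) (fun _ => rfl) (ten KB)).symm

theorem Ex_Kc6 (ν : V → ℝ) (c : V → Bool) (v : V) : Ex ν (fun g : Fin 6 → V => ten (Kc c) (Fin.cons v g)) =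
    Ex (mass ν c) (fun g : Fin 6 → Bool => ten KB (Fin.cons (c v) g)) := by
  rw [Ex_push ν c (mass ν c) (fun _ => rfl)]
  refine congrArg (Ex ν) (funext fun g => ?_)
  have : (Fin.cons (c v) (c ∘ g) : Fin 7 → Bool) = c ∘ (Fin.cons v g : Fin 7 → V) := by
    funext i
    refine Fin.cases rfl (fun i => rfl) i
  rw [this]; rfl

theorem mass_add (ν : V → ℝ) (c : V → Bool) : mass ν c true + mass ν c false = ∑ u, ν u := by
  rw [mass, mass, ← Finset.sum_add_distrib]
  refine Finset.sum_congr rfl (fun u _ => ?_)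
  cases c u <;> simp

theorem K7_formula (ν : V → ℝ) (h1 : ∑ u, ν u = 1) (c : V → Bool) (t : ℝ) (ht : t = mass ν c true * (1 - mass ν c true)) :
    Ex ν (ten (Kc c)) = 28 / 81 - 63 * (t - 2 / 9) ^ 2 * (t + 1 / 9) := by
  rw [Ex_Kc7, ExK7, ht]
  have : mass ν c false = 1 - mass ν c true := by have := mass_add ν c; linarith
  rw [this]; ring

/-- the optimal masses -/
theorem K7_exact (ν : V → ℝ) (h1 : ∑ u, ν u = 1) (c : V → Bool) (h : mass ν c true = 1 / 3 ∨ mass ν c true = 2 / 3) :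
    Ex ν (ten (Kc c)) = 28 / 81 := by
  rw [K7_formula ν h1 c _ rfl]
  rcases h with h | h <;> rw [h] <;> norm_num

theorem K6_exact (ν : V → ℝ) (h1 : ∑ u, ν u = 1) (c : V → Bool) (h : mass ν c true = 1 / 3 ∨ mass ν c true = 2 / 3) (v : V) :
    Ex ν (fun g : Fin 6 → V => ten (Kc c) (Fin.cons v g)) = 28 / 81 := by
  rw [Ex_Kc6]
  have e : mass ν c false = 1 - mass ν c true := by have := mass_add ν c; linarith
  cases c v
  · rw [ExK6f, e]
    rcases h with h | h <;> rw [h] <;> norm_num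
  · rw [ExK6t, e]
    rcases h with h | h <;> rw [h] <;> norm_num

end bip

set_option linter.unusedSectionVars false

section step

variable {V : Type} [Fintype V]

/-- wrong pairs -/
noncomputable def Zn (A : V → V → ℕ) (c : V → Bool) (u w : V) : ℕ := if A u w = Kc c u w then 0 else 1

theorem Zn_le (A : V → V → ℕ) (c : V → Bool) (u w) : Zn A c u w ≤ 1 := by rw [Zn]; split_ifs <;> norm_num
theorem Zn_zero (A : V → V → ℕ) (c : V → Bool) (u w) (h : Zn A c u w = 0) : A u w = Kc c u w := by
  by_contra h'; rw [Zn, if_neg h'] at h; exact one_ne_zero h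
theorem Zn_symm (A : V → V → ℕ) (hs : ∀ i j, A i j = A j i) (c : V → Bool) (u w) : Zn A c u w = Zn A c w u := by
  rw [Zn, Zn, hs, Kc_symm]
theorem Zn_irr (A : V → V → ℕ) (h0 : ∀ i, A i i = 0) (c : V → Bool) (u) : Zn A c u u = 0 := by
  rw [Zn, h0, Kc_irr, if_pos rfl]

noncomputable def wdeg (A : V → V → ℕ) (c : V → Bool) (v : V) : ℕ := ∑ u, Zn A c v u
noncomputable def Wt (A : V → V → ℕ) (c : V → Bool) : ℕ := ∑ v, wdeg A c v

/-- corrected matrix -/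
noncomputable def fixA (A : V → V → ℕ) (c : V → Bool) (v : V) (u w : V) : ℕ := if u = v ∨ w = v then Kc c u w else A u w

/-- uniform weights -/
noncomputable def uni (V : Type) [Fintype V] (_ : V) : ℝ := 1 / (Fintype.card V : ℝ)

noncomputable def injten (A : V → V → ℕ) (f : Fin 7 → V) : ℝ := if Function.Injective f then ten A f else 0

noncomputable def lamI (A : V → V → ℕ) : ℝ := Ex (uni V) (injten A)

theorem uni_sum (h : 0 < Fintype.card V) : ∑ v, uni V v = 1 := by
  simp only [uni, Finset.sum_const, Finset.card_univ, nsmul_eq_mul]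
  field_simp

theorem uni_nonneg (v : V) : 0 ≤ uni V v := by rw [uni]; positivity

theorem injten_insert (A : V → V → ℕ) (i : Fin 7) (v : V) (g : Fin 6 → V) : injten A (i.insertNth v g) = injten A (Fin.cons v g) := by
  obtain ⟨σ, h⟩ := insertNth_eq i v g
  rw [injten, injten, ← h, ten_perm]
  refine if_congr ?_ rfl rfl
  exact (Equiv.injective_comp σ _).symm

theorem lamI_diff (A A' : V → V → ℕ) (v : V) (h : ∀ u w, u ≠ v → w ≠ v → A u w = A' u w) :
    lamI A' - lamI A = 7 / (Fintype.card V : ℝ) *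
      Ex (uni V) (fun g : Fin 6 → V => injten A' (Fin.cons v g) - injten A (Fin.cons v g)) := by
  have e1 : lamI A' - lamI A = Ex (uni V) (fun f : Fin 7 → V => injten A' f - injten A f) := by
    simp only [lamI, Ex, mul_sub, Finset.sum_sub_distrib]
  have e2 : (fun f : Fin 7 → V => injten A' f - injten A f) = fun f => ∑ i, (if f i = v then 1 else 0) * (injten A' f - injten A f) := by
    funext f
    rw [← Finset.sum_mul]
    by_cases hi : Function.Injective f
    · by_cases hv : ∃ i, f i = v
      · obtain ⟨i, rfl⟩ := hv
        have : ∑ j, (if f j = f i then (1 : ℝ) else 0) = 1 := by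
          simp only [hi.eq_iff]; simp
        rw [this, one_mul]
      · push Not at hv
        have : pull A' f = pull A f := by
          funext i j; exact (h _ _ (hv i) (hv j)).symm
        rw [injten, injten, ten, ten, this]; simp
    · rw [injten, injten, if_neg hi, if_neg hi]; simp
  rw [e1, e2, Ex_sum]
  have e3 : ∀ i : Fin 7, Ex (uni V) (fun f : Fin 7 → V => (if f i = v then 1 else 0) * (injten A' f - injten A f)) =
     1 / (Fintype.card V : ℝ) * Ex (uni V) (fun g : Fin 6 → V => injten A' (Fin.cons v g) - injten A (Fin.cons v g)) := by
    intro i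
    rw [Ex_insert (uni V) i]
    simp only [Fin.insertNth_apply_same, injten_insert]
    rw [Finset.sum_eq_single v]
    · simp [uni]
    · intro b _ hb
      simp [hb, Ex]
    · intro h; exact absurd (mem_univ _) h
  rw [Finset.sum_congr rfl (fun i _ => e3 i), Finset.sum_const, Finset.card_univ, Fintype.card_fin]
  simp; ring

/-- number of wrong neighbours of the root hit -/
noncomputable def Hn (A : V → V → ℕ) (c : V → Bool) (v : V) (g : Fin 6 → V) : ℕ := ∑ i, Zn A c v (g i)
noncomputable def Qn (A : V → V → ℕ) (c : V → Bool) (x y : V) : ℕ := (if x = y then 1 else 0) + Zn A c x y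
noncomputable def Tn (A : V → V → ℕ) (c : V → Bool) (v : V) (g : Fin 6 → V) : ℕ :=
  (∑ j, if g j = v then 1 else 0) + ∑ j, ∑ k ∈ univ.erase j, Qn A c (g j) (g k)

theorem ptw_aux1 (p q ε x y H B : ℝ) (hp : 0 ≤ p) (hε : 0 ≤ ε) (hpq : |p - q| ≤ ε * p)
    (t1 : 0 ≤ y) (t2 : y ≤ 1) (t3 : 0 ≤ x) (t4 : x ≤ 1) (hH : 1 ≤ H) (hB : 0 ≤ B) :
    q * (y - x) - p * (ε * H + 2 * B) ≤ p * (y - x) := by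
  have e5 : (0 : ℝ) ≤ p * (2 * B) := by positivity
  have e6 : ε * p ≤ p * (ε * H) := by nlinarith [mul_nonneg hp hε]
  have : (q - p) * (y - x) ≤ ε * p := by
    have : |(q - p) * (y - x)| ≤ ε * p := by
      rw [abs_mul, abs_sub_comm]
      have : |y - x| ≤ 1 := abs_le.2 ⟨by linarith, by linarith⟩
      calc |p - q| * |y - x| ≤ |p - q| * 1 := mul_le_mul_of_nonneg_left this (abs_nonneg _)
        _ ≤ _ := by linarith
    exact (abs_le.1 this).2
  nlinarith

theorem ptw_aux2 (p q ε x y a b H B : ℝ) (hp : 0 ≤ p) (hq : 0 ≤ q) (hε : 0 ≤ ε) (hpq : -(ε * p) ≤ p - q)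
    (t1 : 0 ≤ b) (t2 : b ≤ 1) (t3 : 0 ≤ a) (t4 : a ≤ 1) (i1 : 0 ≤ x) (i2 : y ≤ 1) (hH : 1 ≤ H) (hB : 1 ≤ B) :
    q * (b - a) - p * (ε * H + 2 * B) ≤ p * (x - y) := by
  have u1 : q * (b - a) ≤ q := by nlinarith
  have u2 : -p ≤ p * (x - y) := by nlinarith
  have u3 : q ≤ p + ε * p := by linarith
  have u4 : p * (ε + 2) ≤ p * (ε * H + 2 * B) := mul_le_mul_of_nonneg_left (by nlinarith) hp
  nlinarith

theorem ptw (A : V → V → ℕ) (hs : ∀ i j, A i j = A j i) (h0 : ∀ i, A i i = 0) (c : V → Bool) (v : V) (g : Fin 6 → V)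
    (p q ε : ℝ) (hp : 0 ≤ p) (hq : 0 ≤ q) (hpq : |p - q| ≤ ε * p) (hε : 0 ≤ ε) :
    q * (ten (Kc c) (Fin.cons v g) - ten (optM (Kc c) (A v)) (Fin.cons none (some ∘ g))) - p * (ε * Hn A c v g + 2 * (Hn A c v g * Tn A c v g : ℕ)) ≤
      p * (injten (fixA A c v) (Fin.cons v g) - injten A (Fin.cons v g)) := by
  set f : Fin 7 → V := Fin.cons v g with hf
  have f0 : f 0 = v := rfl
  have fs : ∀ i : Fin 6, f i.succ = g i := fun i => rfl
  have hpq' := abs_le.1 hpq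
  have t1 := ten_nonneg (Kc c) f
  have t2 := ten_le (Kc c) f
  have t3 := ten_nonneg (optM (Kc c) (A v)) (Fin.cons none (some ∘ g) : Fin 7 → Option V)
  have t4 := ten_le (optM (Kc c) (A v)) (Fin.cons none (some ∘ g) : Fin 7 → Option V)
  by_cases hH : Hn A c v g = 0
  · have hz : ∀ i, A v (g i) = Kc c v (g i) := fun i =>
      Zn_zero _ _ _ _ ((Finset.sum_eq_zero_iff.1 hH) i (mem_univ _))
    have hz' : ∀ i, A v (f i) = Kc c v (f i) := by
      intro i; refine Fin.cases ?_ (fun i => hz i) i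
      rw [f0, h0, Kc_irr]
    have e1 : pull (fixA A c v) f = pull A f := by
      funext i j
      simp only [pull, fixA]
      split_ifs with h
      · rcases h with h | h
        · rw [h, hz']
        · rw [h, Kc_symm, hs, hz']
      · rfl
    have e2 : pull (optM (Kc c) (A v)) (Fin.cons none (some ∘ g) : Fin 7 → Option V) = pull (Kc c) f := by
      funext i j
      refine Fin.cases ?_ (fun i => ?_) i <;> refine Fin.cases ?_ (fun j => ?_) j
      · exact (Kc_irr c v).symm
      · exact hz j
      · exact (hz i).trans (Kc_symm _ _ _)
      · rfl
    have e3 : ten (optM (Kc c) (A v)) (Fin.cons none (some ∘ g) : Fin 7 → Option V) = ten (Kc c) f := by rw [ten, ten, e2]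
    have e4 : injten (fixA A c v) f = injten A f := by rw [injten, injten, ten, ten, e1]
    rw [e3, e4, hH]; simp
  · have hH1 : (1 : ℝ) ≤ Hn A c v g := by exact_mod_cast Nat.one_le_iff_ne_zero.2 hH
    by_cases hT : Tn A c v g = 0
    · rw [Tn, Nat.add_eq_zero_iff] at hT
      obtain ⟨ha, hb⟩ := hT
      have h1 : ∀ j, g j ≠ v := fun j hj => by
        have := (Finset.sum_eq_zero_iff.1 ha) j (mem_univ _)
        rw [if_pos hj] at this; exact one_ne_zero this
      have h2 : ∀ j k, j ≠ k → g j ≠ g k ∧ Zn A c (g j) (g k) = 0 := by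
        intro j k hjk
        have := (Finset.sum_eq_zero_iff.1 ((Finset.sum_eq_zero_iff.1 hb) j (mem_univ _))) k (Finset.mem_erase.2 ⟨hjk.symm, mem_univ _⟩)
        rw [Qn, Nat.add_eq_zero_iff] at this
        refine ⟨fun h => ?_, this.2⟩
        rw [if_pos h] at this; exact one_ne_zero this.1
      have h3 : ∀ j k, A (g j) (g k) = Kc c (g j) (g k) := by
        intro j k
        by_cases hjk : j = k
        · rw [hjk, h0, Kc_irr]
        · exact Zn_zero _ _ _ _ (h2 j k hjk).2
      have inj : Function.Injective f := by
        rw [hf, Fin.cons_injective_iff]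
        refine ⟨?_, ?_⟩
        · rintro ⟨j, hj⟩; exact h1 j hj
        · intro j k hjk
          by_contra h; exact (h2 j k h).1 hjk
      have e1 : pull (fixA A c v) f = pull (Kc c) f := by
        funext i j
        simp only [pull, fixA]
        split_ifs with h
        · rfl
        · push Not at h
          revert h
          refine Fin.cases ?_ (fun i => ?_) i
          · intro h; exact absurd rfl h.1
          · refine Fin.cases ?_ (fun j => ?_) j
            · intro h; exact absurd rfl h.2
            · intro _; exact h3 i j
      have e2 : pull (optM (Kc c) (A v)) (Fin.cons none (some ∘ g) : Fin 7 → Option V) = pull A f := by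
        funext i j
        refine Fin.cases ?_ (fun i => ?_) i <;> refine Fin.cases ?_ (fun j => ?_) j
        · exact (h0 v).symm
        · rfl
        · exact hs v (g i)
        · exact (h3 i j).symm
      have e3 : ten (optM (Kc c) (A v)) (Fin.cons none (some ∘ g) : Fin 7 → Option V) = ten A f := by rw [ten, ten, e2]
      have e4 : ten (fixA A c v) f = ten (Kc c) f := by rw [ten, ten, e1]
      rw [e3] at t3 t4
      rw [e3, injten, injten, if_pos inj, if_pos inj, e4]
      exact ptw_aux1 p q ε _ _ _ _ hp hε hpq t1 t2 t3 t4 hH1 (Nat.cast_nonneg _)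
    · have hB : (1 : ℝ) ≤ (Hn A c v g * Tn A c v g : ℕ) := by
        exact_mod_cast Nat.one_le_iff_ne_zero.2 (Nat.mul_ne_zero hH hT)
      have i1 : 0 ≤ injten (fixA A c v) f := by rw [injten]; split_ifs; exact ten_nonneg _ _; exact le_rfl
      have i2 : injten A f ≤ 1 := by rw [injten]; split_ifs; exact ten_le _ _; norm_num
      exact ptw_aux2 p q ε _ _ _ _ _ _ hp hq hε hpq'.1 t1 t2 t3 t4 i1 i2 hH1 hB
end step

set_option linter.unusedSectionVars false

section step2

variable {V : Type} [Fintype V]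

theorem EH (hV : 0 < Fintype.card V) (A : V → V → ℕ) (c : V → Bool) (v : V) :
    Ex (uni V) (fun g => (Hn A c v g : ℝ)) = 6 * ((wdeg A c v : ℝ) / Fintype.card V) := by
  have : (fun g : Fin 6 → V => (Hn A c v g : ℝ)) = fun g => ∑ i, (Zn A c v (g i) : ℝ) := by
    funext g; rw [Hn]; push_cast; rfl
  rw [this, Ex_sum]
  have : ∀ i : Fin 6, Ex (uni V) (fun g => (Zn A c v (g i) : ℝ)) = (wdeg A c v : ℝ) / Fintype.card V := by
    intro i
    rw [Ex_c1 (uni V) (uni_sum hV) i (fun x => (Zn A c v x : ℝ)), wdeg]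
    simp only [uni, ← Finset.mul_sum]
    push_cast; ring
  rw [Finset.sum_congr rfl (fun i _ => this i)]
  simp

theorem bad1 (hV : 0 < Fintype.card V) (A : V → V → ℕ) (h0 : ∀ i, A i i = 0) (c : V → Bool) (v : V) (i j : Fin 6) :
    Ex (uni V) (fun g => (Zn A c v (g i) : ℝ) * (if g j = v then 1 else 0 : ℝ)) ≤ (wdeg A c v : ℝ) / Fintype.card V * (1 / Fintype.card V) := by
  by_cases h : i = j
  · subst h
    rw [Ex_c1 (uni V) (uni_sum hV) i (fun x => (Zn A c v x : ℝ) * (if x = v then 1 else 0 : ℝ))]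
    have : ∀ x, (Zn A c v x : ℝ) * (if x = v then 1 else 0 : ℝ) = 0 := by
      intro x
      split_ifs with hx
      · rw [hx, Zn_irr A h0]; simp
      · simp
    simp only [this, mul_zero, Finset.sum_const_zero]
    positivity
  · rw [Ex_c2 (uni V) (uni_sum hV) i j h (fun x y => (Zn A c v x : ℝ) * (if y = v then 1 else 0 : ℝ))]
    simp only [uni, ← Finset.mul_sum]
    apply le_of_eq
    rw [wdeg]; push_cast
    simp; ring

theorem sumQ (A : V → V → ℕ) (c : V → Bool) (x : V) : ∑ y, (Qn A c x y : ℝ) = 1 + wdeg A c x := by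
  simp only [Qn, Nat.cast_add, Finset.sum_add_distrib, wdeg]
  push_cast; simp

theorem Qn_symm (A : V → V → ℕ) (hs : ∀ i j, A i j = A j i) (c : V → Bool) (x y : V) : Qn A c x y = Qn A c y x := by
  rw [Qn, Qn, Zn_symm A hs]; simp only [eq_comm]

theorem starQ (A : V → V → ℕ) (c : V → Bool) (v : V) (hmax : ∀ u, wdeg A c u ≤ wdeg A c v) (s : ℝ) (hs0 : 0 ≤ s) (hs2 : s * s = Wt A c) :
    ∑ x, (Zn A c v x : ℝ) * (1 + wdeg A c x) ≤ wdeg A c v * (1 + s) := by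
  have e : ∑ x, (Zn A c v x : ℝ) * (1 + wdeg A c x) = wdeg A c v + ∑ x, (Zn A c v x : ℝ) * wdeg A c x := by
    simp only [mul_add, Finset.sum_add_distrib, mul_one]
    congr 1
    rw [wdeg]; push_cast; rfl
  rw [e, mul_add, mul_one]
  have b1 : ∑ x, (Zn A c v x : ℝ) * wdeg A c x ≤ wdeg A c v * wdeg A c v := by
    have : (wdeg A c v : ℝ) * wdeg A c v = ∑ x, (Zn A c v x : ℝ) * wdeg A c v := by
      rw [← Finset.sum_mul]; congr 1; rw [wdeg]; push_cast; rfl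
    rw [this]
    exact Finset.sum_le_sum (fun x _ => mul_le_mul_of_nonneg_left (by exact_mod_cast hmax x) (Nat.cast_nonneg _))
  have b2 : ∑ x, (Zn A c v x : ℝ) * wdeg A c x ≤ s * s := by
    rw [hs2, Wt]; push_cast
    refine Finset.sum_le_sum (fun x _ => ?_)
    have : (Zn A c v x : ℝ) ≤ 1 := by exact_mod_cast Zn_le A c v x
    nlinarith [Nat.cast_nonneg (α := ℝ) (wdeg A c x)]
  have hw : (0 : ℝ) ≤ wdeg A c v := Nat.cast_nonneg _
  rcases le_total (wdeg A c v : ℝ) s with h | h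
  · nlinarith
  · nlinarith

theorem bad2 (hV : 0 < Fintype.card V) (A : V → V → ℕ) (hs : ∀ i j, A i j = A j i) (c : V → Bool) (v : V)
    (hmax : ∀ u, wdeg A c u ≤ wdeg A c v) (s : ℝ) (hs0 : 0 ≤ s) (hs2 : s * s = Wt A c) (i j k : Fin 6) (hjk : j ≠ k) :
    Ex (uni V) (fun g => (Zn A c v (g i) : ℝ) * (Qn A c (g j) (g k) : ℝ)) ≤
      (wdeg A c v : ℝ) / Fintype.card V * ((2 + s) / Fintype.card V + Wt A c / (Fintype.card V) ^ 2) := by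
  have hN : (0 : ℝ) < Fintype.card V := by exact_mod_cast hV
  have star : ∀ j k : Fin 6, j ≠ k → Ex (uni V) (fun g => (Zn A c v (g j) : ℝ) * (Qn A c (g j) (g k) : ℝ)) ≤
      (wdeg A c v : ℝ) / Fintype.card V * ((2 + s) / Fintype.card V + Wt A c / (Fintype.card V) ^ 2) := by
    intro j k hjk
    rw [Ex_c2 (uni V) (uni_sum hV) j k hjk (fun x y => (Zn A c v x : ℝ) * (Qn A c x y : ℝ))]
    simp only [uni, ← Finset.mul_sum, sumQ]
    have e := starQ A c v hmax s hs0 hs2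
    calc 1 / (Fintype.card V : ℝ) * (1 / (Fintype.card V : ℝ) * ∑ x, (Zn A c v x : ℝ) * (1 + wdeg A c x))
        ≤ 1 / (Fintype.card V : ℝ) * (1 / (Fintype.card V : ℝ) * (wdeg A c v * (1 + s))) := by gcongr
      _ = (wdeg A c v : ℝ) / Fintype.card V * ((1 + s) / Fintype.card V) := by ring
      _ ≤ _ := by
        refine mul_le_mul_of_nonneg_left ?_ (by positivity)
        have : (1 + s) / (Fintype.card V : ℝ) ≤ (2 + s) / Fintype.card V := by gcongr; norm_num
        have : (0 : ℝ) ≤ Wt A c / (Fintype.card V : ℝ) ^ 2 := by positivity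
        linarith
  by_cases hij : i = j
  · subst hij; exact star i k hjk
  by_cases hik : i = k
  · subst hik
    have := star i j hij
    refine le_trans (le_of_eq ?_) this
    refine congrArg (Ex (uni V)) (funext fun g => ?_)
    rw [Qn_symm A hs]
  rw [Ex_c3 (uni V) (uni_sum hV) i j k hij hik hjk (fun x y z => (Zn A c v x : ℝ) * (Qn A c y z : ℝ))]
  simp only [uni, ← Finset.mul_sum, sumQ]
  have : ∑ y : V, ((1 : ℝ) + wdeg A c y) = Fintype.card V + Wt A c := by
    rw [Finset.sum_add_distrib, Wt]; push_cast; simp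
  rw [this, ← Finset.sum_mul]
  have : ∑ x, (Zn A c v x : ℝ) = wdeg A c v := by rw [wdeg]; push_cast; rfl
  rw [this]
  have : 1 / (Fintype.card V : ℝ) * (1 / (Fintype.card V : ℝ) * (1 / (Fintype.card V : ℝ) * (wdeg A c v * (Fintype.card V + Wt A c)))) =
    (wdeg A c v : ℝ) / Fintype.card V * (1 / Fintype.card V + Wt A c / (Fintype.card V : ℝ) ^ 2) := by
    field_simp
  refine le_trans (le_of_eq ?_) (le_trans (le_of_eq this) ?_)
  · simp only [Finset.mul_sum, mul_add, Finset.sum_add_distrib]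
  · refine mul_le_mul_of_nonneg_left ?_ (by positivity)
    have : 1 / (Fintype.card V : ℝ) ≤ (2 + s) / Fintype.card V := by gcongr; linarith
    linarith

theorem Ebad (hV : 0 < Fintype.card V) (A : V → V → ℕ) (hs : ∀ i j, A i j = A j i) (h0 : ∀ i, A i i = 0) (c : V → Bool) (v : V)
    (hmax : ∀ u, wdeg A c u ≤ wdeg A c v) (s : ℝ) (hs0 : 0 ≤ s) (hs2 : s * s = Wt A c) :
    Ex (uni V) (fun g => ((Hn A c v g * Tn A c v g : ℕ) : ℝ)) ≤
      216 * ((wdeg A c v : ℝ) / Fintype.card V * ((2 + s) / Fintype.card V + Wt A c / (Fintype.card V) ^ 2)) := by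
  have hN : (0 : ℝ) < Fintype.card V := by exact_mod_cast hV
  set R := (wdeg A c v : ℝ) / Fintype.card V * ((2 + s) / Fintype.card V + Wt A c / (Fintype.card V) ^ 2) with hR
  have e : (fun g : Fin 6 → V => ((Hn A c v g * Tn A c v g : ℕ) : ℝ)) = fun g => ∑ i : Fin 6,
    ((∑ j, (Zn A c v (g i) : ℝ) * (if g j = v then 1 else 0 : ℝ)) + ∑ j, ∑ k ∈ univ.erase j, (Zn A c v (g i) : ℝ) * (Qn A c (g j) (g k) : ℝ)) := by
    funext g
    rw [Hn, Tn]; push_cast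
    rw [Finset.sum_mul]
    simp only [mul_add, Finset.mul_sum]
  rw [e, Ex_sum]
  have hi : ∀ i : Fin 6, Ex (uni V) (fun g : Fin 6 → V => (∑ j, (Zn A c v (g i) : ℝ) * (if g j = v then 1 else 0 : ℝ)) + ∑ j, ∑ k ∈ univ.erase j, (Zn A c v (g i) : ℝ) * (Qn A c (g j) (g k) : ℝ)) ≤ 36 * R := by
    intro i
    rw [Ex_add, Ex_sum, Ex_sum]
    have a1 : ∀ j : Fin 6, Ex (uni V) (fun g => (Zn A c v (g i) : ℝ) * (if g j = v then 1 else 0 : ℝ)) ≤ R := by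
      intro j
      refine (bad1 hV A h0 c v i j).trans ?_
      refine mul_le_mul_of_nonneg_left ?_ (by positivity)
      have : 1 / (Fintype.card V : ℝ) ≤ (2 + s) / Fintype.card V := by gcongr; linarith
      have : (0 : ℝ) ≤ Wt A c / (Fintype.card V : ℝ) ^ 2 := by positivity
      linarith
    have a2 : ∀ j : Fin 6, Ex (uni V) (fun g => ∑ k ∈ univ.erase j, (Zn A c v (g i) : ℝ) * (Qn A c (g j) (g k) : ℝ)) ≤ 5 * R := by
      intro j
      rw [Ex_sum]
      have hc : (univ.erase j).card = 5 := by rw [Finset.card_erase_of_mem (mem_univ _)]; rfl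
      calc _ ≤ ∑ k ∈ univ.erase j, R := Finset.sum_le_sum (fun k hk => bad2 hV A hs c v hmax s hs0 hs2 i j k (Finset.ne_of_mem_erase hk).symm)
        _ = 5 * R := by rw [Finset.sum_const, hc]; simp
    have b1 : ∑ j : Fin 6, Ex (uni V) (fun g => (Zn A c v (g i) : ℝ) * (if g j = v then 1 else 0 : ℝ)) ≤ ∑ j : Fin 6, R :=
      Finset.sum_le_sum (fun j _ => a1 j)
    have b2 : ∑ j : Fin 6, Ex (uni V) (fun g => ∑ k ∈ univ.erase j, (Zn A c v (g i) : ℝ) * (Qn A c (g j) (g k) : ℝ)) ≤ ∑ j : Fin 6, 5 * R :=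
      Finset.sum_le_sum (fun j _ => a2 j)
    simp only [Finset.sum_const, Finset.card_univ, Fintype.card_fin, nsmul_eq_mul] at b1 b2
    push_cast at b1 b2
    linarith
  calc _ ≤ ∑ i : Fin 6, 36 * R := Finset.sum_le_sum (fun i _ => hi i)
    _ = 216 * R := by simp; ring

theorem prod_near (x : Fin 6 → ℝ) (p ε : ℝ) (hp : 0 ≤ p) (hε : 0 ≤ ε) (hε1 : ε ≤ 1 / 10)
    (hx : ∀ i, (1 - ε) * p ≤ x i ∧ x i ≤ (1 + ε) * p) : |∏ _i : Fin 6, p - ∏ i, x i| ≤ 12 * ε * ∏ _i : Fin 6, p := by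
  have l : ∏ _i : Fin 6, ((1 - ε) * p) ≤ ∏ i, x i :=
    Finset.prod_le_prod (fun i _ => mul_nonneg (by linarith) hp) (fun i _ => (hx i).1)
  have u : ∏ i, x i ≤ ∏ _i : Fin 6, ((1 + ε) * p) :=
    Finset.prod_le_prod (fun i _ => (mul_nonneg (by linarith) hp).trans (hx i).1) (fun i _ => (hx i).2)
  simp only [Finset.prod_const, Finset.card_univ, Fintype.card_fin, mul_pow] at l u ⊢
  have hp6 : 0 ≤ p ^ 6 := by positivity
  have a1 : 1 - 12 * ε ≤ (1 - ε) ^ 6 := by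
    have := one_add_mul_le_pow (a := -ε) (by linarith) 6
    have e : 1 + -ε = 1 - ε := by ring
    rw [e] at this; push_cast at this; linarith
  have a2 : (1 + ε) ^ 6 ≤ 1 + 12 * ε := by
    have q1 : (1 + ε) ^ 2 ≤ 1 + 21 / 10 * ε := by nlinarith
    have q2 : (1 + ε) ^ 4 ≤ 1 + 5 * ε := by
      have : (1 + ε) ^ 4 = ((1 + ε) ^ 2) ^ 2 := by ring
      rw [this]; nlinarith [sq_nonneg (1 + ε)]
    have : (1 + ε) ^ 6 = (1 + ε) ^ 4 * (1 + ε) ^ 2 := by ring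
    rw [this]
    calc (1 + ε) ^ 4 * (1 + ε) ^ 2 ≤ (1 + 5 * ε) * (1 + 21 / 10 * ε) := by gcongr
      _ ≤ _ := by nlinarith
  rw [abs_le]
  constructor <;> nlinarith

theorem parity_aux : ∀ x y z : Bool, ∀ a b : Fin 2,
    (((a : ℕ) + b + KB y z) % 2) + 2 * ((if (a : ℕ) = KB x y then 0 else 1) * (if (b : ℕ) = KB x z then 0 else 1)) =
      (if (a : ℕ) = KB x y then 0 else 1) + (if (b : ℕ) = KB x z then 0 else 1) := by decide

theorem parity_Z (A : V → V → ℕ) (hA : ∀ i j, A i j ≤ 1) (c : V → Bool) (v u w : V) :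
    (((A v u + A v w + Kc c u w) % 2 : ℕ) : ℝ) = Zn A c v u + Zn A c v w - 2 * (Zn A c v u * Zn A c v w) := by
  have h := parity_aux (c v) (c u) (c w) ⟨A v u, Nat.lt_succ_of_le (hA v u)⟩ ⟨A v w, Nat.lt_succ_of_le (hA v w)⟩
  have h' : (A v u + A v w + Kc c u w) % 2 + 2 * (Zn A c v u * Zn A c v w) = Zn A c v u + Zn A c v w := by
    simp only [Zn, Kc]; exact h
  have h'' : (((A v u + A v w + Kc c u w) % 2 : ℕ) : ℝ) + 2 * (Zn A c v u * Zn A c v w) = Zn A c v u + Zn A c v w := by exact_mod_cast h'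
  linarith

theorem bval (A : V → V → ℕ) (hA : ∀ i j, A i j ≤ 1) (c : V → Bool) (v : V) (ν : V → ℝ) (h1 : ∑ u, ν u = 1) (t : ℝ)
    (ht : t = ∑ u, ν u * Zn A c v u) :
    ∑ u, ν u * ∑ w, ν w * (((A v u + A v w + Kc c u w) % 2 : ℕ) : ℝ) = 2 * t * (1 - t) := by
  simp only [parity_Z A hA c]
  have : ∀ u, ∑ w, ν w * ((Zn A c v u : ℝ) + Zn A c v w - 2 * (Zn A c v u * Zn A c v w)) = Zn A c v u * (1 - 2 * t) + t := by
    intro u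
    have : ∀ w, ν w * ((Zn A c v u : ℝ) + Zn A c v w - 2 * (Zn A c v u * Zn A c v w)) =
       Zn A c v u * ν w + (1 - 2 * Zn A c v u) * (ν w * Zn A c v w) := fun w => by ring
    rw [Finset.sum_congr rfl (fun w _ => this w), Finset.sum_add_distrib, ← Finset.mul_sum, ← Finset.mul_sum, h1, ← ht]
    ring
  simp only [this]
  have : ∀ u, ν u * ((Zn A c v u : ℝ) * (1 - 2 * t) + t) = (1 - 2 * t) * (ν u * Zn A c v u) + t * ν u := fun u => by ring
  rw [Finset.sum_congr rfl (fun u _ => this u), Finset.sum_add_distrib, ← Finset.mul_sum, ← Finset.mul_sum, h1, ← ht]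
  ring

theorem Ex_sub (μ : V → ℝ) {ι : Type} [Fintype ι] (φ ψ : (ι → V) → ℝ) :
    Ex μ (fun f => φ f - ψ f) = Ex μ φ - Ex μ ψ := by
  simp only [Ex, mul_sub, Finset.sum_sub_distrib]

theorem main_step (hV : 0 < Fintype.card V) (A : V → V → ℕ) (hs : ∀ i j, A i j = A j i) (h0 : ∀ i, A i i = 0) (hA : ∀ i j, A i j ≤ 1)
    (c : V → Bool) (v : V) (hmax : ∀ u, wdeg A c u ≤ wdeg A c v) (hhalf : 2 * (wdeg A c v : ℝ) ≤ Fintype.card V)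
    (s : ℝ) (hs0 : 0 ≤ s) (hs2 : s * s = Wt A c) (ν : V → ℝ) (hν1 : ∑ u, ν u = 1) (hm : mass ν c true = 1 / 3 ∨ mass ν c true = 2 / 3)
    (ε : ℝ) (hε : 0 ≤ ε) (hε1 : ε ≤ 1 / 10) (hν : ∀ u, (1 - ε) * (1 / (Fintype.card V : ℝ)) ≤ ν u ∧ ν u ≤ (1 + ε) * (1 / (Fintype.card V : ℝ))) :
    7 / (Fintype.card V : ℝ) * ((wdeg A c v : ℝ) / Fintype.card V * (100 / 8427240 / 14 - 72 * ε -
       432 * ((2 + s) / Fintype.card V + Wt A c / (Fintype.card V) ^ 2))) ≤ lamI (fixA A c v) - lamI A := by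
  have hN : (0 : ℝ) < Fintype.card V := by exact_mod_cast hV
  rw [lamI_diff A (fixA A c v) v (fun u w hu hw => by rw [fixA, if_neg (by simp [hu, hw])])]
  refine mul_le_mul_of_nonneg_left ?_ (by positivity)
  have hν0 : ∀ u, 0 ≤ ν u := fun u => le_trans (by have : 0 ≤ 1 - ε := by linarith
                                                   positivity) (hν u).1
  -- loss in the weighted count
  have root := rooted ν hν0 hν1 (Kc c) (Kc_symm c) (Kc_irr c) (Kc_le c) (A v) (hA v) (K7_exact ν hν1 c hm)
  rw [bval A hA c v ν hν1 _ rfl] at root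
  set t := ∑ u, ν u * (Zn A c v u : ℝ) with ht
  have k6 := K6_exact ν hν1 c hm v
  set F := Ex ν (fun g : Fin 6 → V => ten (optM (Kc c) (A v)) (Fin.cons none (some ∘ g))) with hF
  set x := (wdeg A c v : ℝ) / Fintype.card V with hx
  have hx0 : 0 ≤ x := by positivity
  have hx1 : x ≤ 1 / 2 := by rw [hx, div_le_iff₀ hN]; linarith
  have tx : ∀ a : ℝ, ∑ u, (a * (1 / (Fintype.card V : ℝ))) * (Zn A c v u : ℝ) = a * x := by
    intro a; rw [← Finset.mul_sum, hx, wdeg]; push_cast; ring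
  have tl : (1 - ε) * x ≤ t := by
    rw [← tx]; exact Finset.sum_le_sum (fun u _ => mul_le_mul_of_nonneg_right (hν u).1 (Nat.cast_nonneg _))
  have tu : t ≤ (1 + ε) * x := by
    rw [← tx]; exact Finset.sum_le_sum (fun u _ => mul_le_mul_of_nonneg_right (hν u).2 (Nat.cast_nonneg _))
  have t1 : 9 / 10 * x ≤ t := by nlinarith
  have t2 : t ≤ 55 / 100 := by nlinarith
  have bl : x / 2 ≤ 2 * t * (1 - t) := by nlinarith
  have loss : 100 / 8427240 / 14 * x ≤ 28 / 81 - F := by linarith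
  -- comparison
  have cmp : Ex ν (fun g : Fin 6 → V => ten (Kc c) (Fin.cons v g) - ten (optM (Kc c) (A v)) (Fin.cons none (some ∘ g))) -
      Ex (uni V) (fun g : Fin 6 → V => 12 * ε * Hn A c v g + 2 * ((Hn A c v g * Tn A c v g : ℕ) : ℝ)) ≤
      Ex (uni V) (fun g : Fin 6 → V => injten (fixA A c v) (Fin.cons v g) - injten A (Fin.cons v g)) := by
    simp only [Ex]
    rw [← Finset.sum_sub_distrib]
    refine Finset.sum_le_sum (fun g _ => ?_)
    refine ptw A hs h0 c v g _ _ (12 * ε) (Finset.prod_nonneg (fun i _ => uni_nonneg _)) (Finset.prod_nonneg (fun i _ => hν0 _)) ?_ (by linarith)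
    exact prod_near (fun i => ν (g i)) (1 / (Fintype.card V : ℝ)) ε (by positivity) hε hε1 (fun i => hν (g i))
  rw [Ex_sub, k6, ← hF, Ex_add, Ex_smul, Ex_smul, EH hV] at cmp
  have eb := Ebad hV A hs h0 c v hmax s hs0 hs2
  rw [← hx] at eb cmp
  refine le_trans ?_ cmp
  nlinarith
end step2

set_option linter.unusedSectionVars false

section indu

variable {V : Type} [Fintype V]

noncomputable def Wr (A : V → V → ℕ) (c : V → Bool) (v : V) : ℕ := ∑ u, ∑ w, if u = v ∨ w = v then 0 else Zn A c u w

theorem Wt_split (A : V → V → ℕ) (hs : ∀ i j, A i j = A j i) (h0 : ∀ i, A i i = 0) (c : V → Bool) (v : V) :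
    Wt A c = 2 * wdeg A c v + Wr A c v := by
  have e : ∀ u w, Zn A c u w = (if u = v then Zn A c v w else 0) + (if w = v then Zn A c v u else 0) +
      (if u = v ∨ w = v then 0 else Zn A c u w) := by
    intro u w
    by_cases hu : u = v <;> by_cases hw : w = v
    · subst hu; subst hw; simp [Zn_irr A h0]
    · subst hu; simp [hw]
    · subst hw; simp [hu, Zn_symm A hs c u]
    · simp [hu, hw]
  have : Wt A c = ∑ u, ∑ w, ((if u = v then Zn A c v w else 0) + (if w = v then Zn A c v u else 0) +
      (if u = v ∨ w = v then 0 else Zn A c u w)) := by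
    rw [Wt]
    refine Finset.sum_congr rfl (fun u _ => ?_)
    rw [wdeg]
    exact Finset.sum_congr rfl (fun w _ => e u w)
  rw [this]
  simp only [Finset.sum_add_distrib]
  rw [← Wr]
  have a : ∑ u, ∑ w, (if u = v then Zn A c v w else 0) = wdeg A c v := by
    rw [Finset.sum_eq_single v]
    · simp [wdeg]
    · intro b _ hb; simp [hb]
    · intro h; exact absurd (mem_univ _) h
  have b : ∑ u, ∑ w, (if w = v then Zn A c v u else 0) = wdeg A c v := by
    simp [wdeg]
  rw [a, b]; ring

theorem Zn_fix (A : V → V → ℕ) (c : V → Bool) (v u w : V) :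
    Zn (fixA A c v) c u w = if u = v ∨ w = v then 0 else Zn A c u w := by
  rw [Zn, fixA]
  split_ifs with h1 h2 h3 <;> simp_all [Zn]

theorem Wt_fix (A : V → V → ℕ) (c : V → Bool) (v : V) : Wt (fixA A c v) c = Wr A c v := by
  simp only [Wt, wdeg, Wr, Zn_fix]

theorem wdeg_fix (A : V → V → ℕ) (c : V → Bool) (v u : V) : wdeg (fixA A c v) c u ≤ wdeg A c u := by
  simp only [wdeg, Zn_fix]
  refine Finset.sum_le_sum (fun w _ => ?_)
  split_ifs
  · exact Nat.zero_le _
  · exact le_rfl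

theorem induct (hV : 0 < Fintype.card V) (c : V → Bool) (ν : V → ℝ) (hν1 : ∑ u, ν u = 1)
    (hm : mass ν c true = 1 / 3 ∨ mass ν c true = 2 / 3)
    (ε : ℝ) (hε : 0 ≤ ε) (hε1 : 72 * ε ≤ 100 / 8427240 / 56)
    (hν : ∀ u, (1 - ε) * (1 / (Fintype.card V : ℝ)) ≤ ν u ∧ ν u ≤ (1 + ε) * (1 / (Fintype.card V : ℝ)))
    (M : ℝ) (hM : 432 * ((2 + √M) / Fintype.card V + M / (Fintype.card V) ^ 2) ≤ 100 / 8427240 / 56) (k : ℕ) :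
    ∀ A : V → V → ℕ, (∀ i j, A i j = A j i) → (∀ i, A i i = 0) → (∀ i j, A i j ≤ 1) →
      (∀ v, 2 * wdeg A c v ≤ Fintype.card V) → Wt A c = k → (k : ℝ) ≤ M →
      100 / 8427240 / 8 * k / (Fintype.card V : ℝ) ^ 2 ≤ lamI (Kc c) - lamI A := by
  have hN : (0 : ℝ) < Fintype.card V := by exact_mod_cast hV
  induction k using Nat.strong_induction_on with
  | _ k ih =>
  intro A hs h0 hA hh hk hkM
  rcases Nat.eq_zero_or_pos k with hk0 | hkp
  · subst hk0
    have : A = Kc c := by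
      funext u w
      refine Zn_zero A c u w ?_
      have h1 := (Finset.sum_eq_zero_iff.1 hk) u (mem_univ _)
      exact (Finset.sum_eq_zero_iff.1 h1) w (mem_univ _)
    rw [this]; simp
  · have : Nonempty V := Fintype.card_pos_iff.1 hV
    obtain ⟨v, _, hv⟩ := Finset.exists_max_image (univ : Finset V) (fun u => wdeg A c u) Finset.univ_nonempty
    have hmax : ∀ u, wdeg A c u ≤ wdeg A c v := fun u => hv u (mem_univ _)
    have hw : 0 < wdeg A c v := by
      by_contra h
      have h' : wdeg A c v = 0 := by omega
      have : Wt A c = 0 := Finset.sum_eq_zero (fun u _ => by have := hmax u; omega)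
      omega
    have sp := Wt_split A hs h0 c v
    rw [← Wt_fix] at sp
    have st := main_step hV A hs h0 hA c v hmax (by exact_mod_cast hh v) (√(Wt A c)) (Real.sqrt_nonneg _)
      (Real.mul_self_sqrt (Nat.cast_nonneg _)) ν hν1 hm ε hε (by linarith) hν
    have r := ih (Wt (fixA A c v) c) (by omega) (fixA A c v)
      (fun i j => by simp only [fixA, or_comm, hs i j, Kc_symm c i j])
      (fun i => by simp only [fixA]; split_ifs; exact Kc_irr c i; exact h0 i)
      (fun i j => by simp only [fixA]; split_ifs; exact Kc_le c i j; exact hA i j)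
      (fun u => by have := wdeg_fix A c v u; have := hh u; omega) rfl
      (le_trans (by exact_mod_cast (by omega : Wt (fixA A c v) c ≤ k)) hkM)
    have mono : 432 * ((2 + √(Wt A c)) / Fintype.card V + Wt A c / (Fintype.card V : ℝ) ^ 2) ≤ 432 * ((2 + √M) / Fintype.card V + M / (Fintype.card V) ^ 2) := by
      rw [hk]; gcongr
    have b : 7 / (Fintype.card V : ℝ) * ((wdeg A c v : ℝ) / Fintype.card V * (100 / 8427240 / 28)) ≤ lamI (fixA A c v) - lamI A := by
      refine le_trans ?_ st
      gcongr
      linarith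
    have hkk : (k : ℝ) = 2 * wdeg A c v + Wt (fixA A c v) c := by rw [← hk]; exact_mod_cast sp
    have e : 100 / 8427240 / 8 * (k : ℝ) / (Fintype.card V : ℝ) ^ 2 =
      7 / (Fintype.card V : ℝ) * ((wdeg A c v : ℝ) / Fintype.card V * (100 / 8427240 / 28)) + 100 / 8427240 / 8 * (Wt (fixA A c v) c : ℝ) / (Fintype.card V : ℝ) ^ 2 := by
      rw [hkk]; field_simp; ring
    linarith

theorem flip_aux : ∀ x y : Bool, ∀ a : Fin 2, (if (a : ℕ) = KB (!x) y then 0 else 1) + (if (a : ℕ) = KB x y then 0 else 1) = 1 := by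
  decide

theorem odd_aux : ∀ a b d : Fin 2, (if (d : ℕ) = KB (decide ((a : ℕ) = 1)) (decide ((b : ℕ) = 1)) then 0 else 1) = ((a : ℕ) + b + d) % 2 := by
  decide

theorem color (hV : 0 < Fintype.card V) (A : V → V → ℕ) (hs : ∀ i j, A i j = A j i) (h0 : ∀ i, A i i = 0) (hA : ∀ i j, A i j ≤ 1) :
    ∃ c : V → Bool, (∀ v, 2 * wdeg A c v ≤ Fintype.card V) ∧
      (Wt A c : ℝ) ≤ (Fintype.card V : ℝ) ^ 2 * Ex (uni V) (fun g : Fin 3 → V => (odd3 A (g 0) (g 1) (g 2) : ℝ)) := by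
  have hN : (0 : ℝ) < Fintype.card V := by exact_mod_cast hV
  obtain ⟨c, _, hc⟩ := Finset.exists_min_image (univ : Finset (V → Bool)) (fun c => Wt A c) Finset.univ_nonempty
  refine ⟨c, fun v => ?_, ?_⟩
  · set c' := Function.update c v (!c v) with hc'
    have h := hc c' (mem_univ _)
    rw [Wt_split A hs h0 c v, Wt_split A hs h0 c' v] at h
    have e1 : Wr A c' v = Wr A c v := by
      simp only [Wr]
      refine Finset.sum_congr rfl (fun u _ => Finset.sum_congr rfl (fun w _ => ?_))
      split_ifs with hh
      · rfl
      · push Not at hh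
        have a1 : c' u = c u := Function.update_of_ne hh.1 _ _
        have a2 : c' w = c w := Function.update_of_ne hh.2 _ _
        rw [Zn, Zn, Kc, Kc, a1, a2]
    have e2 : wdeg A c' v + wdeg A c v ≤ Fintype.card V := by
      rw [wdeg, wdeg, ← Finset.sum_add_distrib]
      calc _ ≤ ∑ _w : V, 1 := by
            refine Finset.sum_le_sum (fun w _ => ?_)
            by_cases hw : w = v
            · subst hw; simp [Zn_irr A h0]
            · have := flip_aux (c v) (c w) ⟨A v w, Nat.lt_succ_of_le (hA v w)⟩
              have a1 : c' w = c w := Function.update_of_ne hw _ _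
              have a2 : c' v = !c v := Function.update_self _ _ _
              rw [Zn, Zn, Kc, Kc, a1, a2]
              exact this.le
        _ = _ := by simp
    omega
  · have e : Ex (uni V) (fun g : Fin 3 → V => (odd3 A (g 0) (g 1) (g 2) : ℝ)) =
        1 / (Fintype.card V : ℝ) ^ 3 * ∑ v, (Wt A (fun u => decide (A v u = 1)) : ℝ) := by
      rw [Ex_c3 (uni V) (uni_sum hV) (0 : Fin 3) 1 2 (by decide) (by decide) (by decide) (fun x y z => (odd3 A x y z : ℝ))]
      simp only [uni, ← Finset.mul_sum]
      rw [← mul_assoc, ← mul_assoc]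
      congr 1
      · ring
      · refine Finset.sum_congr rfl (fun v _ => ?_)
        simp only [Wt, wdeg]; push_cast
        refine Finset.sum_congr rfl (fun u _ => Finset.sum_congr rfl (fun w _ => ?_))
        have := odd_aux ⟨A v u, Nat.lt_succ_of_le (hA v u)⟩ ⟨A v w, Nat.lt_succ_of_le (hA v w)⟩ ⟨A u w, Nat.lt_succ_of_le (hA u w)⟩
        simp only [odd3, Zn, Kc]
        exact_mod_cast this.symm
    have l : (Fintype.card V : ℝ) * Wt A c ≤ ∑ v, (Wt A (fun u => decide (A v u = 1)) : ℝ) := by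
      have : (Fintype.card V : ℝ) * Wt A c = ∑ _v : V, (Wt A c : ℝ) := by simp
      rw [this]
      exact Finset.sum_le_sum (fun v _ => by exact_mod_cast hc _ (mem_univ _))
    rw [e]
    calc (Wt A c : ℝ) = 1 / Fintype.card V * ((Fintype.card V : ℝ) * Wt A c) := by field_simp
      _ ≤ 1 / Fintype.card V * ∑ v, (Wt A (fun u => decide (A v u = 1)) : ℝ) := by gcongr
      _ = _ := by field_simp
end indu

set_option linter.unusedSectionVars false

section approx

variable {V : Type} [Fintype V]

theorem injten_nonneg (A : V → V → ℕ) (f) : 0 ≤ injten A f := by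
  rw [injten]; split_ifs; exact ten_nonneg _ _; exact le_rfl

theorem lamI_nonneg (A : V → V → ℕ) : 0 ≤ lamI A := Ex_nonneg _ uni_nonneg _ (injten_nonneg A)

theorem lamI_le (A : V → V → ℕ) : lamI A ≤ Ex (uni V) (ten A) :=
  Ex_mono _ uni_nonneg _ _ (fun f => by
    rw [injten]; split_ifs
    · exact le_rfl
    · exact ten_nonneg _ _)

theorem pair_bd (hV : 0 < Fintype.card V) (Q : V → V → ℝ) (R : ℝ) (hR : ∑ x, ∑ y, Q x y ≤ R * (Fintype.card V : ℝ) ^ 2) :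
    Ex (uni V) (fun f : Fin 7 → V => ∑ i, ∑ j ∈ univ.erase i, Q (f i) (f j)) ≤ 42 * R := by
  have hN : (0 : ℝ) < Fintype.card V := by exact_mod_cast hV
  rw [Ex_sum]
  have h : ∀ i : Fin 7, Ex (uni V) (fun f : Fin 7 → V => ∑ j ∈ univ.erase i, Q (f i) (f j)) ≤ 6 * R := by
    intro i
    rw [Ex_sum]
    have hc : (univ.erase i).card = 6 := by rw [Finset.card_erase_of_mem (mem_univ _)]; rfl
    calc _ ≤ ∑ j ∈ univ.erase i, R := Finset.sum_le_sum (fun j hj => by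
            rw [Ex_c2 (uni V) (uni_sum hV) i j (Finset.ne_of_mem_erase hj).symm Q]
            simp only [uni, ← Finset.mul_sum]
            calc _ ≤ 1 / (Fintype.card V : ℝ) * (1 / (Fintype.card V : ℝ) * (R * (Fintype.card V : ℝ) ^ 2)) := by gcongr
              _ = R := by field_simp)
      _ = 6 * R := by rw [Finset.sum_const, hc]; simp
  calc _ ≤ ∑ i : Fin 7, 6 * R := Finset.sum_le_sum (fun i _ => h i)
    _ = 42 * R := by simp; ring

theorem le_lamI (hV : 0 < Fintype.card V) (A : V → V → ℕ) : Ex (uni V) (ten A) ≤ lamI A + 42 * (1 / (Fintype.card V : ℝ)) := by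
  have hN : (0 : ℝ) < Fintype.card V := by exact_mod_cast hV
  have b := pair_bd hV (fun x y => if x = y then (1 : ℝ) else 0) (1 / (Fintype.card V : ℝ)) (by
    simp; field_simp; exact le_rfl)
  refine le_trans ?_ (add_le_add_right b (lamI A))
  rw [lamI, ← Ex_add]
  refine Ex_mono _ uni_nonneg _ _ (fun f => ?_)
  have nn : ∀ i, 0 ≤ ∑ j ∈ univ.erase i, (if f i = f j then (1 : ℝ) else 0) := fun i => Finset.sum_nonneg (fun j _ => by split_ifs <;> norm_num)
  by_cases hf : Function.Injective f
  · rw [injten, if_pos hf]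
    have : 0 ≤ ∑ i, ∑ j ∈ univ.erase i, (if f i = f j then (1 : ℝ) else 0) := Finset.sum_nonneg (fun i _ => nn i)
    linarith
  · rw [injten, if_neg hf]
    have : ∃ i j, f i = f j ∧ i ≠ j := by
      by_contra h
      push Not at h
      exact hf (fun i j hij => h i j hij)
    obtain ⟨i, j, hij, hne⟩ := this
    have h1 : (1 : ℝ) ≤ ∑ j ∈ univ.erase i, (if f i = f j then (1 : ℝ) else 0) := by
      have := Finset.single_le_sum (s := univ.erase i) (f := fun j => if f i = f j then (1 : ℝ) else 0)
        (fun j _ => by split_ifs <;> norm_num) (Finset.mem_erase.2 ⟨hne.symm, mem_univ j⟩)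
      simpa [hij] using this
    have h2 := Finset.single_le_sum (s := univ) (f := fun i => ∑ j ∈ univ.erase i, (if f i = f j then (1 : ℝ) else 0))
      (fun i _ => nn i) (mem_univ i)
    have := ten_le A f
    linarith

theorem ten_K (hV : 0 < Fintype.card V) (A : V → V → ℕ) (h0 : ∀ i, A i i = 0) (c : V → Bool) :
    Ex (uni V) (ten A) ≤ Ex (uni V) (ten (Kc c)) + 42 * (Wt A c / (Fintype.card V : ℝ) ^ 2) := by
  have hN : (0 : ℝ) < Fintype.card V := by exact_mod_cast hV
  have b := pair_bd hV (fun x y => (Zn A c x y : ℝ)) (Wt A c / (Fintype.card V : ℝ) ^ 2) (by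
    have : (Wt A c : ℝ) = ∑ x, ∑ y, (Zn A c x y : ℝ) := by simp only [Wt, wdeg]; push_cast; rfl
    rw [← this]; field_simp; exact le_rfl)
  refine le_trans ?_ (add_le_add_right b _)
  rw [← Ex_add]
  refine Ex_mono _ uni_nonneg _ _ (fun f => ?_)
  have nn : 0 ≤ ∑ i, ∑ j ∈ univ.erase i, (Zn A c (f i) (f j) : ℝ) := by positivity
  by_cases hz : ∑ i, ∑ j ∈ univ.erase i, Zn A c (f i) (f j) = 0
  · have : pull A f = pull (Kc c) f := by
      funext i j
      simp only [pull]
      by_cases hij : i = j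
      · rw [hij, h0, Kc_irr]
      · exact Zn_zero _ _ _ _ ((Finset.sum_eq_zero_iff.1 ((Finset.sum_eq_zero_iff.1 hz) i (mem_univ _))) j (Finset.mem_erase.2 ⟨Ne.symm hij, mem_univ _⟩))
    have : ten A f = ten (Kc c) f := by rw [ten, ten, this]
    linarith
  · have h1 : (1 : ℝ) ≤ ∑ i, ∑ j ∈ univ.erase i, (Zn A c (f i) (f j) : ℝ) := by exact_mod_cast Nat.one_le_iff_ne_zero.2 hz
    have := ten_le A f
    have := ten_nonneg (Kc c) f
    linarith

theorem mass_nonneg (ν : V → ℝ) (hν : ∀ v, 0 ≤ ν v) (c : V → Bool) (b : Bool) : 0 ≤ mass ν c b :=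
  Finset.sum_nonneg (fun u _ => by split_ifs; exact hν u; exact le_rfl)

theorem exists_nu (hV : 0 < Fintype.card V) (c : V → Bool) (p δ : ℝ) (hp : p = 1 / 3 ∨ p = 2 / 3) (hδ : δ ≤ 1 / 12)
    (hx : |mass (uni V) c true - p| ≤ δ) : ∃ ν : V → ℝ, ∑ u, ν u = 1 ∧ mass ν c true = p ∧
      ∀ u, (1 - 4 * δ) * (1 / (Fintype.card V : ℝ)) ≤ ν u ∧ ν u ≤ (1 + 4 * δ) * (1 / (Fintype.card V : ℝ)) := by
  have hN : (0 : ℝ) < Fintype.card V := by exact_mod_cast hV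
  set x := mass (uni V) c true with hxd
  have hf : mass (uni V) c false = 1 - x := by
    have := mass_add (uni V) c; rw [uni_sum hV] at this; linarith
  obtain ⟨l, u⟩ := abs_le.1 hx
  have hx1 : 1 / 4 ≤ x := by rcases hp with rfl | rfl <;> linarith
  have hx2 : x ≤ 3 / 4 := by rcases hp with rfl | rfl <;> linarith
  have x0 : 0 < x := by linarith
  have x1 : 0 < 1 - x := by linarith
  set ν : V → ℝ := fun u => if c u = true then p / x * uni V u else (1 - p) / (1 - x) * uni V u with hν
  have mt : mass ν c true = p := by
    have : mass ν c true = p / x * mass (uni V) c true := by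
      rw [mass, mass, Finset.mul_sum]
      refine Finset.sum_congr rfl (fun u _ => ?_)
      by_cases h : c u = true <;> simp [hν, h]
    rw [this, ← hxd]; field_simp
  have mf : mass ν c false = 1 - p := by
    have : mass ν c false = (1 - p) / (1 - x) * mass (uni V) c false := by
      rw [mass, mass, Finset.mul_sum]
      refine Finset.sum_congr rfl (fun u _ => ?_)
      by_cases h : c u = true <;> simp [hν, h]
    rw [this, hf]; field_simp
  refine ⟨ν, ?_, mt, fun w => ?_⟩
  · rw [← mass_add ν c, mt, mf]; ring
  · have hN' : 0 ≤ 1 / (Fintype.card V : ℝ) := by positivity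
    have d0 : 0 ≤ δ := (abs_nonneg _).trans hx
    by_cases h : c w = true
    · simp only [hν, if_pos h, uni]
      constructor
      · refine mul_le_mul_of_nonneg_right ?_ hN'
        rw [le_div_iff₀ x0]; nlinarith
      · refine mul_le_mul_of_nonneg_right ?_ hN'
        rw [div_le_iff₀ x0]; nlinarith
    · simp only [hν, if_neg h, uni]
      constructor
      · refine mul_le_mul_of_nonneg_right ?_ hN'
        rw [le_div_iff₀ x1]; nlinarith
      · refine mul_le_mul_of_nonneg_right ?_ hN'
        rw [div_le_iff₀ x1]; nlinarith

theorem star_color (n : ℕ) (hn : 0 < n) : ∃ d : Fin n → Bool, 28 / 81 - 105 / (n : ℝ) ≤ lamI (Kc d) := by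
  have hV : 0 < Fintype.card (Fin n) := by simpa using hn
  have hN : (0 : ℝ) < n := by exact_mod_cast hn
  have hN1 : (1 : ℝ) ≤ n := by exact_mod_cast hn
  refine ⟨fun u => decide (u.val < n / 3), ?_⟩
  set d : Fin n → Bool := fun u => decide (u.val < n / 3) with hd
  have hm : mass (uni (Fin n)) d true = ((n / 3 : ℕ) : ℝ) / n := by
    have hc : ((univ : Finset (Fin n)).filter (fun u => d u = true)).card = n / 3 := by
      simp only [hd, decide_eq_true_eq]
      have : n / 3 ≤ n := Nat.div_le_self _ _
      rw [Fin.card_filter_val_lt]; omega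
    rw [mass, ← Finset.sum_filter]
    simp only [uni, Finset.sum_const, hc, Fintype.card_fin, nsmul_eq_mul]
    ring
  have b := le_lamI hV (Kc d)
  rw [K7_formula (uni (Fin n)) (uni_sum hV) d _ rfl, Fintype.card_fin] at b
  set x := mass (uni (Fin n)) d true with hx
  have x1 : x ≤ 1 / 3 := by
    rw [hm, div_le_iff₀ hN]
    have : 3 * (n / 3) ≤ n := Nat.mul_div_le n 3
    have : 3 * ((n / 3 : ℕ) : ℝ) ≤ n := by exact_mod_cast this
    linarith
  have x2 : 1 / 3 - 1 / n ≤ x := by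
    rw [hm, le_div_iff₀ hN]
    have : n ≤ 3 * (n / 3) + 3 := by omega
    have : (n : ℝ) ≤ 3 * ((n / 3 : ℕ) : ℝ) + 3 := by exact_mod_cast this
    have e : (1 / 3 - 1 / (n : ℝ)) * n = n / 3 - 1 := by field_simp
    rw [e]; linarith
  have x0 : 0 ≤ x := mass_nonneg _ uni_nonneg _ _
  have i1 : (1 : ℝ) / n ≤ 1 := by rw [div_le_one hN]; exact hN1
  have i0 : (0 : ℝ) < 1 / n := by positivity
  set r : ℝ := 1 / n with hr
  have e1 : 105 / (n : ℝ) = 105 * r := by rw [hr]; ring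
  rw [e1]
  set y := 1 / 3 - x with hy
  have hxy : x = 1 / 3 - y := by rw [hy]; ring
  have t1 : x * (1 - x) - 2 / 9 = -(y * (2 / 3 - x)) := by rw [hxy]; ring
  have t2 : (x * (1 - x) - 2 / 9) ^ 2 ≤ r := by
    rw [t1]
    have a0 : 0 ≤ y * (2 / 3 - x) := mul_nonneg (by linarith) (by linarith)
    have a1 : y * (2 / 3 - x) ≤ r := by nlinarith
    nlinarith
  have t3 : x * (1 - x) + 1 / 9 ≤ 1 := by nlinarith
  have t4 : (x * (1 - x) - 2 / 9) ^ 2 * (x * (1 - x) + 1 / 9) ≤ (x * (1 - x) - 2 / 9) ^ 2 * 1 :=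
    mul_le_mul_of_nonneg_left t3 (sq_nonneg _)
  linarith

theorem mono_aux (W C' C g N : ℝ) (hW : 0 ≤ W) (h1 : 0 < C') (h2 : C' ≤ C) (hN : 0 < N) (h3 : W ≤ C' * g * N ^ 2) :
    W ≤ C * g * N ^ 2 := by
  have g0 : 0 ≤ g := by
    by_contra h
    push Not at h
    have h4 : C' * g * N ^ 2 < 0 :=
      mul_neg_of_neg_of_pos (mul_neg_of_pos_of_neg h1 h) (by positivity)
    linarith
  refine h3.trans ?_
  gcongr

theorem mono_aux2 (C a b N : ℝ) (hC : 0 < C) (h : a ≤ b) : C * a * N ^ 2 ≤ C * b * N ^ 2 := by gcongr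

set_option maxHeartbeats 1000000 in
theorem matrix_main : ∃ C : ℝ, 0 < C ∧ ∀ n : ℕ, C ≤ n → ∀ A : Fin n → Fin n → ℕ, (∀ i j, A i j = A j i) → (∀ i, A i i = 0) →
    (∀ i j, A i j ≤ 1) → ∃ c d : Fin n → Bool, (Wt A c : ℝ) ≤ C * (lamI (Kc d) - lamI A) * (n : ℝ) ^ 2 := by
  obtain ⟨k, hk⟩ : ∃ k : ℝ, k = 100 / 8427240 := ⟨_, rfl⟩
  obtain ⟨B, hB⟩ : ∃ B : ℝ, B = 210 / k := ⟨_, rfl⟩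
  obtain ⟨e, he⟩ : ∃ e : ℝ, e = k / 100000 := ⟨_, rfl⟩
  obtain ⟨τ, hτ⟩ : ∃ τ : ℝ, τ = k / 100000 := ⟨_, rfl⟩
  have k0 : 0 < k := by rw [hk]; norm_num
  have B0 : 0 < B := by rw [hB]; positivity
  have e0 : 0 < e := by rw [he]; positivity
  have τ0 : 0 < τ := by rw [hτ]; positivity
  refine ⟨1 + 2 / k + 8 / k + 1 / (6 * e ^ 2) + 2 / τ + B / τ + B / τ ^ 2 + (42 * B + 105) / e ^ 2, by positivity, ?_⟩
  obtain ⟨C, hC⟩ : ∃ C, C = 1 + 2 / k + 8 / k + 1 / (6 * e ^ 2) + 2 / τ + B / τ + B / τ ^ 2 + (42 * B + 105) / e ^ 2 := ⟨_, rfl⟩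
  rw [← hC]
  intro n hn A hs h0 hA
  have p1 : 0 < 2 / k := by positivity
  have p2 : 0 < 8 / k := by positivity
  have p3 : 0 < 1 / (6 * e ^ 2) := by positivity
  have p4 : 0 < 2 / τ := by positivity
  have p5 : 0 < B / τ := by positivity
  have p6 : 0 < B / τ ^ 2 := by positivity
  have p7 : 0 < (42 * B + 105) / e ^ 2 := by positivity
  have N1 : (1 : ℝ) ≤ n := by linarith
  have hN : (0 : ℝ) < n := by linarith
  have hn0 : 0 < n := by exact_mod_cast hN
  have hV : 0 < Fintype.card (Fin n) := by simpa using hn0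
  obtain ⟨c, hc1, hc2⟩ := color hV A hs h0 hA
  obtain ⟨d, hd⟩ := star_color n hn0
  have fl := flag_ineq (uni (Fin n)) uni_nonneg (uni_sum hV) A hs h0 hA
  have lu := lamI_le A
  rw [Fintype.card_fin] at hc2
  rw [← hk] at fl
  set β := Ex (uni (Fin n)) (fun g : Fin 3 → Fin n => (odd3 A (g 0) (g 1) (g 2) : ℝ)) with hβ
  -- reduction to a constant
  have fin : ∀ (d : Fin n → Bool) (C' : ℝ), 0 < C' → C' ≤ C → (Wt A c : ℝ) ≤ C' * (lamI (Kc d) - lamI A) * (n : ℝ) ^ 2 →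
      (Wt A c : ℝ) ≤ C * (lamI (Kc d) - lamI A) * (n : ℝ) ^ 2 := by
    intro d C' h1 h2 h3
    exact mono_aux _ _ _ _ _ (Nat.cast_nonneg _) h1 h2 hN h3
  by_cases h1 : B ≤ β * n
  · refine ⟨c, d, fin d (2 / k) p1 (by linarith) ?_⟩
    have : 105 / (n : ℝ) ≤ k * β / 2 := by
      rw [div_le_iff₀ hN]
      rw [hB, div_le_iff₀ k0] at h1
      linarith
    have g : k * β / 2 ≤ lamI (Kc d) - lamI A := by linarith
    calc (Wt A c : ℝ) ≤ n ^ 2 * β := hc2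
      _ = 2 / k * (k * β / 2) * n ^ 2 := by field_simp
      _ ≤ _ := mono_aux2 _ _ _ _ (by positivity) (by assumption)
  · push Not at h1
    have hW : (Wt A c : ℝ) ≤ B * n := by
      refine hc2.trans ?_
      nlinarith
    have tk := ten_K hV A h0 c
    rw [K7_formula (uni (Fin n)) (uni_sum hV) c _ rfl, Fintype.card_fin] at tk
    set x := mass (uni (Fin n)) c true with hx
    have x0 : 0 ≤ x := mass_nonneg _ uni_nonneg _ _
    have x1 : 0 ≤ 1 - x := by
      have h := mass_add (uni (Fin n)) c
      rw [uni_sum hV] at h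
      have := mass_nonneg (uni (Fin n)) uni_nonneg c false
      linarith
    by_cases h2 : e ≤ |x * (1 - x) - 2 / 9|
    · refine ⟨c, d, fin d (1 / (6 * e ^ 2)) p3 (by linarith) ?_⟩
      have q1 : e ^ 2 ≤ (x * (1 - x) - 2 / 9) ^ 2 := by
        rw [← sq_abs (x * (1 - x) - 2 / 9)]; gcongr
      have q2 : 7 * e ^ 2 ≤ 63 * (x * (1 - x) - 2 / 9) ^ 2 * (x * (1 - x) + 1 / 9) := by
        have : 0 ≤ x * (1 - x) := mul_nonneg x0 x1
        nlinarith
      have q3 : (Wt A c : ℝ) / n ^ 2 ≤ B / n := by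
        rw [div_le_div_iff₀ (by positivity) hN]; nlinarith
      have q4 : (42 * B + 105) / n ≤ e ^ 2 := by
        rw [div_le_iff₀ hN]
        have : (42 * B + 105) / e ^ 2 ≤ n := by linarith
        rw [div_le_iff₀ (by positivity)] at this
        linarith
      have q5 : (42 * B + 105) / (n : ℝ) = 42 * (B / n) + 105 / n := by ring
      have g : 6 * e ^ 2 ≤ lamI (Kc d) - lamI A := by linarith
      have w : (Wt A c : ℝ) ≤ n ^ 2 := by
        have : Wt A c ≤ n * n := by
          rw [Wt]
          calc ∑ v, wdeg A c v ≤ ∑ _v : Fin n, n := Finset.sum_le_sum (fun v _ => by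
                  have := hc1 v
                  rw [Fintype.card_fin] at this; omega)
            _ = n * n := by simp
        have : (Wt A c : ℝ) ≤ n * n := by exact_mod_cast this
        linarith [sq (n : ℝ)]
      calc (Wt A c : ℝ) ≤ n ^ 2 := w
        _ = 1 / (6 * e ^ 2) * (6 * e ^ 2) * n ^ 2 := by field_simp
        _ ≤ _ := mono_aux2 _ _ _ _ (by positivity) (by assumption)
    · push Not at h2
      refine ⟨c, c, fin c (8 / k) p2 (by linarith) ?_⟩
      have fac : |x - 1 / 3| * |x - 2 / 3| < e := by
        rw [← abs_mul]
        have : (x - 1 / 3) * (x - 2 / 3) = -(x * (1 - x) - 2 / 9) := by ring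
        rw [this, abs_neg]; exact h2
      have e1 : 6 * e ≤ 1 / 12 := by rw [he, hk]; norm_num
      have near : ∃ p : ℝ, (p = 1 / 3 ∨ p = 2 / 3) ∧ |x - p| ≤ 6 * e := by
        rcases le_total x (1 / 2) with h | h
        · refine ⟨1 / 3, Or.inl rfl, ?_⟩
          have : 1 / 6 ≤ |x - 2 / 3| := by rw [abs_sub_comm]; exact le_trans (by linarith) (le_abs_self _)
          nlinarith [abs_nonneg (x - 1 / 3)]
        · refine ⟨2 / 3, Or.inr rfl, ?_⟩
          have : 1 / 6 ≤ |x - 1 / 3| := le_trans (by linarith) (le_abs_self _)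
          nlinarith [abs_nonneg (x - 2 / 3)]
      obtain ⟨p, hp, hxp⟩ := near
      obtain ⟨ν, n1, n2, n3⟩ := exists_nu hV c p (6 * e) hp e1 hxp
      have hM : 432 * ((2 + √(B * n)) / Fintype.card (Fin n) + B * n / (Fintype.card (Fin n)) ^ 2) ≤ 100 / 8427240 / 56 := by
        rw [Fintype.card_fin, ← hk]
        have s1 : 2 / (n : ℝ) ≤ τ := by
          rw [div_le_iff₀ hN]
          have : 2 / τ ≤ n := by linarith
          rw [div_le_iff₀ τ0] at this; linarith
        have s2 : B * n / (n : ℝ) ^ 2 ≤ τ := by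
          have : B / τ ≤ n := by linarith
          rw [div_le_iff₀ τ0] at this
          rw [div_le_iff₀ (by positivity)]; nlinarith
        have s3 : √(B * n) / n ≤ τ := by
          rw [div_le_iff₀ hN]
          refine Real.sqrt_le_iff.2 ⟨by positivity, ?_⟩
          have : B / τ ^ 2 ≤ n := by linarith
          rw [div_le_iff₀ (by positivity)] at this
          nlinarith
        rw [add_div]
        rw [hτ] at s1 s2 s3
        linarith
      have r := induct hV c ν n1 (by rw [n2]; exact hp) (4 * (6 * e)) (by positivity) (by rw [← hk, he]; linarith) n3 (B * n) hM
        (Wt A c) A hs h0 hA hc1 rfl hW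
      rw [Fintype.card_fin, ← hk] at r
      calc (Wt A c : ℝ) = 8 / k * (k / 8 * Wt A c / n ^ 2) * n ^ 2 := by field_simp
        _ ≤ _ := mono_aux2 _ _ _ _ (by positivity) (by assumption)
end approx

set_option linter.unusedSectionVars false

section graph

variable {n : ℕ}

noncomputable def adjM (G : SimpleGraph (Fin n)) (i j : Fin n) : ℕ := if G.Adj i j then 1 else 0

theorem adjM_symm (G : SimpleGraph (Fin n)) (i j) : adjM G i j = adjM G j i := by simp only [adjM, G.adj_comm]
theorem adjM_irr (G : SimpleGraph (Fin n)) (i) : adjM G i i = 0 := by simp [adjM]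
theorem adjM_le (G : SimpleGraph (Fin n)) (i j) : adjM G i j ≤ 1 := by rw [adjM]; split_ifs <;> norm_num

theorem edge_sum (G : SimpleGraph (Fin n)) (S : Finset (Fin n)) : ∑ x ∈ S, ∑ y ∈ S, adjM G x y = 2 * edgeCount G S := by
  have h : edgeCount G S = ∑ x ∈ S, ∑ y ∈ S, if x < y then adjM G x y else 0 := by
    rw [edgeCount, Finset.card_filter, Fintype.sum_prod_type]
    rw [← Finset.sum_filter_add_sum_filter_not univ (fun x => x ∈ S)]
    rw [Finset.sum_eq_zero (s := univ.filter (fun x => ¬ x ∈ S)), add_zero]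
    · rw [Finset.filter_mem_eq_inter, Finset.univ_inter]
      refine Finset.sum_congr rfl (fun x hx => ?_)
      rw [← Finset.sum_filter_add_sum_filter_not univ (fun x => x ∈ S)]
      rw [Finset.sum_eq_zero (s := univ.filter (fun x => ¬ x ∈ S)), add_zero]
      · rw [Finset.filter_mem_eq_inter, Finset.univ_inter]
        refine Finset.sum_congr rfl (fun y hy => ?_)
        by_cases h1 : x < y <;> by_cases h2 : G.Adj x y <;> simp [hx, hy, h1, h2, adjM]
      · intro y hy
        simp [(Finset.mem_filter.1 hy).2]
    · intro y hy
      simp [(Finset.mem_filter.1 hy).2]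
  have h2 : ∑ x ∈ S, ∑ y ∈ S, adjM G x y = ∑ x ∈ S, ∑ y ∈ S, ((if x < y then adjM G x y else 0) + (if y < x then adjM G y x else 0)) := by
    refine Finset.sum_congr rfl (fun x _ => Finset.sum_congr rfl (fun y _ => ?_))
    rcases lt_trichotomy x y with h | h | h
    · simp [h, not_lt.2 h.le]
    · simp [h, adjM_irr]
    · simp [h, not_lt.2 h.le, adjM_symm G x y]
  rw [h2]
  simp only [Finset.sum_add_distrib]
  rw [Finset.sum_comm (f := fun x y => if y < x then adjM G y x else 0), ← h]
  ring

theorem dD_image (G : SimpleGraph (Fin n)) (f : Fin 7 → Fin n) (hf : Function.Injective f) :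
    dD (pull (adjM G) f) = 2 * edgeCount G (univ.image f) := by
  rw [← edge_sum, Finset.sum_image (fun a _ b _ h => hf h)]
  simp only [dD, dg, pull]
  refine Finset.sum_congr rfl (fun i _ => ?_)
  rw [Finset.sum_image (fun a _ b _ h => hf h)]

theorem fiber_card (S : Finset (Fin n)) (hS : S.card = 7) :
    ((univ : Finset (Fin 7 → Fin n)).filter (fun f => Function.Injective f ∧ univ.image f = S)).card = 5040 := by
  have h : (univ : Finset (Equiv.Perm (Fin 7))).card = 5040 := by
    rw [Finset.card_univ, Fintype.card_perm, Fintype.card_fin]; rfl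
  rw [← h]
  symm
  refine Finset.card_bij (fun σ _ => fun i => S.orderEmbOfFin hS (σ i)) ?_ ?_ ?_
  · intro σ _
    refine Finset.mem_filter.2 ⟨mem_univ _, ?_, ?_⟩
    · intro i j hij
      exact σ.injective ((S.orderEmbOfFin hS).injective hij)
    · have : (univ.image fun i => S.orderEmbOfFin hS (σ i)) = (univ.image σ).image (S.orderEmbOfFin hS) := by
        rw [Finset.image_image]; rfl
      rw [this, Finset.image_univ_equiv, Finset.image_orderEmbOfFin_univ]
  · intro σ _ τ _ h
    ext i
    have := congrFun h i
    rw [(S.orderEmbOfFin hS).injective this]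
  · intro f hf
    obtain ⟨hi, him⟩ := (Finset.mem_filter.1 hf).2
    have hm : ∀ i, f i ∈ S := fun i => by rw [← him]; exact Finset.mem_image_of_mem f (mem_univ i)
    set g : Fin 7 → Fin 7 := fun i => (S.orderIsoOfFin hS).symm ⟨f i, hm i⟩ with hg
    have gi : Function.Injective g := by
      intro i j hij
      have := (S.orderIsoOfFin hS).symm.injective hij
      exact hi (Subtype.mk.inj this)
    refine ⟨Equiv.ofBijective g (Finite.injective_iff_bijective.1 gi), mem_univ _, ?_⟩
    funext i
    rw [Equiv.ofBijective_apply, ← Finset.coe_orderIsoOfFin_apply, hg]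
    simp

theorem count_inj (G : SimpleGraph (Fin n)) :
    ((univ : Finset (Fin 7 → Fin n)).filter (fun f => Function.Injective f ∧ dD (pull (adjM G) f) = 20)).card = 5040 * numKL 7 10 G := by
  rw [Finset.card_eq_sum_card_fiberwise (f := fun f => univ.image f) (t := (Finset.powersetCard 7 univ).filter (fun S => edgeCount G S = 10))]
  · rw [numKL, Finset.sum_const_nat (m := 5040)]
    · ring
    · intro S hS
      obtain ⟨h1, h2⟩ := Finset.mem_filter.1 hS
      rw [← fiber_card S (Finset.mem_powersetCard.1 h1).2]
      congr 1
      ext f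
      simp only [Finset.mem_filter, Finset.mem_univ, true_and]
      constructor
      · rintro ⟨⟨a, b⟩, c⟩; exact ⟨a, c⟩
      · rintro ⟨a, c⟩
        refine ⟨⟨a, ?_⟩, c⟩
        rw [dD_image G f a, c, h2]
  · intro f hf
    have hf' := Finset.mem_filter.1 (Finset.mem_coe.1 hf)
    obtain ⟨a, b⟩ := hf'.2
    rw [dD_image G f a] at b
    refine Finset.mem_coe.2 (Finset.mem_filter.2 ⟨Finset.mem_powersetCard.2 ⟨Finset.subset_univ _, ?_⟩, ?_⟩)
    · rw [Finset.card_image_of_injective _ a]; simp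
    · show edgeCount G (univ.image f) = 10
      omega

theorem lamI_count (G : SimpleGraph (Fin n)) : lamI (adjM G) = (1 / (n : ℝ)) ^ 7 * (5040 * numKL 7 10 G : ℕ) := by
  rw [← count_inj, Finset.card_filter, lamI, Ex_def (uni (Fin n)) inferInstance]
  push_cast
  rw [Finset.mul_sum]
  refine Finset.sum_congr rfl (fun f _ => ?_)
  have : ∏ i : Fin 7, uni (Fin n) (f i) = (1 / (n : ℝ)) ^ 7 := by simp [uni]
  rw [this, injten, ten, ite_and]
  congr

theorem lamKL_eq (hn : 7 ≤ n) (G : SimpleGraph (Fin n)) : lamKL 7 10 G = (n : ℝ) ^ 7 / (n.descFactorial 7 : ℝ) * lamI (adjM G) := by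
  have hN : (0 : ℝ) < n := by exact_mod_cast (by omega : 0 < n)
  have hc : (0 : ℝ) < n.choose 7 := by exact_mod_cast Nat.choose_pos hn
  rw [lamI_count, lamKL, Nat.descFactorial_eq_factorial_mul_choose]
  have : Nat.factorial 7 = 5040 := rfl
  rw [this]
  push_cast
  field_simp

theorem ratio_ge (hn : 7 ≤ n) : 1 ≤ (n : ℝ) ^ 7 / (n.descFactorial 7 : ℝ) := by
  have hc : (0 : ℝ) < n.descFactorial 7 := by exact_mod_cast Nat.descFactorial_pos.2 hn
  rw [le_div_iff₀ hc, one_mul]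
  exact_mod_cast Nat.descFactorial_le_pow n 7

theorem ratio_le (hn : 7 ≤ n) : (n : ℝ) ^ 7 / (n.descFactorial 7 : ℝ) ≤ ((n : ℝ) / (n + (-6))) ^ 7 := by
  have h6 : (0 : ℝ) < n + (-6) := by
    have : (7 : ℝ) ≤ n := by exact_mod_cast hn
    linarith
  rw [div_pow]
  have h : (n + 1 - 7) ^ 7 ≤ n.descFactorial 7 := Nat.pow_sub_le_descFactorial n 7
  have e : ((n + 1 - 7 : ℕ) : ℝ) = n + (-6) := by
    rw [Nat.cast_sub (by omega)]; push_cast; ring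
  have h' : ((n : ℝ) + (-6)) ^ 7 ≤ n.descFactorial 7 := by rw [← e]; exact_mod_cast h
  gcongr

def bipG (d : Fin n → Bool) : SimpleGraph (Fin n) where
  Adj u v := d u ≠ d v
  symm := ⟨fun _ _ h => Ne.symm h⟩
  loopless := ⟨fun _ h => h rfl⟩

theorem adjM_bip (d : Fin n → Bool) : adjM (bipG d) = Kc d := by
  funext u v
  simp only [adjM, Kc, KB, bipG]
  by_cases h : d u = d v <;> simp [h]

theorem bip_cb (d : Fin n → Bool) : isCompleteBipartite (bipG d) := by
  refine ⟨fun u => if d u = true then 1 else 0, fun u v => ?_⟩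
  show d u ≠ d v ↔ _
  cases hu : d u <;> cases hv : d v <;> simp [hu, hv]

theorem le_max (G : SimpleGraph (Fin n)) : lamKL 7 10 G ≤ lamKLmax 7 10 n :=
  le_ciSup (f := fun G : SimpleGraph (Fin n) => lamKL 7 10 G) (Set.finite_range _).bddAbove G

theorem lamI_up (hn : 0 < n) (G : SimpleGraph (Fin n)) : lamI (adjM G) ≤ 28 / 81 := by
  have hV : 0 < Fintype.card (Fin n) := by simpa using hn
  have fl := flag_ineq (uni (Fin n)) uni_nonneg (uni_sum hV) (adjM G) (adjM_symm G) (adjM_irr G) (adjM_le G)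
  have := Ex_nonneg (uni (Fin n)) uni_nonneg (fun g : Fin 3 → Fin n => (odd3 (adjM G) (g 0) (g 1) (g 2) : ℝ)) (fun _ => Nat.cast_nonneg _)
  have := lamI_le (adjM G)
  linarith

theorem dist_le (G : SimpleGraph (Fin n)) (c : Fin n → Bool) : distToFam G isCompleteBipartite ≤ Wt (adjM G) c := by
  have h1 : distToFam G isCompleteBipartite ≤ editDist G (bipG c) :=
    ciInf_le (f := fun H : {H : SimpleGraph (Fin n) // isCompleteBipartite H} => editDist G H.1) (OrderBot.bddBelow _) ⟨bipG c, bip_cb c⟩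
  refine h1.trans ?_
  have h2 : editDist G (bipG c) ≤ (Finset.univ.filter (fun p : Fin n × Fin n =>
      p.1 < p.2 ∧ ¬ (G.Adj p.1 p.2 ↔ (bipG c).Adj ((1 : Equiv.Perm (Fin n)) p.1) ((1 : Equiv.Perm (Fin n)) p.2)))).card :=
    ciInf_le (f := fun σ : Equiv.Perm (Fin n) => (Finset.univ.filter (fun p : Fin n × Fin n =>
      p.1 < p.2 ∧ ¬ (G.Adj p.1 p.2 ↔ (bipG c).Adj (σ p.1) (σ p.2)))).card) (OrderBot.bddBelow _) 1
  refine h2.trans ?_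
  rw [Finset.card_filter, Fintype.sum_prod_type]
  simp only [Wt, wdeg]
  refine Finset.sum_le_sum (fun x _ => Finset.sum_le_sum (fun y _ => ?_))
  rw [Zn, ← adjM_bip]
  simp only [adjM, Equiv.Perm.coe_one, id]
  by_cases h : G.Adj x y <;> by_cases h' : (bipG c).Adj x y <;> simp [h, h']
  all_goals split_ifs <;> norm_num
end graph

theorem limit_part : Filter.Tendsto (fun n => lamKLmax 7 10 n) Filter.atTop (nhds (28/81)) := by
  have l1 : Filter.Tendsto (fun n : ℕ => (28 / 81 : ℝ) - 105 / (n : ℝ)) Filter.atTop (nhds (28 / 81)) := by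
    have := (tendsto_const_nhds (x := (28 / 81 : ℝ))).sub (tendsto_const_div_atTop_nhds_zero_nat (105 : ℝ))
    simpa using this
  have l2 : Filter.Tendsto (fun n : ℕ => ((n : ℝ) / (n + (-6))) ^ 7 * (28 / 81)) Filter.atTop (nhds (28 / 81)) := by
    have := ((tendsto_natCast_div_add_atTop (𝕜 := ℝ) (-6)).pow 7).mul_const (28 / 81 : ℝ)
    simpa using this
  refine tendsto_of_tendsto_of_tendsto_of_le_of_le' l1 l2 ?_ ?_
  · filter_upwards [Filter.eventually_ge_atTop 7] with n hn
    obtain ⟨d, hd⟩ := star_color n (by omega)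
    have h := le_max (bipG d)
    rw [lamKL_eq hn, adjM_bip] at h
    have := mul_le_mul_of_nonneg_right (ratio_ge hn) (lamI_nonneg (Kc d))
    linarith
  · filter_upwards [Filter.eventually_ge_atTop 7] with n hn
    refine ciSup_le (fun G => ?_)
    rw [lamKL_eq hn]
    exact mul_le_mul (ratio_le hn) (lamI_up (by omega) G) (lamI_nonneg _) (le_trans (le_trans zero_le_one (ratio_ge hn)) (ratio_le hn))

theorem stab_aux (W C a b r N M L : ℝ) (hW : 0 ≤ W) (hC : 0 < C) (hr : 1 ≤ r) (hN : 0 < N)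
    (h : W ≤ C * (b - a) * N ^ 2) (hM : r * b ≤ M) (hL : L = r * a) : W ≤ (C + 7) * (M - L) * N ^ 2 := by
  have g0 : 0 ≤ b - a := by
    by_contra h'
    push Not at h'
    have h4 : C * (b - a) * N ^ 2 < 0 :=
      mul_neg_of_neg_of_pos (mul_neg_of_pos_of_neg hC h') (by positivity)
    linarith
  have g1 : b - a ≤ M - L := by nlinarith
  refine mono_aux W C (C + 7) _ N hW hC (by linarith) hN (h.trans ?_)
  exact mono_aux2 _ _ _ _ hC g1

theorem stab_part : ∃ C : ℝ, 0 < C ∧ ∀ n : ℕ, (C ≤ n) → ∀ G : SimpleGraph (Fin n),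
      (distToFam G isCompleteBipartite : ℝ) ≤ C * (lamKLmax 7 10 n - lamKL 7 10 G) * n ^ 2 := by
  obtain ⟨C, hC, h⟩ := matrix_main
  refine ⟨C + 7, by linarith, fun n hn G => ?_⟩
  have h7 : (7 : ℝ) ≤ n := by linarith
  have hn7 : 7 ≤ n := by exact_mod_cast h7
  obtain ⟨c, d, hcd⟩ := h n (by linarith) (adjM G) (adjM_symm G) (adjM_irr G) (adjM_le G)
  have hW : (distToFam G isCompleteBipartite : ℝ) ≤ Wt (adjM G) c := by exact_mod_cast dist_le G c
  refine hW.trans ?_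
  have hm := le_max (bipG d)
  rw [lamKL_eq hn7, adjM_bip] at hm
  exact stab_aux _ C _ _ _ _ _ _ (Nat.cast_nonneg _) hC (ratio_ge hn7) (by linarith) hcd hm (lamKL_eq hn7 G)

theorem edge_inducibility_7_10 :
    Filter.Tendsto (fun n => lamKLmax 7 10 n) Filter.atTop (nhds (28/81)) ∧
    ∃ C : ℝ, 0 < C ∧ ∀ n : ℕ, (C ≤ n) → ∀ G : SimpleGraph (Fin n),
      (distToFam G isCompleteBipartite : ℝ) ≤ C * (lamKLmax 7 10 n - lamKL 7 10 G) * n ^ 2 := by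
  exact ⟨limit_part, stab_part⟩
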